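/- arXiv:1602.07629 — 3 statements merged into one kernel-verified Lean document; each statement's English description precedes it below -/
import Mathlib

section
/- Let n ≥ 2 and let B ⊆ ℝⁿ be a Borel set with Hausdorff dimension dim B > n − 1. Then there exists a set E ⊆ ℝⁿ with dim E ≤ 2(n − 1) − dim B such that for every x ∈ ℝⁿ \ E, the radial projection π_x(B) has positive (n − 1)-dimensional Hausdorff measure, i.e. H^{n−1}(π_x(B \ {x})) > 0. -/
open MeasureTheory Metric Set
open scoped ENNReal NNReal

/-- The radial projection with base point `x`, applied to the set `B`:
`π_x(B) = {(y - x)/‖y - x‖ : y ∈ B \ {x}}`. -/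
noncomputable def radialProj {n : ℕ} (x : EuclideanSpace ℝ (Fin n))
    (B : Set (EuclideanSpace ℝ (Fin n))) : Set (EuclideanSpace ℝ (Fin n)) :=
  (fun y => ‖y - x‖⁻¹ • (y - x)) '' (B \ {x})

section NetContent

variable {α β : Type*}

/-- The cell `c = (k, q)` of the sequence of partitions of `α` into the fibres of `ix k`. -/
def netCell (ix : ℕ → α → β) (c : ℕ × β) : Set α := {x | ix c.1 x = c.2}

/-- The partitions into the fibres of `ix k` become finer as `k` grows. -/
def IsNet (ix : ℕ → α → β) : Prop :=
  ∀ ⦃k l : ℕ⦄, k ≤ l → ∀ ⦃x y : α⦄, ix l x = ix l y → ix k x = ix k y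

/-- The total weight of a family of cells, a cell of generation `k` having weight `w k`. -/
noncomputable def netWeight (w : ℕ → ℝ≥0∞) (T : Set (ℕ × β)) : ℝ≥0∞ :=
  ∑' c, T.indicator (fun c => w c.1) c

/-- The net content: the infimum of the total weights of the coverings by cells. -/
noncomputable def netContent (ix : ℕ → α → β) (w : ℕ → ℝ≥0∞) (A : Set α) : ℝ≥0∞ :=
  ⨅ (T : Set (ℕ × β)) (_ : A ⊆ ⋃ c ∈ T, netCell ix c), netWeight w T

variable {ix : ℕ → α → β} {w : ℕ → ℝ≥0∞}

lemma netWeight_union_add_inter (S T : Set (ℕ × β)) :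
    netWeight w (S ∪ T) + netWeight w (S ∩ T) = netWeight w S + netWeight w T := by
  simp only [netWeight, ← ENNReal.tsum_add]
  congr 1
  ext c
  exact congrFun (indicator_union_add_inter (fun c : ℕ × β => w c.1) S T) c

lemma netWeight_iUnion_le {ι : Type*} (T : ι → Set (ℕ × β)) :
    netWeight w (⋃ i, T i) ≤ ∑' i, netWeight w (T i) := by
  simp only [netWeight]
  rw [ENNReal.tsum_comm]
  refine ENNReal.tsum_le_tsum fun c => ?_
  by_cases hc : c ∈ ⋃ i, T i
  · obtain ⟨i, hi⟩ := mem_iUnion.1 hc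
    rw [indicator_of_mem hc]
    calc w c.1 = (T i).indicator (fun c => w c.1) c := by rw [indicator_of_mem hi]
      _ ≤ _ := ENNReal.le_tsum (f := fun i => (T i).indicator (fun c => w c.1) c) i
  · rw [indicator_of_notMem hc]
    exact zero_le

lemma netContent_le {A : Set α} {T : Set (ℕ × β)} (h : A ⊆ ⋃ c ∈ T, netCell ix c) :
    netContent ix w A ≤ netWeight w T :=
  iInf₂_le T h

lemma exists_netWeight_lt {A : Set α} {γ : ℝ≥0∞} (h : netContent ix w A < γ) :
    ∃ T : Set (ℕ × β), A ⊆ ⋃ c ∈ T, netCell ix c ∧ netWeight w T < γ := by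
  simpa only [netContent, iInf_lt_iff, exists_prop] using h

lemma netContent_mono {A B : Set α} (h : A ⊆ B) : netContent ix w A ≤ netContent ix w B :=
  le_iInf₂ fun _ hT => netContent_le (h.trans hT)

lemma netWeight_empty : netWeight w (∅ : Set (ℕ × β)) = 0 := by
  simp [netWeight]

lemma netContent_empty : netContent ix w ∅ = 0 :=
  le_antisymm ((netContent_le (T := ∅) (by simp)).trans netWeight_empty.le) zero_le

lemma netWeight_singleton (c : ℕ × β) : netWeight w {c} = w c.1 := by
  rw [netWeight, tsum_eq_single c]
  · simp
  · intro b hb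
    simp [hb]

lemma netContent_cell_le (A : Set α) (c : ℕ × β) :
    netContent ix w (A ∩ netCell ix c) ≤ w c.1 :=
  (netContent_le (T := {c}) (by simp)).trans (netWeight_singleton c).le

lemma netContent_iUnion_le {ι : Type*} [Countable ι] (A : ι → Set α) :
    netContent ix w (⋃ i, A i) ≤ ∑' i, netContent ix w (A i) := by
  by_cases htop : ∑' i, netContent ix w (A i) = ∞
  · rw [htop]; exact le_top
  refine ENNReal.le_of_forall_pos_le_add fun ε hε _ => ?_
  obtain ⟨δ, hδ, hsum⟩ := ENNReal.exists_pos_sum_of_countable'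
    (ENNReal.coe_ne_zero.2 hε.ne') ι
  have hT : ∀ i, ∃ T : Set (ℕ × β), A i ⊆ ⋃ c ∈ T, netCell ix c ∧
      netWeight w T < netContent ix w (A i) + δ i := fun i =>
    exists_netWeight_lt (ENNReal.lt_add_right (ENNReal.ne_top_of_tsum_ne_top htop i) (hδ i).ne')
  choose T hcov hlt using hT
  calc netContent ix w (⋃ i, A i) ≤ netWeight w (⋃ i, T i) := by
        refine netContent_le (iUnion_subset fun i => (hcov i).trans ?_)
        exact biUnion_subset_biUnion_left (subset_iUnion T i)
    _ ≤ ∑' i, netWeight w (T i) := netWeight_iUnion_le T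
    _ ≤ ∑' i, (netContent ix w (A i) + δ i) := ENNReal.tsum_le_tsum fun i => (hlt i).le
    _ = ∑' i, netContent ix w (A i) + ∑' i, δ i := ENNReal.tsum_add
    _ ≤ _ := by gcongr

/-- The cells of `S` which do not meet a cell of `S` of a strictly earlier generation. -/
def netMaximal (ix : ℕ → α → β) (S : Set (ℕ × β)) : Set (ℕ × β) :=
  {c ∈ S | ∀ d ∈ S, d.1 < c.1 → Disjoint (netCell ix d) (netCell ix c)}

lemma IsNet.exists_mem_netMaximal (h : IsNet ix) {S : Set (ℕ × β)} {x : α} {c : ℕ × β}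
    (hc : c ∈ S) (hx : x ∈ netCell ix c) :
    ∃ d ∈ netMaximal ix S, x ∈ netCell ix d ∧ d.1 ≤ c.1 := by
  classical
  have hex : ∃ k, ∃ d ∈ S, d.1 = k ∧ x ∈ netCell ix d := ⟨c.1, c, hc, rfl, hx⟩
  obtain ⟨d, hd, hdk, hxd⟩ := Nat.find_spec hex
  refine ⟨d, ⟨hd, fun e he hlt => ?_⟩, hxd, hdk ▸ Nat.find_min' hex ⟨c, hc, rfl, hx⟩⟩
  rw [Set.disjoint_left]
  intro y hye hyd
  refine Nat.find_min hex (hdk ▸ hlt) ⟨e, he, rfl, ?_⟩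
  have hxy : ix d.1 x = ix d.1 y := Eq.trans hxd (Eq.symm hyd)
  exact (h hlt.le hxy).trans hye

/-- Strong subadditivity of the net content, in terms of coverings. -/
lemma netWeight_maximal_add_netContent_le {A B : Set α} (hAB : A ⊆ B)
    {S T : Set (ℕ × β)} (hS : A ⊆ ⋃ c ∈ S, netCell ix c) (hT : B ⊆ ⋃ c ∈ T, netCell ix c) :
    netWeight w (netMaximal ix (S ∪ T)) + netContent ix w A ≤ netWeight w S + netWeight w T := by
  set U := netMaximal ix (S ∪ T) with hU
  have hUsub : U ⊆ S ∪ T := fun c hc => hc.1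
  have hcov : A ⊆ ⋃ c ∈ ((S ∪ T) \ U) ∪ (S ∩ T), netCell ix c := by
    intro x hx
    obtain ⟨s, hs, hxs⟩ := mem_iUnion₂.1 (hS hx)
    obtain ⟨t, ht, hxt⟩ := mem_iUnion₂.1 (hT (hAB hx))
    rcases lt_trichotomy s.1 t.1 with hlt | heq | hlt
    · refine mem_iUnion₂.2 ⟨t, Or.inl ⟨Or.inr ht, fun htU => ?_⟩, hxt⟩
      exact Set.disjoint_left.1 (htU.2 s (Or.inl hs) hlt) hxs hxt
    · have : s = t := Prod.ext heq (by
        have h1 : ix s.1 x = s.2 := hxs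
        have h2 : ix t.1 x = t.2 := hxt
        rw [← h1, ← h2, heq])
      exact mem_iUnion₂.2 ⟨s, Or.inr ⟨hs, this ▸ ht⟩, hxs⟩
    · refine mem_iUnion₂.2 ⟨s, Or.inl ⟨Or.inl hs, fun hsU => ?_⟩, hxs⟩
      exact Set.disjoint_left.1 (hsU.2 t (Or.inr ht) hlt) hxt hxs
  have hdiff : netWeight w U + netWeight w ((S ∪ T) \ U) = netWeight w (S ∪ T) := by
    have := netWeight_union_add_inter (w := w) U ((S ∪ T) \ U)
    rw [union_sdiff_cancel hUsub, inter_sdiff_self, netWeight_empty, add_zero] at this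
    exact this.symm
  calc netWeight w U + netContent ix w A
      ≤ netWeight w U + (netWeight w ((S ∪ T) \ U) + netWeight w (S ∩ T)) := by
        gcongr
        refine (netContent_le hcov).trans ?_
        rw [← netWeight_union_add_inter]
        exact le_self_add
    _ = netWeight w S + netWeight w T := by
        rw [← add_assoc, hdiff, netWeight_union_add_inter]

lemma exists_nat_least {p : ℕ → Prop} (h : ∃ k, p k) : ∃ k, p k ∧ ∀ l, p l → k ≤ l := by
  classical
  exact ⟨Nat.find h, Nat.find_spec h, fun _ hl => Nat.find_min' h hl⟩

/-- The increasing sets lemma for the net content. -/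
lemma IsNet.netContent_iUnion_le_of_monotone (h : IsNet ix) {A : ℕ → Set α} (hA : Monotone A)
    {γ : ℝ≥0∞} (hγ : ∀ j, netContent ix w (A j) ≤ γ) : netContent ix w (⋃ j, A j) ≤ γ := by
  by_cases hγtop : γ = ∞
  · rw [hγtop]; exact le_top
  refine ENNReal.le_of_forall_pos_le_add fun ε hε _ => ?_
  obtain ⟨δ, hδ, hsum⟩ := ENNReal.exists_pos_sum_of_countable'
    (ENNReal.coe_ne_zero.2 hε.ne') ℕ
  have hfin : ∀ j, netContent ix w (A j) ≠ ∞ := fun j => ne_top_of_le_ne_top hγtop (hγ j)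
  have hT : ∀ j, ∃ T : Set (ℕ × β), A j ⊆ ⋃ c ∈ T, netCell ix c ∧
      netWeight w T < netContent ix w (A j) + δ j := fun j =>
    exists_netWeight_lt (ENNReal.lt_add_right (hfin j) (hδ j).ne')
  choose T hcov hlt using hT
  let U : ℕ → Set (ℕ × β) := fun j => Nat.rec (motive := fun _ => Set (ℕ × β)) (T 0)
    (fun j S => netMaximal ix (S ∪ T (j + 1))) j
  have hUsucc : ∀ j, U (j + 1) = netMaximal ix (U j ∪ T (j + 1)) := fun j => rfl
  have hUcov : ∀ j, A j ⊆ ⋃ c ∈ U j, netCell ix c := by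
    intro j
    cases j with
    | zero => exact hcov 0
    | succ j =>
      intro x hx
      obtain ⟨t, ht, hxt⟩ := mem_iUnion₂.1 (hcov (j + 1) hx)
      obtain ⟨d, hd, hxd, -⟩ := h.exists_mem_netMaximal (S := U j ∪ T (j + 1)) (Or.inr ht) hxt
      exact mem_iUnion₂.2 ⟨d, hd, hxd⟩
  have hUw : ∀ j, netWeight w (U j) ≤
      netContent ix w (A j) + ∑ i ∈ Finset.range (j + 1), δ i := by
    intro j
    induction j with
    | zero => simpa [U] using (hlt 0).le
    | succ j ih =>
      have key := netWeight_maximal_add_netContent_le (w := w) (hA j.le_succ) (hUcov j)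
        (hcov (j + 1))
      rw [← hUsucc] at key
      refine (ENNReal.add_le_add_iff_right (hfin j)).1 (key.trans ?_)
      calc netWeight w (U j) + netWeight w (T (j + 1))
          ≤ (netContent ix w (A j) + ∑ i ∈ Finset.range (j + 1), δ i) +
            (netContent ix w (A (j + 1)) + δ (j + 1)) := add_le_add ih (hlt (j + 1)).le
        _ = _ := by rw [Finset.sum_range_succ _ (j + 1)]; ring
  have hUle : ∀ j, netWeight w (U j) ≤ γ + ε := fun j =>
    (hUw j).trans (add_le_add (hγ j) ((ENNReal.sum_le_tsum _).trans hsum.le))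
  let V : Set (ℕ × β) := {c | ∀ᶠ j in Filter.atTop, c ∈ U j}
  have hVw : netWeight w V ≤ γ + ε := by
    rw [netWeight, ENNReal.tsum_eq_iSup_sum]
    refine iSup_le fun F => ?_
    have hev : ∀ᶠ j in Filter.atTop, ∀ c ∈ F, c ∈ V → c ∈ U j := by
      rw [Filter.eventually_all_finset]
      intro c _
      by_cases hc : c ∈ V
      · exact Filter.Eventually.mono hc fun j hj _ => hj
      · exact Filter.Eventually.of_forall fun j hc' => absurd hc' hc
    obtain ⟨j, hj⟩ := hev.exists
    calc ∑ c ∈ F, V.indicator (fun c => w c.1) c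
        ≤ ∑ c ∈ F, (U j).indicator (fun c => w c.1) c := by
          refine Finset.sum_le_sum fun c hc => ?_
          by_cases hcV : c ∈ V
          · rw [indicator_of_mem hcV, indicator_of_mem (hj c hc hcV)]
          · rw [indicator_of_notMem hcV]; exact zero_le
      _ ≤ netWeight w (U j) := ENNReal.sum_le_tsum F
      _ ≤ γ + ε := hUle j
  refine (netContent_le (T := V) ?_).trans hVw
  intro x hx
  obtain ⟨j, hxj⟩ := mem_iUnion.1 hx
  have hex : ∃ l : ℕ, ∃ k : ℕ, k ≥ j ∧ (l, ix l x) ∈ U k := by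
    obtain ⟨c, hc, hxc⟩ := mem_iUnion₂.1 (hUcov j hxj)
    have hxc' : ix c.1 x = c.2 := hxc
    exact ⟨c.1, j, le_rfl, by rwa [hxc']⟩
  obtain ⟨l, ⟨k, hjk, hk⟩, hmin⟩ : ∃ l : ℕ, (∃ k : ℕ, k ≥ j ∧ (l, ix l x) ∈ U k) ∧
      ∀ l' : ℕ, (∃ k : ℕ, k ≥ j ∧ (l', ix l' x) ∈ U k) → l ≤ l' :=
    exists_nat_least hex
  refine mem_iUnion₂.2 ⟨(l, ix l x), ?_, rfl⟩
  refine Filter.eventually_atTop.2 ⟨k, fun i hi => ?_⟩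
  induction i, hi using Nat.le_induction with
  | base => exact hk
  | succ i hki ih =>
    obtain ⟨d, hd, hxd, hdl⟩ := h.exists_mem_netMaximal (S := U i ∪ T (i + 1)) (x := x)
      (c := (l, ix l x)) (Or.inl ih) rfl
    have hxd' : ix d.1 x = d.2 := hxd
    have hdU : (d.1, ix d.1 x) ∈ U (i + 1) := by rw [hxd']; exact hd
    have : d.1 = l := le_antisymm hdl (hmin d.1 ⟨i + 1, by omega, hdU⟩)
    rwa [this] at hdU

end NetContent

section Dyadic

variable {n : ℕ}

/-- The index of the half-open dyadic cube of side `2⁻ᵏ` containing `x`. -/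
noncomputable def dyadicIndex (k : ℕ) (x : Fin n → ℝ) : Fin n → ℤ := fun i => ⌊2 ^ k * x i⌋

/-- The index of the parent of a dyadic cube. -/
def dyadicParent (q : Fin n → ℤ) : Fin n → ℤ := fun i => q i / 2

/-- The weight `2⁻ᵏᵃ` of a dyadic cube of generation `k`. -/
noncomputable def dyadicWeight (a : ℝ) (k : ℕ) : ℝ≥0∞ := ENNReal.ofReal ((2⁻¹ ^ k : ℝ) ^ a)

lemma dyadicParent_dyadicIndex (k : ℕ) (x : Fin n → ℝ) :
    dyadicParent (dyadicIndex (k + 1) x) = dyadicIndex k x := by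
  ext i
  have h := Int.floor_div_natCast (2 ^ (k + 1) * x i) 2
  simp only [dyadicParent, dyadicIndex]
  rw [show (2 : ℝ) ^ k * x i = 2 ^ (k + 1) * x i / (2 : ℕ) by push_cast; ring, h]
  rfl

lemma isNet_dyadicIndex : IsNet (dyadicIndex (n := n)) := by
  intro k l hkl x y hxy
  induction l, hkl using Nat.le_induction with
  | base => exact hxy
  | succ l _ ih =>
    refine ih ?_
    rw [← dyadicParent_dyadicIndex l x, ← dyadicParent_dyadicIndex l y, hxy]

lemma card_Icc_sub_one_add_one (q : Fin n → ℤ) :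
    (Finset.Icc (q - 1) (q + 1)).card = 3 ^ n := by
  rw [Pi.card_Icc]
  have : ∀ i, (Finset.Icc ((q - 1) i) ((q + 1) i)).card = 3 := by
    intro i
    simp only [Pi.sub_apply, Pi.add_apply, Pi.one_apply, Int.card_Icc]
    omega
  rw [Finset.prod_congr rfl fun i _ => this i]
  simp

lemma ediam_netCell_dyadicIndex_le (c : ℕ × (Fin n → ℤ)) :
    ediam (netCell dyadicIndex c) ≤ ENNReal.ofReal (2⁻¹ ^ c.1) := by
  refine ediam_le fun x hx y hy => ?_
  rw [edist_dist]
  refine ENNReal.ofReal_le_ofReal ((dist_pi_le_iff (by positivity)).2 fun i => ?_)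
  have hx' : ⌊2 ^ c.1 * x i⌋ = c.2 i := congrFun hx i
  have hy' : ⌊2 ^ c.1 * y i⌋ = c.2 i := congrFun hy i
  have h : |2 ^ c.1 * x i - 2 ^ c.1 * y i| < 1 := Int.abs_sub_lt_one_of_floor_eq_floor
    (hx'.trans hy'.symm)
  rw [← mul_sub, abs_mul, abs_of_pos (by positivity)] at h
  rw [Real.dist_eq, inv_pow, ← one_div, le_div_iff₀ (by positivity), mul_comm]
  exact h.le

lemma dyadicWeight_eq_rpow (a : ℝ) (k : ℕ) :
    dyadicWeight a k = (ENNReal.ofReal (2⁻¹ ^ k)) ^ a := by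
  rw [dyadicWeight, ENNReal.ofReal_rpow_of_pos (by positivity)]

lemma hausdorffMeasure_eq_zero_of_netContent_eq_zero {a : ℝ} (ha : 0 < a) {A : Set (Fin n → ℝ)}
    (h : netContent dyadicIndex (dyadicWeight a) A = 0) : μH[a] A = 0 := by
  have hT : ∀ N : ℕ, ∃ T : Set (ℕ × (Fin n → ℤ)), A ⊆ ⋃ c ∈ T, netCell dyadicIndex c ∧
      netWeight (dyadicWeight a) T < ((N : ℝ≥0∞) + 1)⁻¹ := fun N =>
    exists_netWeight_lt (h ▸ by simp)
  choose T hcov hlt using hT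
  have hlim : Filter.Tendsto (fun N : ℕ => ((N : ℝ≥0∞) + 1)⁻¹) Filter.atTop (nhds 0) := by
    have := (Filter.tendsto_add_atTop_iff_nat 1).2 ENNReal.tendsto_inv_nat_nhds_zero
    simpa using this
  have hsum : ∀ N, ∑' c : T N, ediam (netCell dyadicIndex (c : ℕ × (Fin n → ℤ))) ^ a
      ≤ ((N : ℝ≥0∞) + 1)⁻¹ := by
    intro N
    refine le_trans ?_ (hlt N).le
    rw [netWeight, ← tsum_subtype]
    refine ENNReal.tsum_le_tsum fun c => ?_
    rw [dyadicWeight_eq_rpow]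
    exact ENNReal.rpow_le_rpow (ediam_netCell_dyadicIndex_le _) ha.le
  have key := Measure.hausdorffMeasure_le_liminf_tsum (ι := fun N => T N) a A
    (l := Filter.atTop) (fun N : ℕ => (((N : ℝ≥0∞) + 1)⁻¹) ^ a⁻¹)
    (by simpa [ha] using hlim.ennrpow_const a⁻¹)
    (fun N c => netCell dyadicIndex (c : ℕ × (Fin n → ℤ)))
    (Filter.Eventually.of_forall fun N c => by
      have h1 : ediam (netCell dyadicIndex (c : ℕ × (Fin n → ℤ))) ^ a ≤ ((N : ℝ≥0∞) + 1)⁻¹ :=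
        (ENNReal.le_tsum c).trans (hsum N)
      exact (ENNReal.le_rpow_inv_iff ha).2 h1)
    (Filter.Eventually.of_forall fun N => by
      rw [iUnion_coe_set]
      exact hcov N)
  refine le_antisymm (key.trans ?_) zero_le
  calc _ ≤ Filter.liminf (fun N : ℕ => ((N : ℝ≥0∞) + 1)⁻¹) Filter.atTop :=
        Filter.liminf_le_liminf (Filter.Eventually.of_forall hsum)
    _ = 0 := hlim.liminf_eq

/-- The open neighbourhood of a dyadic cube obtained by enlarging it by half its side. -/
def dyadicNhd (c : ℕ × (Fin n → ℤ)) : Set (Fin n → ℝ) :=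
  {y | ∀ i, |2 ^ c.1 * y i - (c.2 i + 1 / 2)| < 1}

lemma isOpen_dyadicNhd (c : ℕ × (Fin n → ℤ)) : IsOpen (dyadicNhd c) := by
  simp only [dyadicNhd, ofPred_forall]
  exact isOpen_iInter_of_finite fun i => isOpen_lt (by fun_prop) continuous_const

lemma netCell_subset_dyadicNhd (c : ℕ × (Fin n → ℤ)) :
    netCell dyadicIndex c ⊆ dyadicNhd c := by
  intro x hx i
  have hx' : ⌊2 ^ c.1 * x i⌋ = c.2 i := congrFun hx i
  have h1 := Int.floor_le (2 ^ c.1 * x i)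
  have h2 := Int.lt_floor_add_one (2 ^ c.1 * x i)
  rw [hx'] at h1 h2
  rw [abs_lt]
  constructor <;> linarith

lemma dyadicNhd_subset (c : ℕ × (Fin n → ℤ)) :
    dyadicNhd c ⊆ ⋃ q ∈ Finset.Icc (c.2 - 1) (c.2 + 1), netCell dyadicIndex (c.1, q) := by
  intro x hx
  refine mem_iUnion₂.2 ⟨dyadicIndex c.1 x, ?_, rfl⟩
  rw [Finset.mem_Icc, Pi.le_def, Pi.le_def, ← forall_and]
  intro i
  have h := abs_lt.1 (hx i)
  simp only [Pi.sub_apply, Pi.add_apply, Pi.one_apply, dyadicIndex]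
  rw [Int.le_floor, ← Int.lt_add_one_iff, Int.floor_lt]
  push_cast
  constructor <;> linarith

lemma netContent_biUnion_dyadicNhd_le (a : ℝ) (T : Set (ℕ × (Fin n → ℤ))) :
    netContent dyadicIndex (dyadicWeight a) (⋃ c ∈ T, dyadicNhd c) ≤
      3 ^ n * netWeight (dyadicWeight a) T := by
  classical
  have hcell : ∀ c : ℕ × (Fin n → ℤ),
      netContent dyadicIndex (dyadicWeight a) (dyadicNhd c) ≤ 3 ^ n * dyadicWeight a c.1 := by
    intro c
    let S : Finset (ℕ × (Fin n → ℤ)) := (Finset.Icc (c.2 - 1) (c.2 + 1)).image (Prod.mk c.1)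
    refine (netContent_le (T := (S : Set (ℕ × (Fin n → ℤ)))) ?_).trans ?_
    · refine (dyadicNhd_subset c).trans fun x hx => ?_
      obtain ⟨q, hq, hxq⟩ := mem_iUnion₂.1 hx
      exact mem_iUnion₂.2 ⟨(c.1, q), by simpa [S] using hq, hxq⟩
    · rw [netWeight, ← tsum_subtype, Finset.tsum_subtype' S (fun c => dyadicWeight a c.1)]
      have : ∀ d ∈ S, dyadicWeight a d.1 = dyadicWeight a c.1 := by
        intro d hd
        obtain ⟨q, -, rfl⟩ := Finset.mem_image.1 hd
        rfl
      rw [Finset.sum_congr rfl this, Finset.sum_const, nsmul_eq_mul]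
      gcongr
      have hcard : S.card ≤ 3 ^ n :=
        Finset.card_image_le.trans (card_Icc_sub_one_add_one c.2).le
      exact_mod_cast hcard
  rw [biUnion_eq_iUnion]
  refine (netContent_iUnion_le _).trans ?_
  rw [netWeight, ← tsum_subtype, ← ENNReal.tsum_mul_left]
  exact ENNReal.tsum_le_tsum fun c => hcell c

end Dyadic

section Capacitability

variable {n : ℕ}

/-- A set which is analytic and has positive dyadic content contains a compact subset
of positive dyadic content. -/
lemma exists_isCompact_netContent_pos {a : ℝ} {B : Set (Fin n → ℝ)} (hB : AnalyticSet B)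
    (hpos : 0 < netContent dyadicIndex (dyadicWeight a) B) :
    ∃ K ⊆ B, IsCompact K ∧ 0 < netContent dyadicIndex (dyadicWeight a) K := by
  rw [AnalyticSet] at hB
  rcases hB with rfl | ⟨f, hf, rfl⟩
  · rw [netContent_empty] at hpos
    exact absurd hpos (lt_irrefl _)
  obtain ⟨γ, hγ0, hγ⟩ := exists_between hpos
  set cont := netContent (dyadicIndex (n := n)) (dyadicWeight a) with hcont
  have step : ∀ (k : ℕ) (S : {S : Set (ℕ → ℕ) // γ < cont (f '' S)}),
      ∃ N : ℕ, γ < cont (f '' (S.1 ∩ {σ | σ k ≤ N})) := by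
    intro k S
    by_contra! hcon
    have hmono : Monotone fun N : ℕ => f '' (S.1 ∩ {σ | σ k ≤ N}) := fun N N' h =>
      image_mono (inter_subset_inter_right _ fun σ (hσ : σ k ≤ N) => hσ.trans h)
    have := isNet_dyadicIndex.netContent_iUnion_le_of_monotone hmono hcon
    rw [← image_iUnion, ← inter_iUnion, iUnion_eq_univ_iff.2 fun σ => ⟨σ k, by simp⟩,
      inter_univ] at this
    exact absurd S.2 this.not_gt
  choose N hN using step
  let S : ℕ → {S : Set (ℕ → ℕ) // γ < cont (f '' S)} := fun k =>
    Nat.rec (motive := fun _ => {S : Set (ℕ → ℕ) // γ < cont (f '' S)})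
      ⟨univ, by rwa [image_univ]⟩ (fun k S => ⟨S.1 ∩ {σ | σ k ≤ N k S}, hN k S⟩) k
  let b : ℕ → ℕ := fun k => N k (S k)
  have hSsucc : ∀ k, (S (k + 1)).1 = (S k).1 ∩ {σ | σ k ≤ b k} := fun k => rfl
  have hS : ∀ k σ, σ ∈ (S k).1 → ∀ i < k, σ i ≤ b i := by
    intro k
    induction k with
    | zero => intro σ _ i hi; omega
    | succ k ih =>
      intro σ hσ i hi
      rw [hSsucc] at hσ
      rcases Nat.lt_succ_iff_lt_or_eq.1 hi with h | rfl
      · exact ih σ hσ.1 i h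
      · exact hσ.2
  let C : Set (ℕ → ℕ) := univ.pi fun i => Iic (b i)
  have hC : IsCompact C := isCompact_univ_pi fun i => (finite_Iic (b i)).isCompact
  refine ⟨f '' C, image_subset_range f C, hC.image hf, pos_iff_ne_zero.2 fun hzero => ?_⟩
  have h3 : (0 : ℝ≥0∞) < γ / 3 ^ n := ENNReal.div_pos hγ0.ne' (by finiteness)
  obtain ⟨T, hcov, hT⟩ := exists_netWeight_lt (hzero ▸ h3 : cont (f '' C) < γ / 3 ^ n)
  set U : Set (Fin n → ℝ) := ⋃ c ∈ T, dyadicNhd c with hU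
  have hUo : IsOpen U := isOpen_biUnion fun c _ => isOpen_dyadicNhd c
  have hCU : f '' C ⊆ U := hcov.trans (iUnion₂_mono fun c _ => netCell_subset_dyadicNhd c)
  have hsub : ∃ k, f '' (S k).1 ⊆ U := by
    by_contra! hcon
    have hσ : ∀ k, ∃ σ ∈ (S k).1, f σ ∉ U := by
      intro k
      obtain ⟨_, ⟨σ, hσ, rfl⟩, hU'⟩ := not_subset.1 (hcon k)
      exact ⟨σ, hσ, hU'⟩
    choose σ hσS hσU using hσ
    let τ : ℕ → ℕ → ℕ := fun k i => min (σ k i) (b i)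
    obtain ⟨ρ, hρ, φ, hφ, hlim⟩ := hC.tendsto_subseq (x := τ)
      fun k i _ => mem_Iic.2 (min_le_right _ _)
    have hlim' : Filter.Tendsto (σ ∘ φ) Filter.atTop (nhds ρ) := by
      rw [tendsto_pi_nhds] at hlim ⊢
      intro i
      refine (hlim i).congr' ?_
      filter_upwards [Filter.eventually_gt_atTop i] with k hk
      exact min_eq_left (hS _ _ (hσS (φ k)) i (hk.trans_le (hφ.id_le k)))
    have hev := (hf.tendsto ρ).comp hlim' |>.eventually
      (hUo.mem_nhds (hCU (mem_image_of_mem f hρ)))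
    obtain ⟨k, hk⟩ := hev.exists
    exact hσU (φ k) hk
  obtain ⟨k, hk⟩ := hsub
  have hlt : cont (f '' (S k).1) < γ := by
    calc cont (f '' (S k).1) ≤ cont U := netContent_mono hk
      _ ≤ 3 ^ n * netWeight (dyadicWeight a) T := netContent_biUnion_dyadicNhd_le a T
      _ < 3 ^ n * (γ / 3 ^ n) :=
        (ENNReal.mul_lt_mul_iff_right (by positivity) (by finiteness)).2 hT
      _ = γ := ENNReal.mul_div_cancel (by positivity) (by finiteness)
  exact absurd (S k).2 hlt.not_gt

end Capacitability

section Frostman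

variable {n : ℕ}

/-- The masses of the dyadic cubes obtained by splitting, generation by generation, the mass of a
cube among its children proportionally to their values under `g`. -/
noncomputable def splitMass (g : ℕ → (Fin n → ℤ) → ℝ≥0∞) (q₀ : Fin n → ℤ) :
    ℕ → (Fin n → ℤ) → ℝ≥0∞
  | 0, q => ({q₀} : Set (Fin n → ℤ)).indicator (g 0) q
  | k + 1, q => splitMass g q₀ k (dyadicParent q) * (g (k + 1) q /
      ∑' p : (dyadicParent ⁻¹' {dyadicParent q} : Set (Fin n → ℤ)), g (k + 1) p)

variable {g : ℕ → (Fin n → ℤ) → ℝ≥0∞} {q₀ : Fin n → ℤ}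

lemma splitMass_le
    (hg : ∀ k q, g k q ≤ ∑' p : (dyadicParent ⁻¹' {q} : Set (Fin n → ℤ)), g (k + 1) p)
    (k : ℕ) (q : Fin n → ℤ) :
    splitMass g q₀ k q ≤ g k q := by
  induction k generalizing q with
  | zero => exact indicator_le_self _ _ q
  | succ k ih =>
    rw [splitMass, ← mul_div_assoc, mul_comm, mul_div_assoc]
    calc g (k + 1) q * (splitMass g q₀ k (dyadicParent q) / _)
        ≤ g (k + 1) q * 1 := by
          gcongr
          exact ENNReal.div_le_of_le_mul (by rw [one_mul]; exact (ih _).trans (hg k _))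
      _ = g (k + 1) q := mul_one _

lemma tsum_children_splitMass
    (hg : ∀ k q, g k q ≤ ∑' p : (dyadicParent ⁻¹' {q} : Set (Fin n → ℤ)), g (k + 1) p)
    (hfin : ∀ k q, ∑' p : (dyadicParent ⁻¹' {q} : Set (Fin n → ℤ)), g (k + 1) p ≠ ∞)
    (k : ℕ) (q : Fin n → ℤ) :
    ∑' p : (dyadicParent ⁻¹' {q} : Set (Fin n → ℤ)), splitMass g q₀ (k + 1) p =
      splitMass g q₀ k q := by
  have h : ∀ p : dyadicParent ⁻¹' {q}, splitMass g q₀ (k + 1) p = splitMass g q₀ k q *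
      (g (k + 1) p / ∑' p : (dyadicParent ⁻¹' {q} : Set (Fin n → ℤ)), g (k + 1) p) := by
    rintro ⟨p, rfl⟩
    rfl
  rw [tsum_congr h, ENNReal.tsum_mul_left]
  simp only [div_eq_mul_inv]
  rw [ENNReal.tsum_mul_right, ← div_eq_mul_inv]
  by_cases h0 : ∑' p : (dyadicParent ⁻¹' {q} : Set (Fin n → ℤ)), g (k + 1) p = 0
  · have : splitMass g q₀ k q = 0 :=
      le_antisymm ((splitMass_le hg k q).trans ((hg k q).trans h0.le)) zero_le
    rw [this, zero_mul]
  · rw [ENNReal.div_self h0 (hfin k q), mul_one]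

lemma tsum_comp_dyadicParent_mul_splitMass
    (hg : ∀ k q, g k q ≤ ∑' p : (dyadicParent ⁻¹' {q} : Set (Fin n → ℤ)), g (k + 1) p)
    (hfin : ∀ k q, ∑' p : (dyadicParent ⁻¹' {q} : Set (Fin n → ℤ)), g (k + 1) p ≠ ∞)
    (k : ℕ)
    (F : (Fin n → ℤ) → ℝ≥0∞) :
    ∑' q, F (dyadicParent q) * splitMass g q₀ (k + 1) q = ∑' q, F q * splitMass g q₀ k q := by
  rw [← ENNReal.tsum_fiberwise _ (dyadicParent (n := n))]
  refine tsum_congr fun q => ?_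
  rw [← tsum_children_splitMass hg hfin k q, ← ENNReal.tsum_mul_left]
  refine tsum_congr ?_
  rintro ⟨p, rfl⟩
  rfl

lemma tsum_comp_iterate_dyadicParent_mul_splitMass
    (hg : ∀ k q, g k q ≤ ∑' p : (dyadicParent ⁻¹' {q} : Set (Fin n → ℤ)), g (k + 1) p)
    (hfin : ∀ k q, ∑' p : (dyadicParent ⁻¹' {q} : Set (Fin n → ℤ)), g (k + 1) p ≠ ∞) (j d : ℕ)
    (F : (Fin n → ℤ) → ℝ≥0∞) :
    ∑' q, F (dyadicParent^[d] q) * splitMass g q₀ (j + d) q =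
      ∑' q, F q * splitMass g q₀ j q := by
  induction d with
  | zero => rfl
  | succ d ih =>
    rw [← ih, ← tsum_comp_dyadicParent_mul_splitMass hg hfin (j + d)]
    rfl

lemma dyadicParent_iterate_dyadicIndex (j d : ℕ) (x : Fin n → ℝ) :
    dyadicParent^[d] (dyadicIndex (j + d) x) = dyadicIndex j x := by
  induction d with
  | zero => rfl
  | succ d ih =>
    rw [Function.iterate_succ_apply, ← ih, ← dyadicParent_dyadicIndex (j + d) x]
    rfl

lemma finite_preimage_dyadicParent (q : Fin n → ℤ) :
    (dyadicParent ⁻¹' {q} : Set (Fin n → ℤ)).Finite := by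
  refine (finite_Icc (fun i => 2 * q i) (fun i => 2 * q i + 1)).subset fun p hp => ?_
  have hp' : ∀ i, p i / 2 = q i := fun i => congrFun hp i
  rw [mem_Icc, Pi.le_def, Pi.le_def, ← forall_and]
  intro i
  have := hp' i
  constructor <;> omega

lemma closedBall_subset_biUnion_netCell {k : ℕ} {r : ℝ} (hr : 2 ^ k * r ≤ 1) (x : Fin n → ℝ) :
    closedBall x r ⊆ ⋃ q ∈ Finset.Icc (dyadicIndex k x - 1) (dyadicIndex k x + 1),
      netCell dyadicIndex (k, q) := by
  intro y hy
  refine mem_iUnion₂.2 ⟨dyadicIndex k y, ?_, rfl⟩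
  rw [Finset.mem_Icc, Pi.le_def, Pi.le_def, ← forall_and]
  intro i
  have h : |y i - x i| ≤ r := (dist_le_pi_dist y x i).trans hy
  have h' : |2 ^ k * y i - 2 ^ k * x i| ≤ 1 := by
    rw [← mul_sub, abs_mul, abs_of_pos (by positivity)]
    exact (mul_le_mul_of_nonneg_left h (by positivity)).trans hr
  rw [abs_le] at h'
  have h1 := Int.floor_le (2 ^ k * x i)
  have h2 := Int.lt_floor_add_one (2 ^ k * x i)
  simp only [Pi.sub_apply, Pi.add_apply, Pi.one_apply, dyadicIndex]
  rw [Int.le_floor, ← Int.lt_add_one_iff, Int.floor_lt]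
  push_cast
  constructor <;> linarith

lemma exists_two_pow_mul_le_one {r : ℝ} (hr : 0 < r) (hr1 : r ≤ 1) :
    ∃ k : ℕ, 2 ^ k * r ≤ 1 ∧ (2⁻¹ : ℝ) ^ k ≤ 2 * r := by
  obtain ⟨k, hk1, hk2⟩ := exists_nat_pow_near_of_lt_one hr hr1 (y := (2⁻¹ : ℝ))
    (by norm_num) (by norm_num)
  refine ⟨k, ?_, ?_⟩
  · rw [inv_pow] at hk2
    rwa [mul_comm, ← le_div_iff₀ (by positivity), one_div]
  · rw [pow_succ] at hk1
    linarith

/-- **Frostman's lemma** for compact sets. -/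
lemma exists_frostman_of_isCompact {a : ℝ} (ha : 0 ≤ a) {K : Set (Fin n → ℝ)} (hK : IsCompact K)
    (hpos : 0 < netContent dyadicIndex (dyadicWeight a) K) :
    ∃ μ : Measure (Fin n → ℝ), IsFiniteMeasure μ ∧ μ univ ≠ 0 ∧ μ Kᶜ = 0 ∧
      ∃ C : ℝ≥0, ∀ x, ∀ r : ℝ, 0 < r → μ (closedBall x r) ≤ C * ENNReal.ofReal (r ^ a) := by
  set cont := netContent (dyadicIndex (n := n)) (dyadicWeight a) with hcont
  let g : ℕ → (Fin n → ℤ) → ℝ≥0∞ := fun k q => cont (K ∩ netCell dyadicIndex (k, q))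
  have hgw : ∀ k q, g k q ≤ dyadicWeight a k := fun k q => netContent_cell_le K (k, q)
  have hg : ∀ k q, g k q ≤ ∑' p : (dyadicParent ⁻¹' {q} : Set (Fin n → ℤ)), g (k + 1) p := by
    intro k q
    refine (netContent_mono ?_).trans (netContent_iUnion_le _)
    rintro x ⟨hxK, hx⟩
    refine mem_iUnion.2 ⟨⟨dyadicIndex (k + 1) x, ?_⟩, hxK, rfl⟩
    exact (dyadicParent_dyadicIndex k x).trans hx
  have hfin : ∀ k q, ∑' p : (dyadicParent ⁻¹' {q} : Set (Fin n → ℤ)), g (k + 1) p ≠ ∞ := by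
    intro k q
    have := (finite_preimage_dyadicParent q).fintype
    rw [tsum_fintype]
    exact ENNReal.sum_ne_top.2 fun p _ => ne_top_of_le_ne_top ENNReal.ofReal_ne_top (hgw _ _)
  have hq₀ : ∃ q, g 0 q ≠ 0 := by
    by_contra! hcon
    refine hpos.ne' (le_antisymm ?_ zero_le)
    calc cont K ≤ cont (⋃ q, K ∩ netCell dyadicIndex (0, q)) :=
          netContent_mono fun x hx => mem_iUnion.2 ⟨dyadicIndex 0 x, hx, rfl⟩
      _ ≤ ∑' q, g 0 q := netContent_iUnion_le _
      _ = 0 := by simp [hcon]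
  obtain ⟨q₀, hq₀⟩ := hq₀
  let M := splitMass g q₀
  have hM0 : ∀ k q, ¬ (K ∩ netCell dyadicIndex (k, q)).Nonempty → M k q = 0 := by
    intro k q h
    refine le_antisymm ((splitMass_le hg k q).trans ?_) zero_le
    simp only [g, not_nonempty_iff_eq_empty.1 h]
    exact netContent_empty.le
  have htot : ∀ k, ∑' q, M k q = g 0 q₀ := by
    intro k
    have h := tsum_comp_iterate_dyadicParent_mul_splitMass (q₀ := q₀) hg hfin 0 k (fun _ => 1)
    simp only [one_mul, zero_add] at h
    rw [h, tsum_eq_single q₀]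
    · simp [splitMass]
    · intro q hq
      simp [splitMass, hq]
  have hg0top : g 0 q₀ ≠ ∞ := ne_top_of_le_ne_top ENNReal.ofReal_ne_top (hgw _ _)
  have hne : Nonempty K := by
    by_contra h
    refine hq₀ ?_
    have : K = ∅ := not_nonempty_iff_eq_empty.1 fun h' => h h'.to_subtype
    simp only [g, this, empty_inter]
    exact netContent_empty
  have hpt : ∀ k q, ∃ x : K, (K ∩ netCell dyadicIndex (k, q)).Nonempty →
      dyadicIndex k (x : Fin n → ℝ) = q := by
    intro k q
    by_cases h : (K ∩ netCell dyadicIndex (k, q)).Nonempty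
    · obtain ⟨x, hxK, hx⟩ := h
      exact ⟨⟨x, hxK⟩, fun _ => hx⟩
    · exact ⟨hne.some, fun h' => absurd h' h⟩
  choose pt hpt using hpt
  let m : ℕ → Measure K := fun k =>
    (g 0 q₀)⁻¹ • Measure.sum fun q => M k q • Measure.dirac (pt k q)
  have hm : ∀ k, IsProbabilityMeasure (m k) := by
    intro k
    refine ⟨?_⟩
    simp only [m, Measure.smul_apply, Measure.sum_apply _ MeasurableSet.univ, measure_univ,
      smul_eq_mul, mul_one]
    rw [htot]
    exact ENNReal.inv_mul_cancel hq₀ hg0top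
  have hcellM : ∀ j d q, m (j + d) {x : K | dyadicIndex j (x : Fin n → ℝ) = q} ≤
      (g 0 q₀)⁻¹ * dyadicWeight a j := by
    classical
    intro j d q
    have hmeas : MeasurableSet {x : K | dyadicIndex j (x : Fin n → ℝ) = q} := by
      have : {x : K | dyadicIndex j (x : Fin n → ℝ) = q} =
          ⋂ i, {x : K | ⌊2 ^ j * (x : Fin n → ℝ) i⌋ = q i} := by
        ext x
        simp [dyadicIndex, funext_iff]
      rw [this]
      refine MeasurableSet.iInter fun i => ?_
      exact measurableSet_eq_fun (Int.measurable_floor.comp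
        (((measurable_pi_apply i).comp measurable_subtype_coe).const_mul _)) measurable_const
    simp only [m, Measure.smul_apply, Measure.sum_apply _ hmeas, smul_eq_mul]
    gcongr
    have h := tsum_comp_iterate_dyadicParent_mul_splitMass (q₀ := q₀) hg hfin j d
      (fun p => if p = q then 1 else 0)
    simp only [ite_mul, one_mul, zero_mul, tsum_ite_eq] at h
    refine le_trans ?_ ((splitMass_le (q₀ := q₀) hg j q).trans (hgw j q))
    rw [← h]
    refine ENNReal.tsum_le_tsum fun p => ?_
    by_cases hp : (K ∩ netCell dyadicIndex (j + d, p)).Nonempty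
    · have hpp := hpt (j + d) p hp
      rw [Measure.dirac_apply' _ hmeas]
      by_cases hmem : pt (j + d) p ∈ {x : K | dyadicIndex j (x : Fin n → ℝ) = q}
      · have : dyadicParent^[d] p = q := by
          rw [← hpp, dyadicParent_iterate_dyadicIndex]
          exact hmem
        rw [if_pos this, indicator_of_mem hmem, Pi.one_apply, mul_one]
      · rw [indicator_of_notMem hmem, mul_zero]
        exact zero_le
    · have h0 : M (j + d) p = 0 := hM0 _ _ hp
      rw [h0, zero_mul]
      exact zero_le
  have hball : ∀ j d x, ∀ r : ℝ, 2 ^ j * r ≤ 1 →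
      m (j + d) (Subtype.val ⁻¹' closedBall x r) ≤ 3 ^ n * ((g 0 q₀)⁻¹ * dyadicWeight a j) := by
    intro j d x r hr
    calc m (j + d) (Subtype.val ⁻¹' closedBall x r)
        ≤ m (j + d) (⋃ q ∈ Finset.Icc (dyadicIndex j x - 1) (dyadicIndex j x + 1),
            {x : K | dyadicIndex j (x : Fin n → ℝ) = q}) := by
          refine measure_mono fun y hy => ?_
          obtain ⟨q, hq, hyq⟩ := mem_iUnion₂.1 (closedBall_subset_biUnion_netCell hr x hy)
          exact mem_iUnion₂.2 ⟨q, hq, hyq⟩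
      _ ≤ ∑ q ∈ Finset.Icc (dyadicIndex j x - 1) (dyadicIndex j x + 1),
            m (j + d) {x : K | dyadicIndex j (x : Fin n → ℝ) = q} :=
          measure_biUnion_finset_le _ _
      _ ≤ ∑ q ∈ Finset.Icc (dyadicIndex j x - 1) (dyadicIndex j x + 1),
            (g 0 q₀)⁻¹ * dyadicWeight a j := Finset.sum_le_sum fun q _ => hcellM j d q
      _ = _ := by
          rw [Finset.sum_const, card_Icc_sub_one_add_one, nsmul_eq_mul]
          push_cast
          rfl
  have := isCompact_iff_compactSpace.1 hK
  let P : ℕ → ProbabilityMeasure K := fun k => ⟨m k, hm k⟩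
  let 𝒰 : Ultrafilter ℕ := Filter.hyperfilter ℕ
  obtain ⟨μ, -, hμ⟩ := isCompact_univ.ultrafilter_le_nhds (𝒰.map P)
    (by simp)
  have hlim : Filter.Tendsto P 𝒰 (nhds μ) := hμ
  have hballμ : ∀ j x, ∀ r : ℝ, 2 ^ j * r ≤ 1 →
      (μ : Measure K) (Subtype.val ⁻¹' ball x r) ≤ 3 ^ n * ((g 0 q₀)⁻¹ * dyadicWeight a j) := by
    intro j x r hr
    have hop : IsOpen (Subtype.val ⁻¹' ball x r : Set K) :=
      isOpen_ball.preimage continuous_subtype_val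
    refine (ProbabilityMeasure.le_liminf_measure_open_of_tendsto hlim hop).trans ?_
    have hev : ∀ᶠ k in (𝒰 : Filter ℕ), (P k : Measure K) (Subtype.val ⁻¹' ball x r) ≤
        3 ^ n * ((g 0 q₀)⁻¹ * dyadicWeight a j) := by
      have h1 : ∀ᶠ k in (𝒰 : Filter ℕ), j ≤ k :=
        Filter.Eventually.filter_mono (Nat.hyperfilter_le_atTop) (Filter.eventually_ge_atTop j)
      filter_upwards [h1] with k hk
      obtain ⟨d, rfl⟩ := Nat.exists_eq_add_of_le hk
      exact (measure_mono (preimage_mono ball_subset_closedBall)).trans (hball j d x r hr)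
    exact (Filter.liminf_le_liminf hev).trans (Filter.liminf_const _).le
  refine ⟨(μ : Measure K).map Subtype.val, inferInstance, ?_, ?_, ?_⟩
  · rw [Measure.map_apply measurable_subtype_coe MeasurableSet.univ, preimage_univ, measure_univ]
    exact one_ne_zero
  · rw [Measure.map_apply measurable_subtype_coe hK.measurableSet.compl]
    simp
  · have hCtop : 3 ^ n * (g 0 q₀)⁻¹ * ENNReal.ofReal (4 ^ a) + ENNReal.ofReal (2 ^ a) ≠ ∞ := by
      refine ENNReal.add_ne_top.2 ⟨ENNReal.mul_ne_top (ENNReal.mul_ne_top ?_ ?_) ?_, ?_⟩ <;>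
        simp [hq₀]
    refine ⟨(3 ^ n * (g 0 q₀)⁻¹ * ENNReal.ofReal (4 ^ a) + ENNReal.ofReal (2 ^ a)).toNNReal,
      fun x r hr => ?_⟩
    rw [ENNReal.coe_toNNReal hCtop,
      Measure.map_apply measurable_subtype_coe measurableSet_closedBall, add_mul]
    by_cases h : 2 * r ≤ 1
    · refine le_trans ?_ le_self_add
      obtain ⟨j, hj1, hj2⟩ := exists_two_pow_mul_le_one (by positivity) h
      calc (μ : Measure K) (Subtype.val ⁻¹' closedBall x r)
          ≤ (μ : Measure K) (Subtype.val ⁻¹' ball x (2 * r)) :=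
            measure_mono (preimage_mono (closedBall_subset_ball (by linarith)))
        _ ≤ 3 ^ n * ((g 0 q₀)⁻¹ * dyadicWeight a j) := hballμ j x _ hj1
        _ ≤ 3 ^ n * ((g 0 q₀)⁻¹ * ENNReal.ofReal ((4 * r) ^ a)) := by
            unfold dyadicWeight
            gcongr
            linarith
        _ = _ := by
            rw [Real.mul_rpow (by norm_num) hr.le, ENNReal.ofReal_mul (by positivity)]
            ring
    · refine le_trans ?_ le_add_self
      rw [← ENNReal.ofReal_mul (by positivity), ← Real.mul_rpow (by norm_num) hr.le]
      refine prob_le_one.trans ?_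
      rw [ENNReal.one_le_ofReal]
      exact Real.one_le_rpow (by linarith) ha

/-- **Frostman's lemma** for Borel sets. -/
lemma exists_frostman {a : ℝ≥0} (ha : 0 < a) {Z : Set (Fin n → ℝ)} (hZ : MeasurableSet Z)
    (hdim : a < dimH Z) :
    ∃ K ⊆ Z, IsCompact K ∧ ∃ μ : Measure (Fin n → ℝ), IsFiniteMeasure μ ∧ μ univ ≠ 0 ∧
      μ Kᶜ = 0 ∧ ∃ C : ℝ≥0, ∀ x, ∀ r : ℝ, 0 < r →
        μ (closedBall x r) ≤ C * ENNReal.ofReal (r ^ (a : ℝ)) := by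
  have hpos : 0 < netContent dyadicIndex (dyadicWeight a) Z := by
    rw [pos_iff_ne_zero]
    intro h
    have := hausdorffMeasure_eq_zero_of_netContent_eq_zero (by exact_mod_cast ha) h
    rw [hausdorffMeasure_of_lt_dimH hdim] at this
    exact ENNReal.top_ne_zero this
  obtain ⟨K, hKZ, hK, hKpos⟩ := exists_isCompact_netContent_pos hZ.analyticSet hpos
  exact ⟨K, hKZ, hK, exists_frostman_of_isCompact a.coe_nonneg hK hKpos⟩

end Frostman

section Kernel

variable {m : ℕ}

/-- The normalized indicator function of the ball of radius `r` about the origin. -/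
noncomputable def ballKernel (r : ℝ) : (Fin m → ℝ) → ℝ≥0∞ :=
  (closedBall 0 r).indicator fun _ => (ENNReal.ofReal ((2 * r) ^ m))⁻¹

/-- A Lipschitz cut-off supported in the ball of radius `R`. -/
noncomputable def cutoff (R : ℝ) (v : Fin m → ℝ) : ℝ≥0∞ := ENNReal.ofReal (R - ‖v‖)

/-- The projection of `ℝᵐ⁺¹` onto the hyperplane `z i = 0` along the line of slope `v` over the
`i`-th axis. -/
def slopeProj (i : Fin (m + 1)) (v : Fin m → ℝ) (z : Fin (m + 1) → ℝ) : Fin m → ℝ :=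
  i.removeNth z - z i • v

lemma slopeProj_sub (i : Fin (m + 1)) (v : Fin m → ℝ) (y z : Fin (m + 1) → ℝ) :
    slopeProj i v (y - z) = slopeProj i v y - slopeProj i v z := by
  ext k
  simp only [slopeProj, Fin.removeNth, Pi.sub_apply, Pi.smul_apply, smul_eq_mul]
  ring

lemma continuous_slopeProj (i : Fin (m + 1)) :
    Continuous fun p : (Fin m → ℝ) × (Fin (m + 1) → ℝ) => slopeProj i p.1 p.2 := by
  refine continuous_pi fun k => ?_
  simp only [slopeProj, Fin.removeNth, Pi.sub_apply, Pi.smul_apply, smul_eq_mul]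
  fun_prop

@[fun_prop]
lemma Measurable.slopeProj {α : Type*} [MeasurableSpace α] {i : Fin (m + 1)}
    {f : α → Fin m → ℝ} {g : α → Fin (m + 1) → ℝ} (hf : Measurable f) (hg : Measurable g) :
    Measurable fun x => slopeProj i (f x) (g x) :=
  (continuous_slopeProj i).measurable.comp (hf.prodMk hg)

@[fun_prop]
lemma measurable_ballKernel (r : ℝ) : Measurable (ballKernel r : (Fin m → ℝ) → ℝ≥0∞) :=
  measurable_const.indicator measurableSet_closedBall

@[fun_prop]
lemma measurable_cutoff (R : ℝ) : Measurable (cutoff R : (Fin m → ℝ) → ℝ≥0∞) := by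
  unfold cutoff
  fun_prop

lemma ballKernel_le (r : ℝ) (u : Fin m → ℝ) :
    ballKernel r u ≤ (ENNReal.ofReal ((2 * r) ^ m))⁻¹ :=
  indicator_le_self _ _ u

lemma ballKernel_of_lt_norm {r : ℝ} {u : Fin m → ℝ} (h : r < ‖u‖) : ballKernel r u = 0 :=
  indicator_of_notMem (by simpa using h) _

lemma ballKernel_neg (r : ℝ) (u : Fin m → ℝ) : ballKernel r (-u) = ballKernel r u := by
  simp [ballKernel, indicator]

lemma lintegral_ballKernel_sub_smul {r : ℝ} (hr : 0 < r) {c : ℝ} (hc : c ≠ 0) (w : Fin m → ℝ) :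
    ∫⁻ v, ballKernel r (w - c • v) = ENNReal.ofReal |c|⁻¹ ^ m := by
  have h : ∀ v, ballKernel r (w - c • v) = (closedBall (c⁻¹ • w) (|c|⁻¹ * r)).indicator
      (fun _ => (ENNReal.ofReal ((2 * r) ^ m))⁻¹) v := by
    intro v
    have : w - c • v ∈ closedBall (0 : Fin m → ℝ) r ↔ v ∈ closedBall (c⁻¹ • w) (|c|⁻¹ * r) := by
      have hv : v - c⁻¹ • w = -(c⁻¹ • (w - c • v)) := by
        rw [smul_sub, smul_smul, inv_mul_cancel₀ hc, one_smul]
        abel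
      rw [mem_closedBall_zero_iff, mem_closedBall_iff_norm, hv, norm_neg, norm_smul, norm_inv,
        Real.norm_eq_abs]
      exact (mul_le_mul_iff_right₀ (by positivity)).symm
    by_cases hv : v ∈ closedBall (c⁻¹ • w) (|c|⁻¹ * r)
    · rw [ballKernel, indicator_of_mem hv, indicator_of_mem (this.2 hv)]
    · rw [ballKernel, indicator_of_notMem hv, indicator_of_notMem (fun h => hv (this.1 h))]
  have hcp : 0 < |c| := abs_pos.2 hc
  rw [lintegral_congr h, lintegral_indicator_const measurableSet_closedBall,
    Real.volume_pi_closedBall _ (by positivity), Fintype.card_fin, mul_left_comm, mul_pow |c|⁻¹,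
    ENNReal.ofReal_mul (by positivity), mul_left_comm, ENNReal.inv_mul_cancel,
    mul_one, ENNReal.ofReal_pow (by positivity)]
  · exact (ENNReal.ofReal_pos.2 (by positivity)).ne'
  · exact ENNReal.ofReal_ne_top

lemma lintegral_ballKernel {r : ℝ} (hr : 0 < r) :
    ∫⁻ v, ballKernel r (v : Fin m → ℝ) = 1 := by
  have h := lintegral_ballKernel_sub_smul hr (c := -1) (by norm_num) (0 : Fin m → ℝ)
  simpa using h

lemma cutoff_le_cutoff_add (R : ℝ) (v w : Fin m → ℝ) :
    cutoff R v ≤ cutoff R w + ENNReal.ofReal ‖v - w‖ := by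
  refine (ENNReal.ofReal_le_ofReal ?_).trans ENNReal.ofReal_add_le
  have := norm_sub_norm_le w v
  rw [norm_sub_rev] at this
  linarith

lemma cutoff_le (R : ℝ) (v : Fin m → ℝ) : cutoff R v ≤ ENNReal.ofReal R :=
  ENNReal.ofReal_le_ofReal (by linarith [norm_nonneg v])

lemma cutoff_of_le_norm {R : ℝ} {v : Fin m → ℝ} (h : R ≤ ‖v‖) : cutoff R v = 0 :=
  ENNReal.ofReal_of_nonpos (by linarith)

lemma lintegral_cutoff_ne_top (R : ℝ) : ∫⁻ v, cutoff R (v : Fin m → ℝ) ≠ ∞ := by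
  have h : ∀ v : Fin m → ℝ,
      cutoff R v ≤ (closedBall 0 R).indicator (fun _ => ENNReal.ofReal R) v := by
    intro v
    by_cases hv : ‖v‖ ≤ R
    · rw [indicator_of_mem (by simpa using hv)]
      exact cutoff_le R v
    · rw [cutoff_of_le_norm (not_le.1 hv).le]
      exact zero_le
  refine ne_top_of_le_ne_top ?_ (lintegral_mono h)
  rw [lintegral_indicator_const measurableSet_closedBall]
  exact ENNReal.mul_ne_top ENNReal.ofReal_ne_top measure_closedBall_lt_top.ne

/-- The kernel obtained by averaging over the directions `v` the mutual energies of two ball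
kernels translated by the projection of `z`. -/
noncomputable def slopeKernel (i : Fin (m + 1)) (R r r' : ℝ) (z : Fin (m + 1) → ℝ) : ℝ≥0∞ :=
  ∫⁻ v, cutoff R v * ∫⁻ u, ballKernel r u * ballKernel r' (u + slopeProj i v z)

variable {i : Fin (m + 1)} {R r r' : ℝ} {z : Fin (m + 1) → ℝ}

lemma slopeKernel_eq : slopeKernel i R r r' z =
    ∫⁻ u, ballKernel r u * ∫⁻ v, cutoff R v * ballKernel r' (u + slopeProj i v z) := by
  unfold slopeKernel
  have h1 : ∀ v : Fin m → ℝ,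
      cutoff R v * ∫⁻ u, ballKernel r u * ballKernel r' (u + slopeProj i v z) =
      ∫⁻ u, ballKernel r u * (cutoff R v * ballKernel r' (u + slopeProj i v z)) := by
    intro v
    rw [← lintegral_const_mul _ (by fun_prop)]
    exact lintegral_congr fun u => mul_left_comm _ _ _
  rw [lintegral_congr h1, lintegral_lintegral_swap (by fun_prop)]
  exact lintegral_congr fun u => lintegral_const_mul _ (by fun_prop)

lemma norm_sub_le_of_ballKernel_ne_zero {u v : Fin m → ℝ} (hz : z i ≠ 0)
    (hu : ballKernel r u ≠ 0) (hv : ballKernel r' (u + slopeProj i v z) ≠ 0) :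
    ‖v - (z i)⁻¹ • i.removeNth z‖ ≤ |z i|⁻¹ * (r + r') := by
  have hu' : ‖u‖ ≤ r := not_lt.1 fun h => hu (ballKernel_of_lt_norm h)
  have hv' : ‖u + slopeProj i v z‖ ≤ r' := not_lt.1 fun h => hv (ballKernel_of_lt_norm h)
  have h : v - (z i)⁻¹ • i.removeNth z = (z i)⁻¹ • (u - (u + slopeProj i v z)) := by
    rw [slopeProj, sub_add_cancel_left, smul_neg, smul_sub, smul_smul, inv_mul_cancel₀ hz, one_smul]
    abel
  rw [h, norm_smul, norm_inv, Real.norm_eq_abs]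
  have := norm_sub_le u (u + slopeProj i v z)
  gcongr
  linarith

lemma lintegral_lintegral_ballKernel (hr : 0 < r) (hr' : 0 < r') (hz : z i ≠ 0) :
    ∫⁻ u, ballKernel r u * ∫⁻ v, ballKernel r' (u + slopeProj i v z) =
      ENNReal.ofReal |z i|⁻¹ ^ m := by
  have h : ∀ u : Fin m → ℝ, ∫⁻ v, ballKernel r' (u + slopeProj i v z) =
      ENNReal.ofReal |z i|⁻¹ ^ m := by
    intro u
    simp only [slopeProj, ← add_sub_assoc]
    exact lintegral_ballKernel_sub_smul hr' hz _
  simp only [h]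
  rw [lintegral_mul_const _ (by fun_prop), lintegral_ballKernel hr, one_mul]

lemma slopeKernel_le (hr : 0 < r) (hr' : 0 < r') (hz : z i ≠ 0) :
    slopeKernel i R r r' z ≤ ENNReal.ofReal |z i|⁻¹ ^ m *
      (cutoff R ((z i)⁻¹ • i.removeNth z) + ENNReal.ofReal |z i|⁻¹ * ENNReal.ofReal (r + r')) := by
  rw [slopeKernel_eq, ← lintegral_lintegral_ballKernel hr hr' hz, ← lintegral_mul_const _
    (by fun_prop)]
  refine lintegral_mono fun u => ?_
  by_cases hu : ballKernel r u = 0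
  · simp [hu]
  rw [mul_assoc, ← lintegral_mul_const _ (by fun_prop)]
  refine mul_le_mul_right (lintegral_mono fun v => ?_) _
  by_cases hv : ballKernel r' (u + slopeProj i v z) = 0
  · simp [hv]
  rw [mul_comm, ← ENNReal.ofReal_mul (by positivity)]
  refine mul_le_mul_right ((cutoff_le_cutoff_add R v _).trans (add_le_add_right ?_ _)) _
  exact ENNReal.ofReal_le_ofReal (norm_sub_le_of_ballKernel_ne_zero hz hu hv)

lemma le_slopeKernel_add (hr : 0 < r) (hr' : 0 < r') (hz : z i ≠ 0) :
    ENNReal.ofReal |z i|⁻¹ ^ m * cutoff R ((z i)⁻¹ • i.removeNth z) ≤ slopeKernel i R r r' z +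
      ENNReal.ofReal |z i|⁻¹ ^ m * (ENNReal.ofReal |z i|⁻¹ * ENNReal.ofReal (r + r')) := by
  rw [slopeKernel_eq, ← lintegral_lintegral_ballKernel hr hr' hz, ← lintegral_mul_const _
    (by fun_prop), ← lintegral_mul_const _ (by fun_prop), ← lintegral_add_left (by fun_prop)]
  refine lintegral_mono fun u => ?_
  by_cases hu : ballKernel r u = 0
  · simp [hu]
  rw [mul_assoc, mul_assoc, ← mul_add, ← lintegral_mul_const _ (by fun_prop),
    ← lintegral_mul_const _ (by fun_prop), ← lintegral_add_left (by fun_prop)]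
  refine mul_le_mul_right (lintegral_mono fun v => ?_) _
  by_cases hv : ballKernel r' (u + slopeProj i v z) = 0
  · simp [hv]
  rw [mul_comm (cutoff R v), ← ENNReal.ofReal_mul (by positivity), ← mul_add]
  refine mul_le_mul_right ((cutoff_le_cutoff_add R _ v).trans (add_le_add_right ?_ _)) _
  rw [norm_sub_rev]
  exact ENNReal.ofReal_le_ofReal (norm_sub_le_of_ballKernel_ne_zero hz hu hv)

lemma slopeKernel_le_const (hr : 0 < r) : slopeKernel i R r r' z ≤
    (∫⁻ v, cutoff R (v : Fin m → ℝ)) * (ENNReal.ofReal ((2 * r') ^ m))⁻¹ := by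
  rw [← lintegral_mul_const _ (by fun_prop)]
  refine lintegral_mono fun v => mul_le_mul_right ?_ _
  calc ∫⁻ u, ballKernel r u * ballKernel r' (u + slopeProj i v z)
      ≤ ∫⁻ u, ballKernel r (u : Fin m → ℝ) * (ENNReal.ofReal ((2 * r') ^ m))⁻¹ :=
        lintegral_mono fun u => mul_le_mul_right (ballKernel_le _ _) _
    _ = _ := by rw [lintegral_mul_const _ (by fun_prop), lintegral_ballKernel hr, one_mul]

lemma norm_le_max_removeNth (i : Fin (m + 1)) (z : Fin (m + 1) → ℝ) :
    ‖z‖ ≤ max |z i| ‖i.removeNth z‖ := by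
  rw [pi_norm_le_iff_of_nonneg (by positivity)]
  intro k
  rcases Fin.eq_self_or_eq_succAbove i k with rfl | ⟨j, rfl⟩
  · exact le_max_left _ _
  · exact (norm_le_pi_norm (i.removeNth z) j).trans (le_max_right _ _)

lemma slopeKernel_eq_zero (hR : 1 ≤ R) (hz : 2 * (r + r') ≤ ‖z‖) (hzi : 2 * R * |z i| < ‖z‖) :
    slopeKernel i R r r' z = 0 := by
  refine (lintegral_congr fun v => ?_).trans lintegral_zero
  rcases le_or_gt R ‖v‖ with hv | hv
  · rw [cutoff_of_le_norm hv, zero_mul]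
  refine mul_eq_zero_of_right _ ((lintegral_congr fun u => ?_).trans lintegral_zero)
  by_contra! h
  rw [mul_ne_zero_iff] at h
  have hu' : ‖u‖ ≤ r := not_lt.1 fun h' => h.1 (ballKernel_of_lt_norm h')
  have hv' : ‖u + slopeProj i v z‖ ≤ r' := not_lt.1 fun h' => h.2 (ballKernel_of_lt_norm h')
  have h1 : i.removeNth z = (u + slopeProj i v z) - u + z i • v := by
    rw [slopeProj]
    abel
  have h2 : ‖i.removeNth z‖ ≤ r' + r + |z i| * R := by
    rw [h1]
    refine (norm_add_le _ _).trans (add_le_add ((norm_sub_le _ _).trans (by linarith)) ?_)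
    rw [norm_smul, Real.norm_eq_abs]
    gcongr
  have h3 := norm_le_max_removeNth i z
  have h4 : |z i| ≤ |z i| * R := le_mul_of_one_le_right (abs_nonneg _) hR
  rcases le_max_iff.1 h3 with h | h
  · nlinarith [abs_nonneg (z i)]
  · linarith

end Kernel

section KernelBounds

variable {m : ℕ} {i : Fin (m + 1)}

lemma inv_abs_le_of_le {R ρ : ℝ} {z : Fin (m + 1) → ℝ} (hR : 1 ≤ R) (hρ : 0 < ρ)
    (hz : 4 * ρ ≤ ‖z‖) (hzi : ‖z‖ ≤ 2 * R * |z i|) :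
    z i ≠ 0 ∧ |z i|⁻¹ ≤ 2 * R * (max ρ ‖z‖)⁻¹ := by
  have hz0 : 0 < ‖z‖ := by linarith
  have hzi0 : 0 < |z i| := by
    by_contra! h
    nlinarith
  refine ⟨abs_pos.1 hzi0, ?_⟩
  rw [max_eq_right (by linarith), ← div_eq_mul_inv, le_div_iff₀ hz0, mul_comm,
    ← div_eq_mul_inv, div_le_iff₀ hzi0]
  exact hzi

lemma exists_slopeKernel_le (i : Fin (m + 1)) {R : ℝ} (hR : 1 ≤ R) :
    ∃ C : ℝ≥0, ∀ ρ r r' : ℝ, 0 < ρ → ρ / 2 ≤ r → r ≤ ρ → ρ / 2 ≤ r' → r' ≤ ρ → ∀ z,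
      slopeKernel i R r r' z ≤ C * ENNReal.ofReal (max ρ ‖z‖)⁻¹ ^ m := by
  set I := ∫⁻ v, cutoff R (v : Fin m → ℝ) with hI
  have hItop : I ≠ ∞ := lintegral_cutoff_ne_top R
  have hCtop : I * 4 ^ m + ENNReal.ofReal (2 * R) ^ m * ENNReal.ofReal (2 * R) ≠ ∞ := by
    finiteness
  refine ⟨(I * 4 ^ m + ENNReal.ofReal (2 * R) ^ m * ENNReal.ofReal (2 * R)).toNNReal, ?_⟩
  intro ρ r r' hρ hr1 hr2 hr1' hr2' z
  rw [ENNReal.coe_toNNReal hCtop, add_mul]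
  rcases lt_or_ge ‖z‖ (4 * ρ) with hz | hz
  · refine le_trans ?_ le_self_add
    refine (slopeKernel_le_const (by linarith)).trans ?_
    rw [mul_assoc, ← mul_pow]
    refine mul_le_mul_right ?_ _
    rw [← ENNReal.ofReal_inv_of_pos (by have : 0 < r' := by linarith
                                        positivity), ← inv_pow,
      ENNReal.ofReal_pow (by have : 0 < r' := by linarith
                             positivity)]
    refine pow_le_pow_left₀ zero_le ?_ _
    have h4 : (4 : ℝ≥0∞) = ENNReal.ofReal 4 := by simp
    rw [h4, ← ENNReal.ofReal_mul (by norm_num)]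
    refine ENNReal.ofReal_le_ofReal ?_
    have hM : max ρ ‖z‖ ≤ 4 * ρ := max_le (by linarith) hz.le
    have hM0 : 0 < max ρ ‖z‖ := lt_max_of_lt_left hρ
    rw [← div_eq_mul_inv, inv_le_comm₀ (by linarith) (by positivity), inv_div]
    linarith
  · refine le_trans ?_ le_add_self
    rcases lt_or_ge (2 * R * |z i|) ‖z‖ with hzi | hzi
    · rw [slopeKernel_eq_zero hR (by linarith) hzi]
      exact zero_le
    obtain ⟨hzi0, hinv⟩ := inv_abs_le_of_le hR hρ hz hzi
    refine (slopeKernel_le (by linarith) (by linarith) hzi0).trans ?_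
    have hω := ENNReal.ofReal_le_ofReal hinv
    rw [ENNReal.ofReal_mul (by positivity)] at hω
    rw [mul_right_comm, ← mul_pow]
    refine mul_le_mul' (pow_le_pow_left₀ zero_le hω _) ?_
    rw [two_mul R, ENNReal.ofReal_add (p := R) (by linarith) (by linarith),
      ← ENNReal.ofReal_mul (by positivity)]
    refine add_le_add (cutoff_le _ _) (ENNReal.ofReal_le_ofReal ?_)
    have hz0 : 0 < ‖z‖ := by linarith
    calc |z i|⁻¹ * (r + r') ≤ (2 * R * (max ρ ‖z‖)⁻¹) * (2 * ρ) :=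
          mul_le_mul hinv (by linarith) (by linarith) (by positivity)
      _ ≤ (2 * R * (4 * ρ)⁻¹) * (2 * ρ) := by
          gcongr
          exact hz.trans (le_max_right _ _)
      _ = R := by field_simp; norm_num

lemma exists_slopeKernel_add_le (i : Fin (m + 1)) {R : ℝ} (hR : 1 ≤ R) :
    ∃ C : ℝ≥0, ∀ ρ : ℝ, 0 < ρ → ∀ z,
      slopeKernel i R ρ ρ z + slopeKernel i R (ρ / 2) (ρ / 2) z ≤
        2 * slopeKernel i R ρ (ρ / 2) z +
          C * (ENNReal.ofReal ρ * ENNReal.ofReal (max ρ ‖z‖)⁻¹ ^ (m + 1)) := by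
  obtain ⟨C, hC⟩ := exists_slopeKernel_le i hR
  refine ⟨8 * C + 8 * (Real.toNNReal (2 * R)) ^ (m + 1), fun ρ hρ z => ?_⟩
  have hM0 : 0 < max ρ ‖z‖ := lt_max_of_lt_left hρ
  rcases lt_or_ge ‖z‖ (4 * ρ) with hz | hz
  · refine le_trans ?_ le_add_self
    have hM : max ρ ‖z‖ ≤ 4 * ρ := max_le (by linarith) hz.le
    have h1 : 1 ≤ 4 * ENNReal.ofReal ρ * ENNReal.ofReal (max ρ ‖z‖)⁻¹ := by
      have h4 : (4 : ℝ≥0∞) = ENNReal.ofReal 4 := by simp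
      rw [h4, ← ENNReal.ofReal_mul (by norm_num), ← ENNReal.ofReal_mul (by positivity),
        ENNReal.one_le_ofReal, ← div_eq_mul_inv, one_le_div hM0]
      exact hM
    calc slopeKernel i R ρ ρ z + slopeKernel i R (ρ / 2) (ρ / 2) z
        ≤ C * ENNReal.ofReal (max ρ ‖z‖)⁻¹ ^ m + C * ENNReal.ofReal (max ρ ‖z‖)⁻¹ ^ m :=
          add_le_add (hC ρ ρ ρ hρ (by linarith) le_rfl (by linarith) le_rfl z)
            (hC ρ _ _ hρ le_rfl (by linarith) le_rfl (by linarith) z)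
      _ = 2 * C * ENNReal.ofReal (max ρ ‖z‖)⁻¹ ^ m * 1 := by ring
      _ ≤ 2 * C * ENNReal.ofReal (max ρ ‖z‖)⁻¹ ^ m *
          (4 * ENNReal.ofReal ρ * ENNReal.ofReal (max ρ ‖z‖)⁻¹) := by gcongr
      _ = 8 * C * (ENNReal.ofReal ρ * ENNReal.ofReal (max ρ ‖z‖)⁻¹ ^ (m + 1)) := by ring
      _ ≤ _ := by
        push_cast
        gcongr
        exact le_self_add
  · rcases lt_or_ge (2 * R * |z i|) ‖z‖ with hzi | hzi
    · rw [slopeKernel_eq_zero hR (by linarith) hzi, slopeKernel_eq_zero hR (by linarith) hzi,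
        zero_add]
      exact zero_le
    obtain ⟨hzi0, hinv⟩ := inv_abs_le_of_le hR hρ hz hzi
    set ω := ENNReal.ofReal |z i|⁻¹ with hω
    set T := ω ^ m * (ω * ENNReal.ofReal (2 * ρ)) with hT
    set X := ω ^ m * cutoff R ((z i)⁻¹ • i.removeNth z) with hX
    have hu : ∀ r : ℝ, 0 < r → r ≤ ρ → slopeKernel i R r r z ≤ X + T := by
      intro r hr0 hr
      refine (slopeKernel_le hr0 hr0 hzi0).trans ?_
      rw [mul_add, hT]
      gcongr
      linarith
    have hl : X ≤ slopeKernel i R ρ (ρ / 2) z + T := by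
      refine (le_slopeKernel_add hρ (half_pos hρ) hzi0).trans ?_
      rw [hT]
      gcongr
      linarith
    have hωle : ω ≤ Real.toNNReal (2 * R) * ENNReal.ofReal (max ρ ‖z‖)⁻¹ := by
      change ω ≤ ENNReal.ofReal (2 * R) * _
      rw [← ENNReal.ofReal_mul (by positivity)]
      exact ENNReal.ofReal_le_ofReal hinv
    have hTle : 4 * T ≤ 8 * (Real.toNNReal (2 * R)) ^ (m + 1) *
        (ENNReal.ofReal ρ * ENNReal.ofReal (max ρ ‖z‖)⁻¹ ^ (m + 1)) := by
      calc 4 * T = 8 * ω ^ (m + 1) * ENNReal.ofReal ρ := by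
            rw [hT, ENNReal.ofReal_mul (by norm_num), ENNReal.ofReal_ofNat]
            ring
        _ ≤ 8 * (Real.toNNReal (2 * R) * ENNReal.ofReal (max ρ ‖z‖)⁻¹) ^ (m + 1) *
            ENNReal.ofReal ρ := by gcongr
        _ = _ := by ring
    calc slopeKernel i R ρ ρ z + slopeKernel i R (ρ / 2) (ρ / 2) z
        ≤ (X + T) + (X + T) := add_le_add (hu ρ hρ le_rfl) (hu _ (half_pos hρ) (by linarith))
      _ ≤ (slopeKernel i R ρ (ρ / 2) z + T + T) + (slopeKernel i R ρ (ρ / 2) z + T + T) := by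
          gcongr
      _ = 2 * slopeKernel i R ρ (ρ / 2) z + 4 * T := by ring
      _ ≤ _ := by
        push_cast
        exact add_le_add le_rfl (hTle.trans (mul_le_mul_left le_add_self _))

end KernelBounds

section Energy

variable {n : ℕ}

lemma ofReal_inv_max_le_tsum {ρ : ℝ} (hρ : 0 < ρ) (q : ℕ) (x y : Fin n → ℝ) :
    ENNReal.ofReal (max ρ ‖y - x‖)⁻¹ ^ q ≤ ∑' j : ℕ, (closedBall x (2 ^ j * ρ)).indicator
      (fun _ => ENNReal.ofReal ((2 ^ j * ρ / 2)⁻¹ ^ q)) y := by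
  obtain ⟨j, hj1, hj2⟩ := exists_nat_pow_near (x := max ρ ‖y - x‖ / ρ) (y := 2)
    ((one_le_div hρ).2 (le_max_left _ _)) (by norm_num)
  rw [le_div_iff₀ hρ] at hj1
  rw [div_lt_iff₀ hρ] at hj2
  refine le_trans ?_ (ENNReal.le_tsum (j + 1))
  have hy : y ∈ closedBall x (2 ^ (j + 1) * ρ) := by
    rw [mem_closedBall_iff_norm]
    exact (le_max_right _ _).trans hj2.le
  have hM0 : 0 < max ρ ‖y - x‖ := lt_max_of_lt_left hρ
  rw [indicator_of_mem hy, ← ENNReal.ofReal_pow (by positivity)]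
  refine ENNReal.ofReal_le_ofReal (pow_le_pow_left₀ (by positivity) ?_ _)
  refine inv_anti₀ (by positivity) ?_
  rw [pow_succ]
  linarith

lemma exists_lintegral_inv_max_pow_le {μ : Measure (Fin n → ℝ)} {s : ℝ} {C : ℝ≥0}
    (hμ : ∀ x, ∀ r : ℝ, 0 < r → μ (closedBall x r) ≤ C * ENNReal.ofReal (r ^ s)) {q : ℕ}
    (hsq : s < q) :
    ∃ C' : ℝ≥0, ∀ ρ : ℝ, 0 < ρ → ∀ x,
      ∫⁻ y, ENNReal.ofReal (max ρ ‖y - x‖)⁻¹ ^ q ∂μ ≤ C' * ENNReal.ofReal (ρ ^ (s - q)) := by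
  set c := ENNReal.ofReal (2 ^ (s - q)) with hc
  have hc1 : c < 1 := by
    rw [hc, ENNReal.ofReal_lt_one]
    exact Real.rpow_lt_one_of_one_lt_of_neg (by norm_num) (by linarith)
  have hCtop : C * 2 ^ q * (1 - c)⁻¹ ≠ ∞ := by
    have : 1 - c ≠ 0 := (tsub_pos_of_lt hc1).ne'
    finiteness
  refine ⟨(C * 2 ^ q * (1 - c)⁻¹).toNNReal, fun ρ hρ x => ?_⟩
  rw [ENNReal.coe_toNNReal hCtop]
  calc ∫⁻ y, ENNReal.ofReal (max ρ ‖y - x‖)⁻¹ ^ q ∂μ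
      ≤ ∫⁻ y, ∑' j : ℕ, (closedBall x (2 ^ j * ρ)).indicator
          (fun _ => ENNReal.ofReal ((2 ^ j * ρ / 2)⁻¹ ^ q)) y ∂μ :=
        lintegral_mono fun y => ofReal_inv_max_le_tsum hρ q x y
    _ = ∑' j : ℕ, ENNReal.ofReal ((2 ^ j * ρ / 2)⁻¹ ^ q) * μ (closedBall x (2 ^ j * ρ)) := by
        rw [lintegral_tsum fun j =>
          (measurable_const.indicator measurableSet_closedBall).aemeasurable]
        exact tsum_congr fun j => lintegral_indicator_const measurableSet_closedBall _
    _ ≤ ∑' j : ℕ, C * 2 ^ q * ENNReal.ofReal (ρ ^ (s - q)) * c ^ j := by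
        refine ENNReal.tsum_le_tsum fun j => ?_
        refine (mul_le_mul_right (hμ x _ (by positivity)) _).trans_eq ?_
        have h2 : (2 : ℝ≥0∞) ^ q = ENNReal.ofReal (2 ^ q) := by
          rw [ENNReal.ofReal_pow (by norm_num), ENNReal.ofReal_ofNat]
        rw [h2, hc, ← ENNReal.ofReal_pow (by positivity), mul_left_comm,
          ← ENNReal.ofReal_mul (by positivity), mul_assoc, mul_assoc,
          ← ENNReal.ofReal_mul (by positivity), ← ENNReal.ofReal_mul (by positivity)]
        congr 2
        rw [← Real.rpow_natCast (2 ^ (s - q)) j, ← Real.rpow_mul (by norm_num), mul_comm (s - q),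
          Real.rpow_mul (by norm_num), Real.rpow_natCast, ← Real.mul_rpow hρ.le (by positivity),
          mul_comm ρ, Real.rpow_sub (by positivity), Real.rpow_natCast, inv_pow, div_pow, inv_div]
        ring
    _ = _ := by
        rw [ENNReal.tsum_mul_left, ENNReal.tsum_geometric]
        ring

end Energy

section Densities

variable {m : ℕ}

/-- The density at scale `r` of the projection of `μ` along the lines of slope `v`. -/
noncomputable def slopeDensity (i : Fin (m + 1)) (μ : Measure (Fin (m + 1) → ℝ)) (r : ℝ)
    (v p : Fin m → ℝ) : ℝ≥0∞ :=
  ∫⁻ y, ballKernel r (p - slopeProj i v y) ∂μ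

/-- The absolute difference of the densities of the projections of `μ` at the scales `ρ` and
`ρ / 2`. -/
noncomputable def slopeDiff (i : Fin (m + 1)) (μ : Measure (Fin (m + 1) → ℝ)) (ρ : ℝ)
    (v p : Fin m → ℝ) : ℝ≥0∞ :=
  (slopeDensity i μ ρ v p - slopeDensity i μ (ρ / 2) v p) +
    (slopeDensity i μ (ρ / 2) v p - slopeDensity i μ ρ v p)

variable {i : Fin (m + 1)} {μ ν : Measure (Fin (m + 1) → ℝ)} {R r r' ρ : ℝ}

lemma slopeDiff_sq_add (v p : Fin m → ℝ) :
    slopeDiff i μ ρ v p * slopeDiff i μ ρ v p +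
        2 * (slopeDensity i μ ρ v p * slopeDensity i μ (ρ / 2) v p) =
      slopeDensity i μ ρ v p * slopeDensity i μ ρ v p +
        slopeDensity i μ (ρ / 2) v p * slopeDensity i μ (ρ / 2) v p := by
  rw [slopeDiff]
  rcases le_total (slopeDensity i μ ρ v p) (slopeDensity i μ (ρ / 2) v p) with h | h
  · rw [tsub_eq_zero_of_le h, zero_add]
    obtain ⟨d, hd⟩ : ∃ d, slopeDensity i μ (ρ / 2) v p - slopeDensity i μ ρ v p = d := ⟨_, rfl⟩
    rw [hd, ← add_tsub_cancel_of_le h, hd]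
    ring
  · rw [tsub_eq_zero_of_le h, add_zero]
    obtain ⟨d, hd⟩ : ∃ d, slopeDensity i μ ρ v p - slopeDensity i μ (ρ / 2) v p = d := ⟨_, rfl⟩
    rw [hd, ← add_tsub_cancel_of_le h, hd]
    ring

variable [IsFiniteMeasure μ] [IsFiniteMeasure ν]

@[fun_prop]
lemma Measurable.slopeDensity {α : Type*} [MeasurableSpace α] {f g : α → Fin m → ℝ}
    (hf : Measurable f) (hg : Measurable g) :
    Measurable fun x => slopeDensity i μ r (f x) (g x) := by
  unfold _root_.slopeDensity
  exact Measurable.lintegral_prod_right (by fun_prop)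

@[fun_prop]
lemma Measurable.slopeDiff {α : Type*} [MeasurableSpace α] {f g : α → Fin m → ℝ}
    (hf : Measurable f) (hg : Measurable g) :
    Measurable fun x => slopeDiff i μ ρ (f x) (g x) := by
  unfold _root_.slopeDiff
  fun_prop

lemma lintegral_slopeDensity_mul_slopeDensity (i : Fin (m + 1)) (R r r' : ℝ) :
    ∫⁻ v, cutoff R v * ∫⁻ p, slopeDensity i μ r v p * slopeDensity i ν r' v p =
      ∫⁻ x, ∫⁻ y, slopeKernel i R r r' (y - x) ∂μ ∂ν := by
  have h1 : ∀ v p, slopeDensity i μ r v p * slopeDensity i ν r' v p =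
      ∫⁻ x, ∫⁻ y,
        ballKernel r (p - slopeProj i v y) * ballKernel r' (p - slopeProj i v x) ∂μ ∂ν := by
    intro v p
    rw [mul_comm, slopeDensity, slopeDensity, ← lintegral_mul_const _ (by fun_prop)]
    refine lintegral_congr fun x => ?_
    rw [mul_comm, lintegral_mul_const _ (by fun_prop)]
  have h2 : ∀ v, ∫⁻ p, slopeDensity i μ r v p * slopeDensity i ν r' v p =
      ∫⁻ x, ∫⁻ y, (∫⁻ u, ballKernel r u * ballKernel r' (u + slopeProj i v (y - x))) ∂μ ∂ν := by
    intro v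
    rw [lintegral_congr (h1 v), lintegral_lintegral_swap]
    · refine lintegral_congr fun x => ?_
      rw [lintegral_lintegral_swap (by fun_prop)]
      refine lintegral_congr fun y => ?_
      rw [← lintegral_add_right_eq_self _ (slopeProj i v y)]
      refine lintegral_congr fun u => ?_
      rw [slopeProj_sub, add_sub_cancel_right, add_sub_assoc]
    · exact (Measurable.lintegral_prod_right (by fun_prop)).aemeasurable
  have h3 : ∀ v, cutoff R v * ∫⁻ p, slopeDensity i μ r v p * slopeDensity i ν r' v p =
      ∫⁻ x, ∫⁻ y, cutoff R v *
        (∫⁻ u, ballKernel r u * ballKernel r' (u + slopeProj i v (y - x))) ∂μ ∂ν := by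
    intro v
    have hm : Measurable fun q : (Fin (m + 1) → ℝ) × (Fin (m + 1) → ℝ) =>
        ∫⁻ u, ballKernel r u * ballKernel r' (u + slopeProj i v (q.2 - q.1)) :=
      Measurable.lintegral_prod_right (by fun_prop)
    rw [h2, ← lintegral_const_mul _ (Measurable.lintegral_prod_right hm)]
    exact lintegral_congr fun x => (lintegral_const_mul _ (hm.comp measurable_prodMk_left)).symm
  have hm : Measurable fun q : ((Fin m → ℝ) × (Fin (m + 1) → ℝ)) × (Fin (m + 1) → ℝ) =>
      cutoff R q.1.1 *
        ∫⁻ u, ballKernel r u * ballKernel r' (u + slopeProj i q.1.1 (q.2 - q.1.2)) :=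
    ((measurable_cutoff R).comp (by fun_prop)).mul (Measurable.lintegral_prod_right (by fun_prop))
  rw [lintegral_congr h3, lintegral_lintegral_swap]
  · refine lintegral_congr fun x => ?_
    rw [lintegral_lintegral_swap]
    · rfl
    · exact (hm.comp (f := fun q : (Fin m → ℝ) × (Fin (m + 1) → ℝ) => ((q.1, x), q.2))
        (by fun_prop)).aemeasurable
  · exact (Measurable.lintegral_prod_right hm).aemeasurable

lemma exists_lintegral_slopeDensity_sq_le (i : Fin (m + 1)) (hR : 1 ≤ R) {t : ℝ} {C : ℝ≥0}
    (hν : ∀ x, ∀ r : ℝ, 0 < r → ν (closedBall x r) ≤ C * ENNReal.ofReal (r ^ t)) (ht : t < m) :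
    ∃ C' : ℝ≥0, ∀ ρ r : ℝ, 0 < ρ → ρ / 2 ≤ r → r ≤ ρ →
      ∫⁻ v, cutoff R v * ∫⁻ p, slopeDensity i ν r v p * slopeDensity i ν r v p ≤
        C' * ENNReal.ofReal (ρ ^ (t - m)) := by
  obtain ⟨C₁, hC₁⟩ := exists_slopeKernel_le i hR
  obtain ⟨C₂, hC₂⟩ := exists_lintegral_inv_max_pow_le hν ht
  refine ⟨C₁ * C₂ * (ν univ).toNNReal, fun ρ r hρ hr1 hr2 => ?_⟩
  rw [lintegral_slopeDensity_mul_slopeDensity]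
  calc ∫⁻ x, ∫⁻ y, slopeKernel i R r r (y - x) ∂ν ∂ν
      ≤ ∫⁻ x, C₁ * (C₂ * ENNReal.ofReal (ρ ^ (t - m))) ∂ν := by
        refine lintegral_mono fun x => ?_
        refine (lintegral_mono fun y => hC₁ ρ r r hρ hr1 hr2 hr1 hr2 (y - x)).trans ?_
        rw [lintegral_const_mul _ (by fun_prop)]
        exact mul_le_mul_right (hC₂ ρ hρ x) _
    _ = _ := by
        rw [lintegral_const]
        push_cast
        rw [ENNReal.coe_toNNReal (measure_ne_top ν univ)]
        ring

lemma lintegral_slopeKernel_ne_top (hr : 0 < r) (hr' : 0 < r') :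
    ∫⁻ x, ∫⁻ y, slopeKernel i R r r' (y - x) ∂μ ∂ν ≠ ∞ := by
  have hI : ∫⁻ v, cutoff R (v : Fin m → ℝ) ≠ ∞ := lintegral_cutoff_ne_top R
  have hN : (ENNReal.ofReal ((2 * r') ^ m))⁻¹ ≠ ∞ :=
    ENNReal.inv_ne_top.2 (ENNReal.ofReal_pos.2 (by positivity)).ne'
  refine ne_top_of_le_ne_top ?_
    (lintegral_mono fun x => lintegral_mono fun y => slopeKernel_le_const hr)
  simp only [lintegral_const]
  finiteness

lemma exists_lintegral_slopeDiff_sq_le (i : Fin (m + 1)) (hR : 1 ≤ R) {s : ℝ} {C : ℝ≥0}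
    (hμ : ∀ x, ∀ r : ℝ, 0 < r → μ (closedBall x r) ≤ C * ENNReal.ofReal (r ^ s))
    (hs : s < m + 1) :
    ∃ C' : ℝ≥0, ∀ ρ : ℝ, 0 < ρ →
      ∫⁻ v, cutoff R v * ∫⁻ p, slopeDiff i μ ρ v p * slopeDiff i μ ρ v p ≤
        C' * ENNReal.ofReal (ρ ^ (s - m)) := by
  obtain ⟨C₁, hC₁⟩ := exists_slopeKernel_add_le i hR
  obtain ⟨C₂, hC₂⟩ := exists_lintegral_inv_max_pow_le hμ (q := m + 1) (by exact_mod_cast hs)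
  refine ⟨C₁ * C₂ * (μ univ).toNNReal, fun ρ hρ => ?_⟩
  set H : ℝ → ℝ → ℝ≥0∞ := fun r r' => ∫⁻ x, ∫⁻ y, slopeKernel i R r r' (y - x) ∂μ ∂μ with hH
  have hHF : ∀ r r', ∫⁻ v, cutoff R v * ∫⁻ p, slopeDensity i μ r v p * slopeDensity i μ r' v p =
      H r r' := fun r r' => lintegral_slopeDensity_mul_slopeDensity i R r r'
  have hHtop : 2 * H ρ (ρ / 2) ≠ ∞ :=
    ENNReal.mul_ne_top (by simp) (lintegral_slopeKernel_ne_top hρ (half_pos hρ))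
  have hkm : ∀ r r', Measurable fun q : (Fin (m + 1) → ℝ) × (Fin (m + 1) → ℝ) =>
      slopeKernel i R r r' (q.2 - q.1) := by
    intro r r'
    unfold slopeKernel
    refine Measurable.lintegral_prod_right ?_
    refine ((measurable_cutoff R).comp (by fun_prop)).mul ?_
    exact Measurable.lintegral_prod_right (by fun_prop)
  have hsum : (∫⁻ v, cutoff R v * ∫⁻ p, slopeDiff i μ ρ v p * slopeDiff i μ ρ v p) +
      2 * H ρ (ρ / 2) = H ρ ρ + H (ρ / 2) (ρ / 2) := by
    have hFF : ∀ r r', Measurable fun v : Fin m → ℝ =>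
        ∫⁻ p, slopeDensity i μ r v p * slopeDensity i μ r' v p := fun r r' =>
      Measurable.lintegral_prod_right (by fun_prop)
    have hDD : Measurable fun v : Fin m → ℝ =>
        ∫⁻ p, slopeDiff i μ ρ v p * slopeDiff i μ ρ v p :=
      Measurable.lintegral_prod_right (by fun_prop)
    rw [← hHF, ← hHF, ← hHF, ← lintegral_const_mul _ (by fun_prop),
      ← lintegral_add_left (by fun_prop), ← lintegral_add_left (by fun_prop)]
    refine lintegral_congr fun v => ?_
    rw [mul_left_comm, ← mul_add, ← mul_add, ← lintegral_const_mul _ (by fun_prop),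
      ← lintegral_add_left (by fun_prop), ← lintegral_add_left (by fun_prop)]
    simp only [slopeDiff_sq_add]
  have hle : H ρ ρ + H (ρ / 2) (ρ / 2) ≤ C₁ * C₂ * (μ univ).toNNReal *
      ENNReal.ofReal (ρ ^ (s - m)) + 2 * H ρ (ρ / 2) := by
    calc H ρ ρ + H (ρ / 2) (ρ / 2)
        = ∫⁻ x, ∫⁻ y, (slopeKernel i R ρ ρ (y - x) + slopeKernel i R (ρ / 2) (ρ / 2) (y - x))
            ∂μ ∂μ := by
          rw [hH, ← lintegral_add_left (Measurable.lintegral_prod_right (hkm _ _))]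
          exact lintegral_congr fun x =>
            (lintegral_add_left ((hkm _ _).comp measurable_prodMk_left) _).symm
      _ ≤ ∫⁻ x, ∫⁻ y, (C₁ * (ENNReal.ofReal ρ * ENNReal.ofReal (max ρ ‖y - x‖)⁻¹ ^ (m + 1)) +
            2 * slopeKernel i R ρ (ρ / 2) (y - x)) ∂μ ∂μ := by
          refine lintegral_mono fun x => lintegral_mono fun y => ?_
          exact (hC₁ ρ hρ (y - x)).trans (add_comm _ _).le
      _ ≤ ∫⁻ x, (C₁ * (ENNReal.ofReal ρ * (C₂ * ENNReal.ofReal (ρ ^ (s - (m + 1 : ℕ))))) +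
            2 * ∫⁻ y, slopeKernel i R ρ (ρ / 2) (y - x) ∂μ) ∂μ := by
          refine lintegral_mono fun x => ?_
          rw [lintegral_add_left (by fun_prop), lintegral_const_mul _ (by fun_prop),
            lintegral_const_mul _ (by fun_prop),
            lintegral_const_mul' 2 _ (by simp)]
          gcongr
          exact hC₂ ρ hρ x
      _ = _ := by
          rw [lintegral_add_left (by fun_prop), lintegral_const,
            lintegral_const_mul _ (Measurable.lintegral_prod_right (hkm _ _)),
            ENNReal.coe_toNNReal (measure_ne_top μ univ)]
          congr 1
          have : ENNReal.ofReal (ρ ^ (s - m)) =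
              ENNReal.ofReal ρ * ENNReal.ofReal (ρ ^ (s - (m + 1 : ℕ))) := by
            rw [← ENNReal.ofReal_mul hρ.le, mul_comm, ← Real.rpow_add_one hρ.ne']
            congr 2
            push_cast
            ring
          rw [this]
          ring
  push_cast
  rw [← hsum] at hle
  exact (ENNReal.add_le_add_iff_right hHtop).1 hle

lemma ENNReal.mul_le_mul_sq_add (a b : ℝ≥0∞) {c : ℝ≥0∞} (hc : c ≠ 0) (hc' : c ≠ ∞) :
    a * b ≤ c * (a * a) + c⁻¹ * (b * b) := by
  rcases le_total b (c * a) with h | h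
  · refine le_trans ?_ le_self_add
    calc a * b ≤ a * (c * a) := by gcongr
      _ = _ := by ring
  · refine le_trans ?_ le_add_self
    have h' : a ≤ c⁻¹ * b := by
      calc a = c⁻¹ * (c * a) := by rw [← mul_assoc, ENNReal.inv_mul_cancel hc hc', one_mul]
        _ ≤ c⁻¹ * b := by gcongr
    calc a * b ≤ c⁻¹ * b * b := by gcongr
      _ = _ := by ring

lemma exists_lintegral_slopeDiff_mul_le (i : Fin (m + 1)) (hR : 1 ≤ R) {s t : ℝ} {C C' : ℝ≥0}
    (hμ : ∀ x, ∀ r : ℝ, 0 < r → μ (closedBall x r) ≤ C * ENNReal.ofReal (r ^ s))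
    (hν : ∀ x, ∀ r : ℝ, 0 < r → ν (closedBall x r) ≤ C' * ENNReal.ofReal (r ^ t))
    (hs : s < m + 1) (ht : t < m) :
    ∃ K : ℝ≥0, ∀ ρ : ℝ, 0 < ρ →
      ∫⁻ v, cutoff R v * ∫⁻ p, slopeDiff i μ ρ v p *
          (slopeDensity i ν ρ v p + slopeDensity i ν (ρ / 2) v p) ≤
        K * ENNReal.ofReal (ρ ^ ((s + t) / 2 - m)) := by
  obtain ⟨C₁, hC₁⟩ := exists_lintegral_slopeDiff_sq_le i hR hμ hs
  obtain ⟨C₂, hC₂⟩ := exists_lintegral_slopeDensity_sq_le i hR hν ht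
  refine ⟨2 * (C₁ + C₂), fun ρ hρ => ?_⟩
  set c := ENNReal.ofReal (ρ ^ ((t - s) / 2)) with hc
  have hc0 : c ≠ 0 := (ENNReal.ofReal_pos.2 (by positivity)).ne'
  have hctop : c ≠ ∞ := ENNReal.ofReal_ne_top
  have hone : ∀ r, ρ / 2 ≤ r → r ≤ ρ →
      ∫⁻ v, cutoff R v * ∫⁻ p, slopeDiff i μ ρ v p * slopeDensity i ν r v p ≤
        (C₁ + C₂) * ENNReal.ofReal (ρ ^ ((s + t) / 2 - m)) := by
    intro r hr1 hr2
    have hDD : Measurable fun v : Fin m → ℝ =>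
        ∫⁻ p, slopeDiff i μ ρ v p * slopeDiff i μ ρ v p :=
      Measurable.lintegral_prod_right (by fun_prop)
    have hGG : Measurable fun v : Fin m → ℝ =>
        ∫⁻ p, slopeDensity i ν r v p * slopeDensity i ν r v p :=
      Measurable.lintegral_prod_right (by fun_prop)
    calc ∫⁻ v, cutoff R v * ∫⁻ p, slopeDiff i μ ρ v p * slopeDensity i ν r v p
        ≤ ∫⁻ v, cutoff R v * ∫⁻ p, (c * (slopeDiff i μ ρ v p * slopeDiff i μ ρ v p) +
            c⁻¹ * (slopeDensity i ν r v p * slopeDensity i ν r v p)) := by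
          gcongr
          exact ENNReal.mul_le_mul_sq_add _ _ hc0 hctop
      _ = ∫⁻ v, (c * (cutoff R v * ∫⁻ p, slopeDiff i μ ρ v p * slopeDiff i μ ρ v p) +
            c⁻¹ * (cutoff R v * ∫⁻ p, slopeDensity i ν r v p * slopeDensity i ν r v p)) := by
          refine lintegral_congr fun v => ?_
          rw [lintegral_add_left (by fun_prop), lintegral_const_mul _ (by fun_prop),
            lintegral_const_mul _ (by fun_prop)]
          ring
      _ = c * (∫⁻ v, cutoff R v * ∫⁻ p, slopeDiff i μ ρ v p * slopeDiff i μ ρ v p) +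
            c⁻¹ * ∫⁻ v, cutoff R v * ∫⁻ p, slopeDensity i ν r v p * slopeDensity i ν r v p := by
          rw [lintegral_add_left (by fun_prop), lintegral_const_mul _ (by fun_prop),
            lintegral_const_mul _ (by fun_prop)]
      _ ≤ c * (C₁ * ENNReal.ofReal (ρ ^ (s - m))) + c⁻¹ * (C₂ * ENNReal.ofReal (ρ ^ (t - m))) := by
          gcongr
          · exact hC₁ ρ hρ
          · exact hC₂ ρ r hρ hr1 hr2
      _ = _ := by
          have h1 : ENNReal.ofReal (ρ ^ ((s + t) / 2 - m)) = c * ENNReal.ofReal (ρ ^ (s - m)) := by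
            rw [hc, ← ENNReal.ofReal_mul (by positivity), ← Real.rpow_add hρ]
            congr 2
            ring
          have h2 : ENNReal.ofReal (ρ ^ ((s + t) / 2 - m)) =
              c⁻¹ * ENNReal.ofReal (ρ ^ (t - m)) := by
            rw [hc, ← ENNReal.ofReal_inv_of_pos (by positivity), ← Real.rpow_neg hρ.le,
              ← ENNReal.ofReal_mul (by positivity), ← Real.rpow_add hρ]
            congr 2
            ring
          rw [add_mul]
          nth_rewrite 1 [h1]
          rw [h2]
          ring
  have hDG : ∀ r, Measurable fun v : Fin m → ℝ =>
      ∫⁻ p, slopeDiff i μ ρ v p * slopeDensity i ν r v p := fun r =>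
    Measurable.lintegral_prod_right (by fun_prop)
  calc ∫⁻ v, cutoff R v * ∫⁻ p, slopeDiff i μ ρ v p *
          (slopeDensity i ν ρ v p + slopeDensity i ν (ρ / 2) v p)
      = (∫⁻ v, cutoff R v * ∫⁻ p, slopeDiff i μ ρ v p * slopeDensity i ν ρ v p) +
          ∫⁻ v, cutoff R v * ∫⁻ p, slopeDiff i μ ρ v p * slopeDensity i ν (ρ / 2) v p := by
        rw [← lintegral_add_left (by fun_prop)]
        refine lintegral_congr fun v => ?_
        rw [← mul_add, ← lintegral_add_left (by fun_prop)]
        simp only [mul_add]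
    _ ≤ (C₁ + C₂) * ENNReal.ofReal (ρ ^ ((s + t) / 2 - m)) +
          (C₁ + C₂) * ENNReal.ofReal (ρ ^ ((s + t) / 2 - m)) :=
        add_le_add (hone ρ (by linarith) le_rfl) (hone _ le_rfl (by linarith))
    _ = _ := by
        push_cast
        ring

end Densities

section Correlation

variable {m : ℕ}

/-- The density at scale `r` of the projection of `μ` along the lines of slope `v`, averaged
over the ball of radius `r` about the projection of `x`. -/
noncomputable def slopeCorrelation (i : Fin (m + 1)) (μ : Measure (Fin (m + 1) → ℝ)) (r : ℝ)
    (v : Fin m → ℝ) (x : Fin (m + 1) → ℝ) : ℝ≥0∞ :=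
  ∫⁻ p, slopeDensity i μ r v p * ballKernel r (p - slopeProj i v x)

/-- A bound for the increment of `slopeCorrelation` from the scale `ρ / 2` to the scale `ρ`. -/
noncomputable def slopeIncrement (i : Fin (m + 1)) (μ : Measure (Fin (m + 1) → ℝ)) (ρ : ℝ)
    (v : Fin m → ℝ) (x : Fin (m + 1) → ℝ) : ℝ≥0∞ :=
  ∫⁻ p, slopeDiff i μ ρ v p *
    (ballKernel ρ (p - slopeProj i v x) + ballKernel (ρ / 2) (p - slopeProj i v x))

variable {i : Fin (m + 1)} {μ ν : Measure (Fin (m + 1) → ℝ)} {r r' ρ : ℝ} {v : Fin m → ℝ}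
  {x : Fin (m + 1) → ℝ}

lemma le_tsum_of_forall_le_add {a d : ℕ → ℝ≥0∞} (h : ∀ j, a j ≤ a (j + 1) + d j) {J : ℕ}
    (hJ : ∀ j, J ≤ j → a j = 0) (j : ℕ) : a j ≤ ∑' k, d (j + k) := by
  have hn : ∀ n, a j ≤ a (j + n) + ∑ k ∈ Finset.range n, d (j + k) := by
    intro n
    induction n with
    | zero => simp
    | succ n ih =>
      rw [Finset.sum_range_succ, add_comm (∑ k ∈ _, _), ← add_assoc]
      exact ih.trans (add_le_add (h _) le_rfl)
  refine (hn J).trans ?_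
  rw [hJ _ (Nat.le_add_left J j), zero_add]
  exact ENNReal.sum_le_tsum _

lemma exists_slopeCorrelation_eq_zero {K : Set (Fin (m + 1) → ℝ)} (hK : IsCompact K)
    (hμK : μ Kᶜ = 0) (h : ∀ y ∈ K, slopeProj i v (y - x) ≠ 0) :
    ∃ ε > 0, ∀ r : ℝ, 2 * r < ε → slopeCorrelation i μ r v x = 0 := by
  have hcont : Continuous fun y => slopeProj i v (y - x) :=
    (continuous_slopeProj i).comp (continuous_const.prodMk (continuous_id.sub continuous_const))
  obtain ⟨ε, hε, hεK⟩ : ∃ ε > 0, ∀ y ∈ K, ε ≤ ‖slopeProj i v (y - x)‖ := by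
    rcases K.eq_empty_or_nonempty with rfl | hne
    · exact ⟨1, one_pos, by simp⟩
    · obtain ⟨y₀, hy₀, hmin⟩ := hK.exists_isMinOn hne hcont.norm.continuousOn
      exact ⟨_, norm_pos_iff.2 (h y₀ hy₀), fun y hy => hmin hy⟩
  refine ⟨ε, hε, fun r hr => (lintegral_congr fun p => ?_).trans lintegral_zero⟩
  by_cases hp : ballKernel r (p - slopeProj i v x) = 0
  · rw [hp, mul_zero]
  refine mul_eq_zero_of_left ?_ _
  have hp' : ‖p - slopeProj i v x‖ ≤ r := not_lt.1 fun h' => hp (ballKernel_of_lt_norm h')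
  have hae : ∀ᵐ y ∂μ, y ∈ K := hμK
  rw [slopeDensity]
  refine (lintegral_congr_ae ?_).trans lintegral_zero
  filter_upwards [hae] with y hy
  refine ballKernel_of_lt_norm ?_
  have h1 := hεK y hy
  have h2 : slopeProj i v (y - x) = (p - slopeProj i v x) - (p - slopeProj i v y) := by
    rw [slopeProj_sub]
    abel
  rw [h2] at h1
  have := norm_sub_le (p - slopeProj i v x) (p - slopeProj i v y)
  linarith

variable [IsFiniteMeasure μ] [IsFiniteMeasure ν]

lemma lintegral_slopeDensity_mul_ballKernel_comm (A : Fin m → ℝ) :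
    ∫⁻ p, slopeDensity i μ r v p * ballKernel r' (p - A) =
      ∫⁻ p, slopeDensity i μ r' v p * ballKernel r (p - A) := by
  have h : ∀ r r', ∫⁻ p, slopeDensity i μ r v p * ballKernel r' (p - A) =
      ∫⁻ y, (∫⁻ p, ballKernel r (p - slopeProj i v y) * ballKernel r' (p - A)) ∂μ := by
    intro r r'
    rw [lintegral_lintegral_swap (by fun_prop)]
    exact lintegral_congr fun p => (lintegral_mul_const _ (by fun_prop)).symm
  rw [h, h]
  refine lintegral_congr fun y => ?_
  rw [← lintegral_sub_left_eq_self _ (slopeProj i v y + A)]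
  refine lintegral_congr fun p => ?_
  rw [← ballKernel_neg, mul_comm, ← ballKernel_neg]
  congr 2 <;> abel

lemma slopeCorrelation_le_add :
    slopeCorrelation i μ ρ v x ≤ slopeCorrelation i μ (ρ / 2) v x + slopeIncrement i μ ρ v x := by
  have h1 : ∀ p, slopeDensity i μ ρ v p ≤ slopeDensity i μ (ρ / 2) v p + slopeDiff i μ ρ v p := by
    intro p
    rw [slopeDiff, ← add_assoc]
    exact le_add_tsub.trans le_self_add
  have h2 : ∀ r', ∫⁻ p, slopeDensity i μ ρ v p * ballKernel r' (p - slopeProj i v x) ≤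
      (∫⁻ p, slopeDensity i μ (ρ / 2) v p * ballKernel r' (p - slopeProj i v x)) +
        ∫⁻ p, slopeDiff i μ ρ v p * ballKernel r' (p - slopeProj i v x) := by
    intro r'
    rw [← lintegral_add_left (by fun_prop)]
    refine lintegral_mono fun p => ?_
    rw [← add_mul]
    exact mul_le_mul_left (h1 p) _
  have h3 : slopeIncrement i μ ρ v x =
      (∫⁻ p, slopeDiff i μ ρ v p * ballKernel ρ (p - slopeProj i v x)) +
        ∫⁻ p, slopeDiff i μ ρ v p * ballKernel (ρ / 2) (p - slopeProj i v x) := by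
    rw [slopeIncrement, ← lintegral_add_left (by fun_prop)]
    simp only [mul_add]
  calc slopeCorrelation i μ ρ v x ≤ _ := h2 ρ
    _ ≤ ((∫⁻ p, slopeDensity i μ (ρ / 2) v p * ballKernel (ρ / 2) (p - slopeProj i v x)) +
        ∫⁻ p, slopeDiff i μ ρ v p * ballKernel (ρ / 2) (p - slopeProj i v x)) +
        ∫⁻ p, slopeDiff i μ ρ v p * ballKernel ρ (p - slopeProj i v x) := by
      refine add_le_add ?_ le_rfl
      rw [lintegral_slopeDensity_mul_ballKernel_comm]
      exact h2 (ρ / 2)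
    _ = _ := by
      rw [h3, slopeCorrelation, add_assoc, add_comm (∫⁻ p, slopeDiff i μ ρ v p * ballKernel ρ _)]

lemma lintegral_slopeCorrelation :
    ∫⁻ x, slopeCorrelation i μ r v x ∂ν =
      ∫⁻ p, slopeDensity i μ r v p * slopeDensity i ν r v p := by
  unfold slopeCorrelation
  rw [lintegral_lintegral_swap (by fun_prop)]
  exact lintegral_congr fun p => lintegral_const_mul _ (by fun_prop)

lemma lintegral_slopeIncrement :
    ∫⁻ x, slopeIncrement i μ ρ v x ∂ν =
      ∫⁻ p, slopeDiff i μ ρ v p * (slopeDensity i ν ρ v p + slopeDensity i ν (ρ / 2) v p) := by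
  unfold slopeIncrement
  rw [lintegral_lintegral_swap (by fun_prop)]
  refine lintegral_congr fun p => ?_
  rw [lintegral_const_mul _ (by fun_prop), lintegral_add_left (by fun_prop)]
  rfl

@[fun_prop]
lemma Measurable.slopeCorrelation {α : Type*} [MeasurableSpace α] {f : α → Fin m → ℝ}
    {g : α → Fin (m + 1) → ℝ} (hf : Measurable f) (hg : Measurable g) :
    Measurable fun x => slopeCorrelation i μ r (f x) (g x) := by
  unfold _root_.slopeCorrelation
  exact Measurable.lintegral_prod_right (by fun_prop)

@[fun_prop]
lemma Measurable.slopeIncrement {α : Type*} [MeasurableSpace α] {f : α → Fin m → ℝ}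
    {g : α → Fin (m + 1) → ℝ} (hf : Measurable f) (hg : Measurable g) :
    Measurable fun x => slopeIncrement i μ ρ (f x) (g x) := by
  unfold _root_.slopeIncrement
  exact Measurable.lintegral_prod_right (by fun_prop)

end Correlation

section Directions

variable {m : ℕ} {i : Fin (m + 1)} {μ ν : Measure (Fin (m + 1) → ℝ)} [IsFiniteMeasure μ]
  [IsFiniteMeasure ν] {R : ℝ} {K₁ K₂ : Set (Fin (m + 1) → ℝ)}

lemma exists_le_lintegral_slopeKernel_add (hK₁ : IsCompact K₁) (hK₂ : IsCompact K₂)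
    (hμK : μ K₁ᶜ = 0) (hνK : ν K₂ᶜ = 0) (hμ0 : μ univ ≠ 0) (hν0 : ν univ ≠ 0) {c : ℝ} (hc : 0 < c)
    (hsep : ∀ x ∈ K₂, ∀ y ∈ K₁, c ≤ |(y - x) i|) :
    ∃ R : ℝ, 1 ≤ R ∧ ∃ κ : ℝ≥0∞, κ ≠ 0 ∧ ∃ C : ℝ≥0, ∀ r : ℝ, 0 < r →
      κ ≤ (∫⁻ x, ∫⁻ y, slopeKernel i R r r (y - x) ∂μ ∂ν) + C * ENNReal.ofReal r := by
  obtain ⟨M₁, hM₁0, hM₁⟩ := hK₁.isBounded.exists_pos_norm_le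
  obtain ⟨M₂, hM₂0, hM₂⟩ := hK₂.isBounded.exists_pos_norm_le
  set M := M₁ + M₂ with hM
  have hM0 : 0 < M := by positivity
  set κ := ENNReal.ofReal M⁻¹ ^ m with hκ
  have hκ0 : κ ≠ 0 := pow_ne_zero _ (ENNReal.ofReal_pos.2 (by positivity)).ne'
  refine ⟨M / c + 1, le_add_of_nonneg_left (by positivity), κ * μ univ * ν univ,
    mul_ne_zero (mul_ne_zero hκ0 hμ0) hν0,
    2 * (Real.toNNReal c⁻¹) ^ (m + 1) * (μ univ).toNNReal * (ν univ).toNNReal, fun r hr => ?_⟩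
  have hpt : ∀ x ∈ K₂, ∀ y ∈ K₁, κ ≤ slopeKernel i (M / c + 1) r r (y - x) +
      ENNReal.ofReal c⁻¹ ^ (m + 1) * ENNReal.ofReal (r + r) := by
    intro x hx y hy
    have hz := hsep x hx y hy
    have hzM : ‖y - x‖ ≤ M := (norm_sub_le y x).trans (add_le_add (hM₁ y hy) (hM₂ x hx))
    have hzM' : |(y - x) i| ≤ M := (norm_le_pi_norm (y - x) i).trans hzM
    have hz0 : (y - x) i ≠ 0 := abs_pos.1 (hc.trans_le hz)
    have hbM : ‖i.removeNth (y - x)‖ ≤ M :=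
      (pi_norm_le_iff_of_nonneg hM0.le).2 fun k => (norm_le_pi_norm (y - x) _).trans hzM
    have hcut : 1 ≤ cutoff (M / c + 1) (((y - x) i)⁻¹ • i.removeNth (y - x)) := by
      rw [cutoff, ENNReal.one_le_ofReal]
      have : ‖((y - x) i)⁻¹ • i.removeNth (y - x)‖ ≤ M / c := by
        rw [norm_smul, norm_inv, Real.norm_eq_abs, inv_mul_eq_div]
        gcongr
      linarith
    have hω1 : ENNReal.ofReal M⁻¹ ≤ ENNReal.ofReal |(y - x) i|⁻¹ :=
      ENNReal.ofReal_le_ofReal (inv_anti₀ (hc.trans_le hz) hzM')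
    have hω2 : ENNReal.ofReal |(y - x) i|⁻¹ ≤ ENNReal.ofReal c⁻¹ :=
      ENNReal.ofReal_le_ofReal (inv_anti₀ hc hz)
    calc κ = ENNReal.ofReal M⁻¹ ^ m * 1 := (mul_one _).symm
      _ ≤ ENNReal.ofReal |(y - x) i|⁻¹ ^ m *
          cutoff (M / c + 1) (((y - x) i)⁻¹ • i.removeNth (y - x)) := by gcongr
      _ ≤ _ := le_slopeKernel_add hr hr hz0
      _ ≤ slopeKernel i (M / c + 1) r r (y - x) +
          ENNReal.ofReal c⁻¹ ^ m * (ENNReal.ofReal c⁻¹ * ENNReal.ofReal (r + r)) := by gcongr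
      _ = _ := by ring
  have hae₁ : ∀ᵐ y ∂μ, y ∈ K₁ := hμK
  have hae₂ : ∀ᵐ x ∂ν, x ∈ K₂ := hνK
  calc κ * μ univ * ν univ = ∫⁻ _, ∫⁻ _, κ ∂μ ∂ν := by simp only [lintegral_const]
    _ ≤ ∫⁻ x, ((∫⁻ y, slopeKernel i (M / c + 1) r r (y - x) ∂μ) +
          ENNReal.ofReal c⁻¹ ^ (m + 1) * ENNReal.ofReal (r + r) * μ univ) ∂ν := by
        refine lintegral_mono_ae ?_
        filter_upwards [hae₂] with x hx
        rw [← lintegral_const, ← lintegral_add_right _ measurable_const]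
        refine lintegral_mono_ae ?_
        filter_upwards [hae₁] with y hy
        exact hpt x hx y hy
    _ = _ := by
        rw [lintegral_add_right _ measurable_const, lintegral_const]
        push_cast
        rw [ENNReal.coe_toNNReal (measure_ne_top μ univ),
          ENNReal.coe_toNNReal (measure_ne_top ν univ), ENNReal.ofReal_add hr.le hr.le]
        change _ = _ + 2 * ENNReal.ofReal c⁻¹ ^ (m + 1) * _ * _ * _
        ring

/-- If the sum of the exponents of two measures on `ℝᵐ⁺¹` exceeds `2m`, then the second one charges
a point from which the support of the first one is seen in a set of slopes of positive measure. -/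
theorem exists_volume_slopes_ne_zero {s t : ℝ} {C C' : ℝ≥0}
    (hμ : ∀ x, ∀ r : ℝ, 0 < r → μ (closedBall x r) ≤ C * ENNReal.ofReal (r ^ s))
    (hν : ∀ x, ∀ r : ℝ, 0 < r → ν (closedBall x r) ≤ C' * ENNReal.ofReal (r ^ t))
    (hs : s < m + 1) (ht : t < m) (hst : 2 * m < s + t)
    (hK₁ : IsCompact K₁) (hK₂ : IsCompact K₂)
    (hμK : μ K₁ᶜ = 0) (hνK : ν K₂ᶜ = 0) (hμ0 : μ univ ≠ 0) (hν0 : ν univ ≠ 0) {c : ℝ} (hc : 0 < c)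
    (hsep : ∀ x ∈ K₂, ∀ y ∈ K₁, c ≤ |(y - x) i|) :
    ∃ x ∈ K₂, volume {v | ∃ y ∈ K₁, slopeProj i v (y - x) = 0} ≠ 0 := by
  by_contra! hnull
  obtain ⟨R, hR, κ, hκ, C₀, hC₀⟩ :=
    exists_le_lintegral_slopeKernel_add hK₁ hK₂ hμK hνK hμ0 hν0 hc hsep
  obtain ⟨D, hD⟩ := exists_lintegral_slopeDiff_mul_le i hR hμ hν hs ht
  set ρ : ℕ → ℝ := fun j => 2⁻¹ ^ j with hρ
  have hρ0 : ∀ j, 0 < ρ j := fun j => by positivity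
  have hρtendsto : Filter.Tendsto ρ Filter.atTop (nhds 0) :=
    tendsto_pow_atTop_nhds_zero_of_lt_one (by norm_num) (by norm_num)
  set b := ENNReal.ofReal (2⁻¹ ^ ((s + t) / 2 - m)) with hb
  have hb1 : b < 1 := by
    rw [hb, ENNReal.ofReal_lt_one]
    exact Real.rpow_lt_one (by norm_num) (by norm_num) (by linarith)
  have hDb : ∀ j, ∫⁻ v, cutoff R v * ∫⁻ x, slopeIncrement i μ (ρ j) v x ∂ν ≤ D * b ^ j := by
    intro j
    simp only [lintegral_slopeIncrement]
    refine (hD (ρ j) (hρ0 j)).trans_eq ?_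
    rw [hb, ← ENNReal.ofReal_pow (by positivity), ← Real.rpow_natCast,
      ← Real.rpow_mul (by norm_num), mul_comm _ (j : ℝ),
      Real.rpow_mul (by norm_num), Real.rpow_natCast]
  have htel : ∀ j, ∀ᵐ x ∂ν, ∀ᵐ v,
      slopeCorrelation i μ (ρ j) v x ≤ ∑' k, slopeIncrement i μ (ρ (j + k)) v x := by
    intro j
    have hae₂ : ∀ᵐ x ∂ν, x ∈ K₂ := hνK
    filter_upwards [hae₂] with x hx
    have hv : ∀ᵐ v : Fin m → ℝ, ¬ ∃ y ∈ K₁, slopeProj i v (y - x) = 0 :=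
      measure_eq_zero_iff_ae_notMem.1 (hnull x hx)
    filter_upwards [hv] with v hv
    push Not at hv
    obtain ⟨ε, hε, hεr⟩ := exists_slopeCorrelation_eq_zero hK₁ hμK hv
    obtain ⟨J, hJ⟩ := Filter.eventually_atTop.1
      (hρtendsto.eventually_lt_const (half_pos hε))
    have hJ0 : ∀ k, J ≤ k → slopeCorrelation i μ (ρ k) v x = 0 :=
      fun k hk => hεr (ρ k) (by linarith [hJ k hk])
    refine le_tsum_of_forall_le_add (a := fun k => slopeCorrelation i μ (ρ k) v x)
      (d := fun k => slopeIncrement i μ (ρ k) v x) (J := J) (fun k => ?_) hJ0 j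
    have h2 : ρ (k + 1) = ρ k / 2 := by
      simp only [hρ, pow_succ]
      ring
    simp only [h2]
    exact slopeCorrelation_le_add
  have hΛ : ∀ j, ∫⁻ x, ∫⁻ y, slopeKernel i R (ρ j) (ρ j) (y - x) ∂μ ∂ν ≤
      D * (1 - b)⁻¹ * b ^ j := by
    intro j
    calc ∫⁻ x, ∫⁻ y, slopeKernel i R (ρ j) (ρ j) (y - x) ∂μ ∂ν
        = ∫⁻ v, cutoff R v * ∫⁻ x, slopeCorrelation i μ (ρ j) v x ∂ν := by
          rw [← lintegral_slopeDensity_mul_slopeDensity]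
          simp only [lintegral_slopeCorrelation]
      _ = ∫⁻ v, ∫⁻ x, cutoff R v * slopeCorrelation i μ (ρ j) v x ∂ν :=
          lintegral_congr fun v => (lintegral_const_mul _ (by fun_prop)).symm
      _ = ∫⁻ x, (∫⁻ v, cutoff R v * slopeCorrelation i μ (ρ j) v x) ∂ν :=
          lintegral_lintegral_swap (by fun_prop)
      _ ≤ ∫⁻ x, (∫⁻ v, ∑' k, cutoff R v * slopeIncrement i μ (ρ (j + k)) v x) ∂ν := by
          refine lintegral_mono_ae ?_
          filter_upwards [htel j] with x hx
          refine lintegral_mono_ae ?_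
          filter_upwards [hx] with v hv
          rw [ENNReal.tsum_mul_left]
          exact mul_le_mul_right hv _
      _ = ∑' k, ∫⁻ x, (∫⁻ v, cutoff R v * slopeIncrement i μ (ρ (j + k)) v x) ∂ν := by
          rw [← lintegral_tsum fun k =>
            (Measurable.lintegral_prod_right (by fun_prop)).aemeasurable]
          exact lintegral_congr fun x => lintegral_tsum fun k => by fun_prop
      _ = ∑' k, ∫⁻ v, cutoff R v * ∫⁻ x, slopeIncrement i μ (ρ (j + k)) v x ∂ν := by
          refine tsum_congr fun k => ?_
          rw [lintegral_lintegral_swap (by fun_prop)]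
          exact lintegral_congr fun v => lintegral_const_mul _ (by fun_prop)
      _ ≤ ∑' k, D * b ^ j * b ^ k := by
          refine ENNReal.tsum_le_tsum fun k => (hDb (j + k)).trans_eq ?_
          rw [pow_add, mul_assoc]
      _ = _ := by
          rw [ENNReal.tsum_mul_left, ENNReal.tsum_geometric]
          ring
  have hlim : Filter.Tendsto (fun j => D * (1 - b)⁻¹ * b ^ j + C₀ * ENNReal.ofReal (ρ j))
      Filter.atTop (nhds 0) := by
    have h1 : D * (1 - b)⁻¹ ≠ ∞ := by
      have : 1 - b ≠ 0 := (tsub_pos_of_lt hb1).ne'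
      finiteness
    have h2 := ENNReal.Tendsto.const_mul (a := D * (1 - b)⁻¹)
      (ENNReal.tendsto_pow_atTop_nhds_zero_of_lt_one hb1) (Or.inr h1)
    have h3 := ENNReal.Tendsto.const_mul (a := (C₀ : ℝ≥0∞))
      (ENNReal.tendsto_ofReal hρtendsto) (Or.inr ENNReal.coe_ne_top)
    simpa using h2.add h3
  refine hκ (le_antisymm (ge_of_tendsto' hlim fun j => ?_) zero_le)
  exact (hC₀ (ρ j) (hρ0 j)).trans (add_le_add (hΛ j) le_rfl)

end Directions

section Assembly

variable {m : ℕ}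

lemma isClosed_setOf_exists_slopeProj_eq_zero (i : Fin (m + 1)) {K : Set (Fin (m + 1) → ℝ)}
    (hK : IsCompact K) :
    IsClosed {p : (Fin (m + 1) → ℝ) × (Fin m → ℝ) | ∃ y ∈ K, slopeProj i p.2 (y - p.1) = 0} := by
  have : CompactSpace K := isCompact_iff_compactSpace.1 hK
  have hcl : IsClosed {q : K × ((Fin (m + 1) → ℝ) × (Fin m → ℝ)) |
      slopeProj i q.2.2 ((q.1 : Fin (m + 1) → ℝ) - q.2.1) = 0} :=
    isClosed_eq ((continuous_slopeProj i).comp (by fun_prop :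
      Continuous fun q : K × ((Fin (m + 1) → ℝ) × (Fin m → ℝ)) =>
        (q.2.2, (q.1 : Fin (m + 1) → ℝ) - q.2.1))) continuous_const
  convert isClosedMap_snd_of_compactSpace _ hcl using 1
  ext p
  simp

lemma measurableSet_volume_slopes_eq_zero (i : Fin (m + 1)) {K : Set (Fin (m + 1) → ℝ)}
    (hK : IsCompact K) :
    MeasurableSet {x | volume {v | ∃ y ∈ K, slopeProj i v (y - x) = 0} = 0} :=
  (measurable_measure_prodMk_left (ν := (volume : Measure (Fin m → ℝ)))
    (isClosed_setOf_exists_slopeProj_eq_zero i hK).measurableSet) (measurableSet_singleton 0)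

lemma exists_ne_forall_measure_closedBall_ne_zero {X : Type*} [MetricSpace X]
    [SecondCountableTopology X] [MeasurableSpace X] {μ : Measure X} [NullSingletonClass μ]
    (hμ : μ univ ≠ 0) :
    ∃ y₁ y₂, y₁ ≠ y₂ ∧ (∀ r > 0, μ (closedBall y₁ r) ≠ 0) ∧ ∀ r > 0, μ (closedBall y₂ r) ≠ 0 := by
  obtain ⟨y₁, -, h₁⟩ := exists_mem_forall_mem_nhdsWithin_pos_measure hμ
  have hμ' : μ {y₁}ᶜ ≠ 0 := by
    intro h
    refine hμ (le_antisymm ?_ zero_le)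
    rw [← union_compl_self {y₁}]
    exact (measure_union_le _ _).trans (by simp [h])
  obtain ⟨y₂, h₂mem, h₂⟩ := exists_mem_forall_mem_nhdsWithin_pos_measure hμ'
  exact ⟨y₁, y₂, fun h => h₂mem h.symm,
    fun r hr => (h₁ _ (mem_nhdsWithin_of_mem_nhds (closedBall_mem_nhds _ hr))).ne',
    fun r hr => (h₂ _ (mem_nhdsWithin_of_mem_nhds (closedBall_mem_nhds _ hr))).ne'⟩

lemma nullSingletonClass_of_measure_closedBall_le {X : Type*} [PseudoMetricSpace X]
    [MeasurableSpace X]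
    {μ : Measure X} {s : ℝ} (hs : 0 < s) {C : ℝ≥0}
    (hμ : ∀ x, ∀ r : ℝ, 0 < r → μ (closedBall x r) ≤ C * ENNReal.ofReal (r ^ s)) :
    NullSingletonClass μ := by
  refine ⟨fun x => le_antisymm ?_ zero_le⟩
  have hlim : Filter.Tendsto (fun r : ℝ => (C : ℝ≥0∞) * ENNReal.ofReal (r ^ s))
      (nhdsWithin 0 (Ioi 0)) (nhds 0) := by
    have h1 : Filter.Tendsto (fun r : ℝ => r ^ s) (nhdsWithin 0 (Ioi 0)) (nhds 0) := by
      have := (Real.continuousAt_rpow_const 0 s (Or.inr hs.le)).tendsto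
      rw [Real.zero_rpow hs.ne'] at this
      exact this.mono_left nhdsWithin_le_nhds
    simpa using ENNReal.Tendsto.const_mul (a := (C : ℝ≥0∞))
      (ENNReal.tendsto_ofReal h1) (Or.inr ENNReal.coe_ne_top)
  refine ge_of_tendsto hlim ?_
  filter_upwards [self_mem_nhdsWithin] with r hr
  exact (measure_mono (singleton_subset_iff.2 (mem_closedBall_self (le_of_lt hr)))).trans
    (hμ x r hr)

lemma exists_lt_dimH_diff_ball {X : Type*} [MetricSpace X] {F : Set X} {a : ℝ≥0∞}
    (hF : a < dimH F) {y₁ y₂ : X} (hy : y₁ ≠ y₂) :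
    ∃ ρ > 0, a < dimH (F \ ball y₁ ρ) ∨ a < dimH (F \ ball y₂ ρ) := by
  refine ⟨dist y₁ y₂ / 2, half_pos (dist_pos.2 hy), ?_⟩
  rw [← lt_sup_iff, ← dimH_union, ← sdiff_inter,
    (ball_disjoint_ball (by linarith)).inter_eq, sdiff_empty]
  exact hF

lemma exists_lt_dimH_inter_coord {F : Set (Fin (m + 1) → ℝ)} {a : ℝ≥0∞} {ρ : ℝ}
    {y : Fin (m + 1) → ℝ} (hρ : 0 < ρ) (hF : a < dimH (F \ ball y ρ)) :
    ∃ i, a < dimH (F ∩ {x | ρ ≤ |(y - x) i|}) := by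
  have hsub : F \ ball y ρ ⊆ ⋃ i, F ∩ {x | ρ ≤ |(y - x) i|} := by
    rintro x ⟨hxF, hx⟩
    by_contra! hcon
    simp only [mem_iUnion, mem_inter_iff, mem_ofPred_eq, not_exists, not_and, not_le] at hcon
    refine hx ?_
    rw [mem_ball', dist_eq_norm, pi_norm_lt_iff hρ]
    exact fun i => hcon i hxF
  simpa [dimH_iUnion, lt_iSup_iff] using hF.trans_le (dimH_mono hsub)

/-- If `dim A > m` and `dim A + dim F > 2m` in `ℝᵐ⁺¹`, then some point of `F` sees a compact part of
`A` in a set of slopes of positive measure. -/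
theorem exists_mem_volume_slopes_ne_zero (hm : 1 ≤ m) {A F : Set (Fin (m + 1) → ℝ)}
    (hA : MeasurableSet A) (hdA : (m : ℝ≥0∞) < dimH A) (hdAF : 2 * (m : ℝ≥0∞) < dimH A + dimH F) :
    ∃ i, ∃ K ⊆ A, IsCompact K ∧ ∃ x ∈ F, (∃ c > 0, ∀ y ∈ K, c ≤ |(y - x) i|) ∧
      volume {v | ∃ y ∈ K, slopeProj i v (y - x) = 0} ≠ 0 := by
  have hfin : ∀ D : Set (Fin (m + 1) → ℝ), dimH D ≤ (m + 1 : ℕ) := fun D => by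
    simpa [Real.dimH_univ_pi_fin] using dimH_mono (subset_univ D)
  obtain ⟨dA, hdA'⟩ : ∃ d : ℝ≥0, (d : ℝ≥0∞) = dimH A :=
    ⟨_, ENNReal.coe_toNNReal ((hfin A).trans_lt (ENNReal.natCast_lt_top _)).ne⟩
  obtain ⟨dF, hdF'⟩ : ∃ d : ℝ≥0, (d : ℝ≥0∞) = dimH F :=
    ⟨_, ENNReal.coe_toNNReal ((hfin F).trans_lt (ENNReal.natCast_lt_top _)).ne⟩
  have hdA1 := hfin A
  rw [← hdA'] at hdA hdAF hdA1
  rw [← hdF'] at hdAF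
  norm_cast at hdA hdAF hdA1
  have hdA_real : (m : ℝ) < dA := by exact_mod_cast hdA
  have hdA1_real : (dA : ℝ) ≤ m + 1 := by exact_mod_cast hdA1
  have hdAF_real : 2 * (m : ℝ) < dA + dF := by exact_mod_cast hdAF
  have hm_real : (1 : ℝ) ≤ m := by exact_mod_cast hm
  obtain ⟨s, hs1, hs2⟩ := exists_between
    (max_lt hdA_real (by linarith : 2 * (m : ℝ) - dF < dA))
  obtain ⟨hsm, hsF⟩ := max_lt_iff.1 hs1
  obtain ⟨t, ht1, ht2⟩ := exists_between
    (lt_min (by linarith : 2 * (m : ℝ) - s < dF) (by linarith : 2 * (m : ℝ) - s < m))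
  obtain ⟨htF, htm⟩ := lt_min_iff.1 ht2
  have hs0 : 0 < s := by linarith
  have ht0 : 0 < t := by linarith
  lift s to ℝ≥0 using hs0.le
  lift t to ℝ≥0 using ht0.le
  obtain ⟨K, hKA, hK, μ, hμfin, hμ0, hμK, C, hμ⟩ := exists_frostman (a := s)
    (by exact_mod_cast hs0) hA (by rw [← hdA']; exact_mod_cast hs2)
  have : NullSingletonClass μ := nullSingletonClass_of_measure_closedBall_le hs0 hμ
  have htF' : (t : ℝ≥0∞) < dimH F := by rw [← hdF']; exact_mod_cast htF
  obtain ⟨y, hy, ρ, hρ, hρF⟩ : ∃ y, (∀ r > 0, μ (closedBall y r) ≠ 0) ∧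
      ∃ ρ > 0, (t : ℝ≥0∞) < dimH (F \ ball y ρ) := by
    obtain ⟨y₁, y₂, hne, h₁, h₂⟩ := exists_ne_forall_measure_closedBall_ne_zero hμ0
    obtain ⟨ρ, hρ, h | h⟩ := exists_lt_dimH_diff_ball htF' hne
    exacts [⟨y₁, h₁, ρ, hρ, h⟩, ⟨y₂, h₂, ρ, hρ, h⟩]
  obtain ⟨i, hi⟩ := exists_lt_dimH_inter_coord hρ hρF
  set K₁ := K ∩ closedBall y (ρ / 2) with hK₁def
  have hK₁ : IsCompact K₁ := hK.inter_right isClosed_closedBall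
  have hsep : ∀ x ∈ {x | ρ ≤ |(y - x) i|}, ∀ z ∈ K₁, ρ / 2 ≤ |(z - x) i| := by
    rintro x hx z ⟨-, hz⟩
    have hx : ρ ≤ |(y - x) i| := hx
    have h1 : |(z - y) i| ≤ ρ / 2 :=
      (norm_le_pi_norm (z - y) i).trans (mem_closedBall_iff_norm.1 hz)
    simp only [Pi.sub_apply] at *
    have := abs_sub_le (y i) (z i) (x i)
    rw [abs_sub_comm (y i) (z i)] at this
    linarith
  refine ⟨i, K₁, inter_subset_left.trans hKA, hK₁, ?_⟩
  by_contra! hcon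
  set Z := {x | ρ ≤ |(y - x) i|} ∩ {x | volume {v | ∃ z ∈ K₁, slopeProj i v (z - x) = 0} = 0}
  have hZ : MeasurableSet Z := by
    refine (measurableSet_le measurable_const ?_).inter (measurableSet_volume_slopes_eq_zero i hK₁)
    fun_prop
  have hFZ : F ∩ {x | ρ ≤ |(y - x) i|} ⊆ Z := fun x hx =>
    ⟨hx.2, hcon x hx.1 ⟨ρ / 2, half_pos hρ, hsep x hx.2⟩⟩
  obtain ⟨K₂, hK₂Z, hK₂, ν, hνfin, hν0, hνK, C', hν⟩ := exists_frostman (a := t)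
    (by exact_mod_cast ht0) hZ (hi.trans_le (dimH_mono hFZ))
  obtain ⟨x, hx, hx0⟩ := exists_volume_slopes_ne_zero (i := i) (μ := μ.restrict K₁) (ν := ν)
    (fun x r hr => (Measure.restrict_apply_le _ _).trans (hμ x r hr)) hν
    (by linarith) htm (by linarith) hK₁ hK₂
    (by rw [Measure.restrict_apply hK₁.measurableSet.compl, compl_inter_self, measure_empty]) hνK
    (by
      rw [Measure.restrict_apply_univ, hK₁def, inter_comm, measure_inter_conull hμK]
      exact hy _ (half_pos hρ)) hν0 (half_pos hρ) (fun x hx => hsep x (hK₂Z hx).1)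
  exact hx0 (hK₂Z hx).2

lemma lipschitzOnWith_inv_smul_removeNth (i : Fin (m + 1)) {δ : ℝ} (hδ : 0 < δ) :
    LipschitzOnWith (Real.toNNReal (2 / δ ^ 2))
      (fun e : EuclideanSpace ℝ (Fin (m + 1)) => (e i)⁻¹ • i.removeNth (e : Fin (m + 1) → ℝ))
      {e | ‖e‖ ≤ 1 ∧ δ ≤ |e i|} := by
  refine LipschitzOnWith.of_dist_le_mul fun e he f hf => ?_
  rw [Real.coe_toNNReal _ (by positivity), dist_pi_le_iff (by positivity)]
  intro k
  have he0 : e i ≠ 0 := abs_pos.1 (hδ.trans_le he.2)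
  have hf0 : f i ≠ 0 := abs_pos.1 (hδ.trans_le hf.2)
  have hcoord : ∀ g : EuclideanSpace ℝ (Fin (m + 1)), ∀ j, |g j| ≤ ‖g‖ :=
    fun g j => PiLp.norm_apply_le g j
  set j := i.succAbove k
  have h1 := hcoord (e - f) j
  have h2 := hcoord (e - f) i
  have h3 := (hcoord f j).trans hf.1
  have h4 := (hcoord f i).trans hf.1
  simp only [PiLp.sub_apply] at h1 h2
  have key : (e i)⁻¹ * e j - (f i)⁻¹ * f j =
      ((e j - f j) * f i - f j * (e i - f i)) / (e i * f i) := by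
    field_simp
    ring
  rw [Real.dist_eq, dist_eq_norm]
  change |(e i)⁻¹ * e j - (f i)⁻¹ * f j| ≤ _
  rw [key, abs_div, abs_mul (e i), div_mul_eq_mul_div]
  have hnum : |(e j - f j) * f i - f j * (e i - f i)| ≤ 2 * ‖e - f‖ :=
    calc _ ≤ |(e j - f j) * f i| + |f j * (e i - f i)| := abs_sub _ _
      _ = |e j - f j| * |f i| + |f j| * |e i - f i| := by rw [abs_mul, abs_mul]
      _ ≤ ‖e - f‖ * 1 + 1 * ‖e - f‖ := by gcongr
      _ = _ := by ring
  have hden : δ ^ 2 ≤ |e i| * |f i| := by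
    rw [sq]
    exact mul_le_mul he.2 hf.2 hδ.le (abs_nonneg _)
  gcongr

lemma hausdorffMeasure_radialProj_pos {B : Set (EuclideanSpace ℝ (Fin (m + 1)))}
    {K : Set (Fin (m + 1) → ℝ)} (hK : IsCompact K) (hKB : ∀ y ∈ K, WithLp.toLp 2 y ∈ B)
    {x : EuclideanSpace ℝ (Fin (m + 1))} {i : Fin (m + 1)} {c : ℝ} (hc : 0 < c)
    (hsep : ∀ y ∈ K, c ≤ |(y - x) i|)
    (hvol : volume {v | ∃ y ∈ K, slopeProj i v (y - x) = 0} ≠ 0) :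
    0 < μH[m] (radialProj x B) := by
  obtain ⟨M, hM0, hM⟩ := ((hK.image (PiLp.continuous_toLp 2 _)).image
    (continuous_sub_right x)).isBounded.exists_pos_norm_le
  set h := fun e : EuclideanSpace ℝ (Fin (m + 1)) =>
    (e i)⁻¹ • i.removeNth (e : Fin (m + 1) → ℝ) with hh
  set S := {e : EuclideanSpace ℝ (Fin (m + 1)) | ‖e‖ ≤ 1 ∧ c / M ≤ |e i|}
  have hsub : {v | ∃ y ∈ K, slopeProj i v (y - x) = 0} ⊆ h '' (radialProj x B ∩ S) := by
    rintro v ⟨y, hy, hv⟩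
    have hz := hsep y hy
    have hz0 : (y - x) i ≠ 0 := abs_pos.1 (hc.trans_le hz)
    set w : EuclideanSpace ℝ (Fin (m + 1)) := WithLp.toLp 2 y - x with hw
    have hwi : ∀ k, w k = (y - x) k := fun k => rfl
    have hw0 : w ≠ 0 := fun h0 => hz0 (by rw [← hwi, h0]; rfl)
    have hwpos : 0 < ‖w‖ := norm_pos_iff.2 hw0
    have hwM : ‖w‖ ≤ M := hM _ ⟨_, ⟨y, hy, rfl⟩, rfl⟩
    refine ⟨‖w‖⁻¹ • w, ⟨⟨_, ⟨hKB y hy, fun h0 => hw0 (sub_eq_zero.2 h0)⟩, rfl⟩, ?_, ?_⟩, ?_⟩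
    · rw [norm_smul, norm_inv, norm_norm, inv_mul_cancel₀ hwpos.ne']
    · rw [PiLp.smul_apply, smul_eq_mul, abs_mul, abs_inv, abs_norm, inv_mul_eq_div, hwi]
      gcongr
    · ext k
      have hvk : (y - x) (i.succAbove k) - (y - x) i * v k = 0 := congrFun hv k
      change (‖w‖⁻¹ * w i)⁻¹ * (‖w‖⁻¹ * w (i.succAbove k)) = v k
      rw [hwi, hwi, sub_eq_zero.1 hvk]
      field_simp
  have hlip : LipschitzOnWith (Real.toNNReal (2 / (c / M) ^ 2)) h S :=
    lipschitzOnWith_inv_smul_removeNth i (by positivity)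
  have hle : volume {v | ∃ y ∈ K, slopeProj i v (y - x) = 0} ≤
      (Real.toNNReal (2 / (c / M) ^ 2) : ℝ≥0∞) ^ (m : ℝ) * μH[m] (radialProj x B) := by
    have hH : (μH[m] : Measure (Fin m → ℝ)) = volume := by
      simpa using hausdorffMeasure_pi_real (ι := Fin m)
    rw [← hH]
    calc _ ≤ μH[m] (h '' (radialProj x B ∩ S)) := measure_mono hsub
      _ ≤ _ * μH[m] (radialProj x B ∩ S) :=
        (hlip.mono inter_subset_right).hausdorffMeasure_image_le m.cast_nonneg
      _ ≤ _ := by gcongr; exact inter_subset_left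
  refine pos_iff_ne_zero.2 fun h0 => hvol (le_antisymm ?_ zero_le)
  simpa [h0] using hle

end Assembly

/-- **A sharp exceptional set estimate for visibility** (Theorem 1.1, upper bound).
If `B ⊆ ℝⁿ` is Borel with `dim B > n - 1`, then there is an exceptional set `E` with
`dim E ≤ 2(n-1) - dim B` such that `B` is visible from every point outside `E`. -/
theorem visibility_exceptional_set (n : ℕ) (hn : 2 ≤ n)
    (B : Set (EuclideanSpace ℝ (Fin n))) (hB : MeasurableSet B)
    (hdimB : (n : ℝ≥0∞) - 1 < dimH B) :
    ∃ E : Set (EuclideanSpace ℝ (Fin n)),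
      dimH E ≤ 2 * ((n : ℝ≥0∞) - 1) - dimH B ∧
      ∀ x ∉ E, 0 < μH[(n : ℝ) - 1] (radialProj x B) := by
  obtain ⟨m, rfl⟩ : ∃ m, n = m + 1 := ⟨n - 1, by lia⟩
  have hm1 : ((m + 1 : ℕ) : ℝ≥0∞) - 1 = m := by
    push_cast
    exact ENNReal.add_sub_cancel_right ENNReal.one_ne_top
  have hm2 : ((m + 1 : ℕ) : ℝ) - 1 = m := by
    push_cast
    ring
  rw [hm1] at hdimB ⊢
  rw [hm2]
  refine ⟨{x | ¬ 0 < μH[m] (radialProj x B)}, ?_, fun x hx => not_not.1 hx⟩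
  refine le_of_not_gt fun hcon => ?_
  set e := EuclideanSpace.equiv (Fin (m + 1)) ℝ
  obtain ⟨i, K, hKB, hK, _, ⟨x, hx, rfl⟩, ⟨c, hc, hsep⟩, hvol⟩ :=
    exists_mem_volume_slopes_ne_zero (by lia) (A := e '' B)
      (F := e '' {x | ¬ 0 < μH[m] (radialProj x B)})
      (e.toHomeomorph.measurableEmbedding.measurableSet_image.2 hB)
      (by rwa [e.dimH_image])
      (by
        rw [e.dimH_image, e.dimH_image]
        refine lt_of_not_ge fun hle => hcon.not_ge (ENNReal.le_sub_of_add_le_left ?_ hle)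
        exact ne_top_of_le_ne_top (by finiteness) (le_self_add.trans hle))
  refine hx (hausdorffMeasure_radialProj_pos hK (fun y hy => ?_) hc hsep hvol)
  obtain ⟨b, hb, rfl⟩ := hKB hy
  exact hb
end

section
/- For every n ≥ 2 and every s with n − 1 < s < n, there exists a compact set B ⊆ ℝⁿ with dim B = s such that the exceptional set {x ∈ ℝⁿ : H^{n−1}(π_x(B \ {x})) = 0} has Hausdorff dimension at least 2(n − 1) − s. (In particular, the exponent 2(n − 1) − dim B in the visibility theorem is sharp.) -/
open MeasureTheory Metric Set
open scoped ENNReal NNReal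

/-- The length of the `k`-th block of binary digits. -/
def blockLen (k : ℕ) : ℕ := k * k.factorial

/-- The reals that, for every `k`, lie within `2 ^ -(M + k)` of the lattice `2 ^ -⌊a M⌋ ℤ`,
where `M = blockLen k`. -/
def latticeSet (a : ℝ) : Set ℝ :=
  {x | ∀ k, ∃ z : ℤ, |x - z / 2 ^ ⌊a * blockLen k⌋₊| ≤ (2 ^ (blockLen k + k))⁻¹}

/-- The positions of binary digits which are forced to vanish for points of `latticeSet a`. -/
def vanishingDigit (a : ℝ) (p : ℕ) : Prop :=
  ∃ k, ⌊a * blockLen k⌋₊ ≤ p ∧ p < blockLen k + k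

open Classical in
/-- Insert zeros in the binary expansion of an integer, at the positions in `F` below `j`. -/
noncomputable def spreadDigits (F : ℕ → Prop) : ℕ → ℕ → ℕ
  | 0, X => X
  | j + 1, X => if F j then 2 * spreadDigits F j X else 2 * spreadDigits F j (X / 2) + X % 2

lemma spreadDigits_strictMono (F : ℕ → Prop) (j : ℕ) : StrictMono (spreadDigits F j) := by
  induction j with
  | zero => exact strictMono_id
  | succ j ih =>
    intro X Y h
    simp only [spreadDigits]
    split_ifs
    · have := ih h
      omega
    · rcases lt_or_ge (X / 2) (Y / 2) with h' | h'
      · have := ih h'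
        omega
      · have : X / 2 = Y / 2 := by omega
        rw [this]
        omega

open Classical in
/-- The first `j` binary digits of the image of `x` when zeros are inserted in its binary
expansion at the positions in `F`. -/
noncomputable def spreadApprox (F : ℕ → Prop) (j : ℕ) (x : ℝ) : ℕ :=
  spreadDigits F j ⌊2 ^ Nat.count (fun p => ¬ F p) j * x⌋₊

lemma spreadApprox_succ_of_mem {F : ℕ → Prop} {j : ℕ} (h : F j) (x : ℝ) :
    spreadApprox F (j + 1) x = 2 * spreadApprox F j x := by
  simp [spreadApprox, spreadDigits, h, Nat.count_succ]

lemma spreadApprox_succ_of_notMem {F : ℕ → Prop} {j : ℕ} (h : ¬ F j) (x : ℝ) :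
    ∃ e < 2, spreadApprox F (j + 1) x = 2 * spreadApprox F j x + e := by
  classical
  refine ⟨_, Nat.mod_lt ⌊2 ^ Nat.count (fun p => ¬ F p) (j + 1) * x⌋₊ two_pos, ?_⟩
  have : ⌊2 ^ Nat.count (fun p => ¬ F p) (j + 1) * x⌋₊ / 2
      = ⌊2 ^ Nat.count (fun p => ¬ F p) j * x⌋₊ := by
    rw [← Nat.floor_div_ofNat]
    congr 1
    simp [Nat.count_succ, h, pow_succ]
    ring
  simp only [spreadApprox, spreadDigits, h, if_false]
  rw [this]

lemma spreadApprox_succ_le (F : ℕ → Prop) (j : ℕ) (x : ℝ) :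
    2 * spreadApprox F j x ≤ spreadApprox F (j + 1) x ∧
      spreadApprox F (j + 1) x + 1 ≤ 2 * (spreadApprox F j x + 1) := by
  by_cases h : F j
  · rw [spreadApprox_succ_of_mem h]
    omega
  · obtain ⟨e, he, h'⟩ := spreadApprox_succ_of_notMem h x
    omega

lemma monotone_spreadApprox_div (F : ℕ → Prop) (x : ℝ) :
    Monotone fun j => (spreadApprox F j x : ℝ) / 2 ^ j := by
  refine monotone_nat_of_le_succ fun j => ?_
  have h : (2 * spreadApprox F j x : ℝ) ≤ spreadApprox F (j + 1) x := by
    exact_mod_cast (spreadApprox_succ_le F j x).1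
  rw [div_le_div_iff₀ (by positivity) (by positivity), pow_succ]
  nlinarith [pow_pos (two_pos : (0 : ℝ) < 2) j]

lemma antitone_spreadApprox_add_one_div (F : ℕ → Prop) (x : ℝ) :
    Antitone fun j => ((spreadApprox F j x : ℝ) + 1) / 2 ^ j := by
  refine antitone_nat_of_succ_le fun j => ?_
  have h : (spreadApprox F (j + 1) x + 1 : ℝ) ≤ 2 * (spreadApprox F j x + 1) := by
    exact_mod_cast (spreadApprox_succ_le F j x).2
  rw [div_le_div_iff₀ (by positivity) (by positivity), pow_succ]
  nlinarith [pow_pos (two_pos : (0 : ℝ) < 2) j]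

/-- Insert zeros in the binary expansion of `x` at the positions in `F`. -/
noncomputable def spread (F : ℕ → Prop) (x : ℝ) : ℝ :=
  ⨆ j, (spreadApprox F j x : ℝ) / 2 ^ j

lemma spreadApprox_div_le (F : ℕ → Prop) (x : ℝ) (i j : ℕ) :
    (spreadApprox F i x : ℝ) / 2 ^ i ≤ (spreadApprox F j x + 1) / 2 ^ j := by
  calc (spreadApprox F i x : ℝ) / 2 ^ i
      ≤ spreadApprox F (max i j) x / 2 ^ (max i j) :=
        monotone_spreadApprox_div F x (le_max_left i j)
    _ ≤ (spreadApprox F (max i j) x + 1) / 2 ^ (max i j) := by gcongr; linarith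
    _ ≤ _ := antitone_spreadApprox_add_one_div F x (le_max_right i j)

lemma spread_le (F : ℕ → Prop) (x : ℝ) (j : ℕ) :
    spread F x ≤ (spreadApprox F j x + 1) / 2 ^ j :=
  ciSup_le fun i => spreadApprox_div_le F x i j

lemma le_spread (F : ℕ → Prop) (x : ℝ) (j : ℕ) :
    (spreadApprox F j x : ℝ) / 2 ^ j ≤ spread F x :=
  le_ciSup (f := fun j => (spreadApprox F j x : ℝ) / 2 ^ j)
    ⟨_, forall_mem_range.2 fun i => spreadApprox_div_le F x i 0⟩ j

lemma measurable_spread (F : ℕ → Prop) : Measurable (spread F) := by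
  refine Measurable.iSup fun j => Measurable.div_const ?_ _
  exact (measurable_from_top (f := fun X : ℕ => ((spreadDigits F j X : ℕ) : ℝ))).comp
    (Nat.measurable_floor.comp (measurable_const_mul _))

lemma spread_mem_Icc (F : ℕ → Prop) {x : ℝ} (hx : x ∈ Ico (0 : ℝ) 1) :
    spread F x ∈ Icc (0 : ℝ) 1 := by
  have h0 : spreadApprox F 0 x = 0 := by
    simpa [spreadApprox, spreadDigits] using hx.2
  have h1 := le_spread F x 0
  have h2 := spread_le F x 0
  simp only [h0] at h1 h2
  constructor <;> norm_num at h1 h2 <;> assumption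

open Classical in
lemma abs_sub_le_spread (F : ℕ → Prop) {x y : ℝ} (hx : 0 ≤ x) (hy : 0 ≤ y) (j : ℕ) :
    2 ^ Nat.count (fun p => ¬ F p) j * |x - y| ≤ 2 + 2 ^ j * |spread F x - spread F y| := by
  wlog hxy : y ≤ x generalizing x y
  · rw [abs_sub_comm, abs_sub_comm (spread F x)]
    exact this hy hx (le_of_not_ge hxy)
  set r := Nat.count (fun p => ¬ F p) j
  have hf : ⌊2 ^ r * y⌋₊ ≤ ⌊2 ^ r * x⌋₊ := Nat.floor_le_floor (by gcongr)
  have hs : ∀ d X : ℕ, spreadDigits F j X + d ≤ spreadDigits F j (X + d) := by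
    intro d X
    induction d with
    | zero => simp
    | succ d ih =>
      have := spreadDigits_strictMono F j (Nat.lt_succ_self (X + d))
      rw [← add_assoc, ← add_assoc]
      simp only [Nat.succ_eq_add_one] at this
      omega
  have hd := hs (⌊2 ^ r * x⌋₊ - ⌊2 ^ r * y⌋₊) ⌊2 ^ r * y⌋₊
  rw [Nat.add_sub_cancel' hf] at hd
  have hd' : spreadApprox F j y + ⌊2 ^ r * x⌋₊ ≤ spreadApprox F j x + ⌊2 ^ r * y⌋₊ := by
    change spreadDigits F j ⌊2 ^ r * y⌋₊ + _ ≤ spreadDigits F j ⌊2 ^ r * x⌋₊ + _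
    omega
  have hd'' : (spreadApprox F j y + ⌊2 ^ r * x⌋₊ : ℝ) ≤ spreadApprox F j x + ⌊2 ^ r * y⌋₊ := by
    exact_mod_cast hd'
  have h1 := Nat.lt_floor_add_one (2 ^ r * x)
  have h2 := Nat.floor_le (a := 2 ^ r * y) (by positivity)
  have h3 := le_spread F x j
  have h4 := spread_le F y j
  rw [div_le_iff₀ (by positivity)] at h3
  rw [le_div_iff₀ (by positivity)] at h4
  have h5 := le_abs_self (spread F x - spread F y)
  have h6 : (2 : ℝ) ^ j * (spread F x - spread F y) ≤ 2 ^ j * |spread F x - spread F y| := by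
    gcongr
  rw [abs_of_nonneg (sub_nonneg.2 hxy)]
  linarith

lemma spreadApprox_add {F : ℕ → Prop} {i d : ℕ} (h : ∀ p, i ≤ p → p < i + d → F p) (x : ℝ) :
    spreadApprox F (i + d) x = 2 ^ d * spreadApprox F i x := by
  induction d with
  | zero => simp
  | succ d ih =>
    rw [← add_assoc, spreadApprox_succ_of_mem (h _ (by omega) (by omega)),
      ih fun p hp hp' => h p hp (by omega), pow_succ]
    ring

lemma floor_mul_le {a : ℝ} (ha : a ≤ 1) (M : ℕ) : ⌊a * M⌋₊ ≤ M :=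
  (Nat.floor_le_floor (by nlinarith [Nat.cast_nonneg (α := ℝ) M])).trans_eq (Nat.floor_natCast M)

lemma spread_mem_latticeSet {a : ℝ} (ha : a ≤ 1) (x : ℝ) :
    spread (vanishingDigit a) x ∈ latticeSet a := by
  intro k
  have hM := floor_mul_le ha (blockLen k)
  set α := ⌊a * blockLen k⌋₊ with hα
  obtain ⟨d, hd⟩ : ∃ d, blockLen k + k = α + d := ⟨blockLen k + k - α, by omega⟩
  have h := spreadApprox_add (F := vanishingDigit a) (i := α) (d := d)
    (fun p hp hp' => ⟨k, hp, by omega⟩) x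
  refine ⟨spreadApprox (vanishingDigit a) α x, ?_⟩
  have h1 := le_spread (vanishingDigit a) x α
  have h2 := spread_le (vanishingDigit a) x (α + d)
  rw [h, pow_add] at h2
  rw [hd, pow_add, Int.cast_natCast, abs_of_nonneg (sub_nonneg.2 h1)]
  have : ((2 ^ d * spreadApprox (vanishingDigit a) α x : ℕ) + 1 : ℝ) / (2 ^ α * 2 ^ d)
      = spreadApprox (vanishingDigit a) α x / 2 ^ α + (2 ^ α * 2 ^ d)⁻¹ := by
    push_cast
    field_simp
  linarith

lemma blockLen_add_le {K k : ℕ} {ε : ℝ} (hε : 0 < ε) (hK : 4 / ε ≤ K) :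
    (blockLen k + k + (k + 1) + 2 : ℝ) ≤ ε * blockLen (k + 1) + 4 * K.factorial := by
  have h1 : (blockLen k + k + (k + 1) + 2 : ℝ) ≤ 4 * (k + 1).factorial := by
    have : blockLen k + k + (k + 1) + 2 ≤ 4 * (k + 1).factorial := by
      rw [blockLen, Nat.factorial_succ]
      nlinarith [Nat.factorial_pos k]
    exact_mod_cast this
  rcases le_total (k + 1) K with h | h
  · have h2 : ((k + 1).factorial : ℝ) ≤ K.factorial := by exact_mod_cast Nat.factorial_le h
    have : 0 ≤ ε * blockLen (k + 1) := by positivity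
    linarith
  · have h2 : (K : ℝ) ≤ (k + 1 : ℕ) := by exact_mod_cast h
    have h3 : 4 ≤ ε * (k + 1 : ℕ) := by
      rw [div_le_iff₀ hε] at hK
      nlinarith
    have h4 : (4 * (k + 1).factorial : ℝ) ≤ ε * blockLen (k + 1) := by
      rw [blockLen]
      push_cast at h3 ⊢
      rw [← mul_assoc]
      gcongr
    have : (0 : ℝ) ≤ 4 * K.factorial := by positivity
    linarith

lemma le_blockLen (k : ℕ) : k ≤ blockLen k :=
  Nat.le_mul_of_pos_right _ (Nat.factorial_pos k)

lemma monotone_blockLen : Monotone blockLen := fun _ _ h =>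
  Nat.mul_le_mul h (Nat.factorial_le h)

open Classical in
lemma exists_count_vanishingDigit_le {a ε : ℝ} (ha₀ : 0 < a) (ha₁ : a ≤ 1) (hε : 0 < ε) :
    ∃ C : ℝ, ∀ j, (Nat.count (vanishingDigit a) j : ℝ) ≤ (1 - a + ε) * j + C := by
  obtain ⟨K, hK⟩ := exists_nat_ge (4 / (ε * a))
  refine ⟨4 * K.factorial, fun j => ?_⟩
  have hC : (0 : ℝ) ≤ 4 * K.factorial := by positivity
  rcases Nat.eq_zero_or_pos j with rfl | hj
  · simp
  obtain ⟨B, hB⟩ := exists_nat_ge (((j : ℝ) + 1) / a)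
  have hbound : ∀ k, ⌊a * blockLen k⌋₊ < j → k ≤ B := by
    intro k hk
    have h1 : a * blockLen k < j := by
      have := Nat.lt_floor_add_one (a * blockLen k)
      have h2 : (⌊a * blockLen k⌋₊ : ℝ) + 1 ≤ j := by exact_mod_cast hk
      linarith
    have h2 : (k : ℝ) ≤ blockLen k := by exact_mod_cast le_blockLen k
    rw [div_le_iff₀ ha₀] at hB
    have h3 : (k : ℝ) < B := by
      by_contra! h
      nlinarith
    exact_mod_cast h3.le
  set k := Nat.findGreatest (fun k => ⌊a * blockLen k⌋₊ < j) B with hk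
  have hkj : ⌊a * blockLen k⌋₊ < j :=
    Nat.findGreatest_spec (P := fun k => ⌊a * blockLen k⌋₊ < j) (Nat.zero_le B)
      (by simpa [blockLen] using hj)
  have hmax : ∀ i, ⌊a * blockLen i⌋₊ < j → i ≤ k := fun i hi =>
    Nat.le_findGreatest (hbound i hi) hi
  clear_value k
  rw [Nat.count_eq_card_filter_range]
  cases k with
  | zero =>
    have : Finset.filter (vanishingDigit a) (Finset.range j) = ∅ := by
      refine Finset.filter_eq_empty_iff.2 fun p hp => ?_
      rintro ⟨i, hi, hi'⟩
      have := hmax i (hi.trans_lt (Finset.mem_range.1 hp))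
      obtain rfl : i = 0 := by omega
      simp [blockLen] at hi'
    rw [this]
    simp only [Finset.card_empty, Nat.cast_zero]
    have : 0 ≤ (1 - a + ε) * j := mul_nonneg (by linarith) (Nat.cast_nonneg _)
    linarith
  | succ k =>
    set α := ⌊a * blockLen (k + 1)⌋₊ with hα
    have hsub : Finset.filter (vanishingDigit a) (Finset.range j) ⊆
        Finset.range (blockLen k + k) ∪ Finset.Ico α (min j (blockLen (k + 1) + (k + 1))) := by
      intro p hp
      obtain ⟨hpj, i, hi, hi'⟩ := Finset.mem_filter.1 hp
      rw [Finset.mem_range] at hpj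
      rw [Finset.mem_union, Finset.mem_range, Finset.mem_Ico]
      rcases (hmax i (hi.trans_lt hpj)).lt_or_eq with h | rfl
      · have := monotone_blockLen (Nat.le_of_lt_succ h)
        omega
      · exact Or.inr ⟨hi, lt_min hpj hi'⟩
    have hcard := (Finset.card_le_card hsub).trans (Finset.card_union_le _ _)
    rw [Finset.card_range, Nat.card_Ico] at hcard
    have hαM : α ≤ blockLen (k + 1) := floor_mul_le ha₁ _
    have hcard' : (Finset.card (Finset.filter (vanishingDigit a) (Finset.range j)) : ℝ) ≤
        blockLen k + k + ((min j (blockLen (k + 1) + (k + 1)) : ℕ) - α) := by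
      rw [← Nat.cast_sub (le_min hkj.le (by omega))]
      exact_mod_cast hcard
    have hfl := Nat.lt_floor_add_one (a * blockLen (k + 1))
    rw [← hα] at hfl
    have hαj : (α : ℝ) + 1 ≤ j := by exact_mod_cast hkj
    have hm1 : ((min j (blockLen (k + 1) + (k + 1)) : ℕ) : ℝ) ≤ j := by
      exact_mod_cast min_le_left _ _
    have hm2 : ((min j (blockLen (k + 1) + (k + 1)) : ℕ) : ℝ) ≤ blockLen (k + 1) + (k + 1) := by
      exact_mod_cast min_le_right _ _
    have hlen := blockLen_add_le (k := k) (mul_pos hε ha₀) hK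
    set m : ℝ := ((min j (blockLen (k + 1) + (k + 1)) : ℕ) : ℝ)
    have e1 : (1 - a) * m ≤ (1 - a) * j := by gcongr
    have e2 : a * m ≤ a * (blockLen (k + 1) + (k + 1)) := by gcongr
    have e3 : ε * a * blockLen (k + 1) ≤ ε * j := by
      rw [mul_assoc]
      gcongr
      linarith
    have e4 : a * (k + 1) ≤ 1 * ((k : ℝ) + 1) := by gcongr
    linarith

open Classical in
lemma exists_le_count_not_vanishingDigit {a d : ℝ} (ha₀ : 0 < a) (ha₁ : a ≤ 1) (hd : d < a) :
    ∃ C : ℝ, ∀ j, d * j ≤ (Nat.count (fun p => ¬ vanishingDigit a p) j : ℝ) + C := by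
  obtain ⟨C, hC⟩ := exists_count_vanishingDigit_le ha₀ ha₁ (sub_pos.2 hd)
  refine ⟨C, fun j => ?_⟩
  have h := Finset.card_filter_add_card_filter_not (s := Finset.range j) (vanishingDigit a)
  rw [← Nat.count_eq_card_filter_range, ← Nat.count_eq_card_filter_range, Finset.card_range] at h
  have h' : (Nat.count (vanishingDigit a) j : ℝ) +
      Nat.count (fun p => ¬ vanishingDigit a p) j = j := by exact_mod_cast h
  have := hC j
  linarith

/-- `K` contains the image of `[0, 1)` under a measurable map whose inverse is `d`-Hölder. -/
def ContainsInvHolderImage (d : ℝ) (K : Set ℝ) : Prop :=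
  ∃ g : ℝ → ℝ, Measurable g ∧ (∀ x ∈ Ico (0 : ℝ) 1, g x ∈ K) ∧
    ∃ C : ℝ, ∀ x ∈ Ico (0 : ℝ) 1, ∀ y ∈ Ico (0 : ℝ) 1, |x - y| ≤ C * |g x - g y| ^ d

lemma exists_abs_sub_le_spread_rpow {a d : ℝ} (ha₀ : 0 < a) (ha₁ : a ≤ 1) (hd₀ : 0 < d)
    (hd : d < a) : ∃ C : ℝ, ∀ x ∈ Ico (0 : ℝ) 1, ∀ y ∈ Ico (0 : ℝ) 1,
      |x - y| ≤ C * |spread (vanishingDigit a) x - spread (vanishingDigit a) y| ^ d := by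
  classical
  obtain ⟨C, hC⟩ := exists_le_count_not_vanishingDigit ha₀ ha₁ hd
  refine ⟨3 * 2 ^ C * 2 ^ d, fun x hx y hy => ?_⟩
  set Δ := |spread (vanishingDigit a) x - spread (vanishingDigit a) y|
  have key : ∀ j : ℕ, 2 ^ j * Δ ≤ 1 → |x - y| ≤ 3 * 2 ^ C * ((2 : ℝ) ^ j)⁻¹ ^ d := by
    intro j hj
    have h := abs_sub_le_spread (vanishingDigit a) hx.1 hy.1 j
    have h1 : (2 : ℝ) ^ (d * j) ≤
        2 ^ Nat.count (fun p => ¬ vanishingDigit a p) j * 2 ^ C := by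
      rw [← Real.rpow_natCast, ← Real.rpow_add two_pos]
      exact Real.rpow_le_rpow_of_exponent_le one_le_two (hC j)
    rw [Real.inv_rpow (by positivity), ← Real.rpow_natCast, ← Real.rpow_mul two_pos.le,
      mul_comm (j : ℝ), ← div_eq_mul_inv, le_div_iff₀ (by positivity)]
    calc |x - y| * 2 ^ (d * j)
        ≤ |x - y| * (2 ^ Nat.count (fun p => ¬ vanishingDigit a p) j * 2 ^ C) := by gcongr
      _ = (2 ^ Nat.count (fun p => ¬ vanishingDigit a p) j * |x - y|) * 2 ^ C := by ring
      _ ≤ 3 * 2 ^ C := by gcongr; linarith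
  have hΔ0 : 0 ≤ Δ := abs_nonneg _
  have hΔ1 : Δ ≤ 1 := by
    have h1 := spread_mem_Icc (vanishingDigit a) hx
    have h2 := spread_mem_Icc (vanishingDigit a) hy
    exact abs_sub_le_iff.2 ⟨by linarith [h1.2, h2.1], by linarith [h1.1, h2.2]⟩
  rcases hΔ0.eq_or_lt with h0 | h0
  · rw [← h0, Real.zero_rpow hd₀.ne', mul_zero]
    have h2 : Filter.Tendsto (fun j : ℕ => 3 * (2 : ℝ) ^ C * ((2 : ℝ) ^ j)⁻¹ ^ d) Filter.atTop
        (nhds (3 * (2 : ℝ) ^ C * 0 ^ d)) := by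
      refine Filter.Tendsto.const_mul _ (Filter.Tendsto.rpow_const ?_ (Or.inr hd₀.le))
      exact tendsto_inv_atTop_zero.comp (tendsto_pow_atTop_atTop_of_one_lt one_lt_two)
    rw [Real.zero_rpow hd₀.ne', mul_zero] at h2
    exact ge_of_tendsto' h2 fun j => key j (by rw [← h0]; simp)
  · obtain ⟨j, hj1, hj2⟩ := exists_nat_pow_near ((one_le_inv₀ h0).2 hΔ1) (one_lt_two (α := ℝ))
    have h3 := key j (by
      rw [← mul_inv_cancel₀ h0.ne', mul_comm]
      gcongr)
    refine h3.trans ?_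
    rw [mul_assoc (3 * 2 ^ C), ← Real.mul_rpow two_pos.le hΔ0]
    gcongr
    rw [pow_succ, inv_lt_comm₀ h0 (by positivity), mul_inv] at hj2
    linarith

lemma one_add_mem_latticeSet {a x : ℝ} (hx : x ∈ latticeSet a) :
    1 + x ∈ latticeSet a := by
  intro k
  obtain ⟨z, hz⟩ := hx k
  refine ⟨2 ^ ⌊a * blockLen k⌋₊ + z, ?_⟩
  push_cast
  rwa [add_div, div_self (by positivity), add_sub_add_left_eq_sub]

lemma containsInvHolderImage_latticeSet_inter_Icc_zero_one {a d : ℝ} (ha₀ : 0 < a) (ha₁ : a ≤ 1)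
    (hd₀ : 0 < d) (hd : d < a) : ContainsInvHolderImage d (latticeSet a ∩ Icc 0 1) :=
  ⟨spread (vanishingDigit a), measurable_spread _,
    fun x hx => ⟨spread_mem_latticeSet ha₁ x, spread_mem_Icc _ hx⟩,
    exists_abs_sub_le_spread_rpow ha₀ ha₁ hd₀ hd⟩

lemma containsInvHolderImage_latticeSet_inter_Icc_one_two {a d : ℝ} (ha₀ : 0 < a) (ha₁ : a ≤ 1)
    (hd₀ : 0 < d) (hd : d < a) : ContainsInvHolderImage d (latticeSet a ∩ Icc 1 2) := by
  obtain ⟨g, hg, hgK, C, hC⟩ :=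
    containsInvHolderImage_latticeSet_inter_Icc_zero_one ha₀ ha₁ hd₀ hd
  refine ⟨fun x => 1 + g x, hg.const_add 1, fun x hx => ?_, C, fun x hx y hy => ?_⟩
  · obtain ⟨h1, h2, h3⟩ := hgK x hx
    exact ⟨one_add_mem_latticeSet h1, by constructor <;> linarith⟩
  · rw [add_sub_add_left_eq_sub]
    exact hC x hx y hy

lemma containsInvHolderImage_Icc : ContainsInvHolderImage 1 (Icc 0 1) :=
  ⟨id, measurable_id, fun _ hx => ⟨hx.1, hx.2.le⟩, 1, by simp⟩

lemma containsInvHolderImage_singleton (c : ℝ) : ContainsInvHolderImage 0 {c} :=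
  ⟨fun _ => c, measurable_const, fun _ _ => rfl, 1, fun x hx y hy => by
    rw [Real.rpow_zero, one_mul]
    exact abs_sub_le_iff.2 ⟨by linarith [hx.2, hy.1], by linarith [hx.1, hy.2]⟩⟩

/-- The product of the sets `K i`, as a subset of Euclidean space. -/
def euclideanBox {ι : Type*} (K : ι → Set ℝ) : Set (EuclideanSpace ℝ ι) :=
  {x | ∀ i, x i ∈ K i}

lemma prod_rpow_eq_rpow_sum {ι : Type*} (s : Finset ι) (x : ℝ≥0∞) {d : ι → ℝ}
    (hd : ∀ i, 0 ≤ d i) : ∏ i ∈ s, x ^ d i = x ^ ∑ i ∈ s, d i := by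
  classical
  induction s using Finset.induction_on with
  | empty => simp
  | insert i s hi ih =>
    rw [Finset.prod_insert hi, Finset.sum_insert hi, ih,
      ENNReal.rpow_add_of_nonneg _ _ (hd i) (Finset.sum_nonneg fun j _ => hd j)]

lemma le_dimH_euclideanBox {ι : Type*} [Fintype ι] {d : ι → ℝ} (hd : ∀ i, 0 ≤ d i)
    {K : ι → Set ℝ} (hK : ∀ i, ContainsInvHolderImage (d i) (K i)) :
    ENNReal.ofReal (∑ i, d i) ≤ dimH (euclideanBox K) := by
  choose g hg hgK C hC using hK
  set Φ : (ι → ℝ) → EuclideanSpace ℝ ι := fun x => WithLp.toLp 2 fun i => g i (x i) with hΦ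
  have hΦm : Measurable Φ := (WithLp.measurable_toLp 2 (ι → ℝ)).comp
    (measurable_pi_lambda _ fun i => (hg i).comp (measurable_pi_apply i))
  set Q : Set (ι → ℝ) := pi univ fun _ => Ico 0 1 with hQ
  have hQv : volume Q = 1 := by simp [hQ, Real.volume_pi_Ico]
  set μ : Measure (EuclideanSpace ℝ ι) := Measure.map Φ (volume.restrict Q) with hμ
  set A : ℝ≥0∞ := ∏ i, ENNReal.ofReal (C i) with hA
  have hA_top : A ≠ ∞ := (ENNReal.prod_lt_top fun i _ => ENNReal.ofReal_lt_top).ne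
  have hμs : ∀ s, μ s ≤ A * ediam s ^ ∑ i, d i := by
    intro s
    rw [← ediam_closure s]
    refine (measure_mono subset_closure).trans ?_
    have hmeas : MeasurableSet (closure s) := isClosed_closure.measurableSet
    rw [hμ, Measure.map_apply hΦm hmeas, Measure.restrict_apply (hΦm hmeas)]
    refine (Real.volume_pi_le_prod_diam _).trans ?_
    rw [← prod_rpow_eq_rpow_sum _ _ hd, hA, ← Finset.prod_mul_distrib]
    refine Finset.prod_le_prod' fun i _ => ediam_le ?_
    rintro _ ⟨x, ⟨hxs, hxQ⟩, rfl⟩ _ ⟨y, ⟨hys, hyQ⟩, rfl⟩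
    have h1 := hC i (x i) (hxQ i trivial) (y i) (hyQ i trivial)
    have h2 : edist (g i (x i)) (g i (y i)) ≤ ediam (closure s) :=
      (PiLp.edist_apply_le (Φ x) (Φ y) i).trans (edist_le_ediam_of_mem hxs hys)
    calc edist (x i) (y i) = ENNReal.ofReal |x i - y i| := by rw [edist_dist, Real.dist_eq]
      _ ≤ ENNReal.ofReal (C i * |g i (x i) - g i (y i)| ^ d i) := ENNReal.ofReal_le_ofReal h1
      _ = ENNReal.ofReal (C i) * edist (g i (x i)) (g i (y i)) ^ d i := by
        rw [ENNReal.ofReal_mul' (by positivity), edist_dist, Real.dist_eq,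
          ENNReal.ofReal_rpow_of_nonneg (abs_nonneg _) (hd i)]
      _ ≤ _ := by gcongr; exact hd i
  have hle : (A + 1)⁻¹ • μ ≤ μH[∑ i, d i] := by
    refine Measure.le_hausdorffMeasure _ _ 1 one_pos fun s _ => ?_
    rw [Measure.smul_apply, smul_eq_mul]
    calc (A + 1)⁻¹ * μ s ≤ (A + 1)⁻¹ * ((A + 1) * ediam s ^ ∑ i, d i) := by
          gcongr
          exact (hμs s).trans (by gcongr; exact le_self_add)
      _ = ediam s ^ ∑ i, d i := by
        rw [← mul_assoc, ENNReal.inv_mul_cancel (by simp) (by simpa using hA_top), one_mul]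
  have hμbox : 1 ≤ μ (euclideanBox K) := by
    refine le_trans ?_ (Measure.le_map_apply hΦm.aemeasurable _)
    rw [← hQv, ← Measure.restrict_apply_self]
    exact measure_mono fun x hx i => hgK i _ (hx i trivial)
  refine le_dimH_of_hausdorffMeasure_ne_zero fun h0 => ?_
  rw [Real.coe_toNNReal _ (Finset.sum_nonneg fun i _ => hd i)] at h0
  have h := hle (euclideanBox K)
  rw [h0, Measure.smul_apply, smul_eq_mul, nonpos_iff_eq_zero, mul_eq_zero] at h
  rcases h with h | h
  · exact absurd h (by simpa using hA_top)
  · rw [h] at hμbox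
    exact absurd hμbox (by simp)

lemma dimH_euclideanBox_le {m : ℕ} {σ : ℝ} (hσ₀ : 0 ≤ σ)
    {K : Fin (m + 1) → Set ℝ} (h₀ : K 0 ⊆ latticeSet σ ∩ Icc 1 2)
    (h₁ : ∀ i : Fin m, K i.succ ⊆ Icc 0 1) :
    dimH (euclideanBox K) ≤ ENNReal.ofReal (m + σ) := by
  set α : ℕ → ℕ := fun k => ⌊σ * blockLen k⌋₊ with hα
  set N : ℕ → ℕ := fun k => blockLen k + k with hN
  set e : ℕ → Fin (m + 1) → ℕ := fun k => Fin.cons (α k) fun _ => N k with he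
  set c : ℕ → Fin (m + 1) → ℕ := fun k => Fin.cons (2 ^ (α k + 2)) fun _ => 2 ^ (N k + 1) with hc
  set t : ∀ k : ℕ, (∀ i, Fin (c k i)) → Set (EuclideanSpace ℝ (Fin (m + 1))) := fun k z =>
    {x | ∀ i, |x i - ((z i : ℕ) : ℝ) / 2 ^ e k i| ≤ (2 ^ N k)⁻¹} with ht
  set L : ℝ≥0 := (Fintype.card (Fin (m + 1)) : ℝ≥0) ^ (1 / (2 : ℝ≥0∞)).toReal with hL
  set b : ℝ := L * 2 with hb
  have hb0 : 0 ≤ b := by positivity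
  have hdiam : ∀ k z, ediam (t k z) ≤ ENNReal.ofReal (b * (2 ^ N k)⁻¹) := by
    intro k z
    refine ediam_le fun x hx y hy => ?_
    have h := PiLp.lipschitzWith_toLp 2 (fun _ : Fin (m + 1) => ℝ) (WithLp.ofLp x) (WithLp.ofLp y)
    refine h.trans ?_
    rw [hb, mul_assoc, ENNReal.ofReal_mul (by positivity), ENNReal.ofReal_coe_nnreal]
    gcongr
    refine edist_pi_le_iff.2 fun i => ?_
    rw [edist_dist, Real.dist_eq]
    refine ENNReal.ofReal_le_ofReal ?_
    have h1 := abs_le.1 (hx i)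
    have h2 := abs_le.1 (hy i)
    exact abs_le.2 ⟨by linarith, by linarith⟩
  have hcover : ∀ k, euclideanBox K ⊆ ⋃ z, t k z := by
    intro k x hx
    have hz : ∀ i, ∃ z : Fin (c k i), |x i - ((z : ℕ) : ℝ) / 2 ^ e k i| ≤ (2 ^ N k)⁻¹ := by
      intro i
      have hη : ((2 : ℝ) ^ N k)⁻¹ ≤ 1 := inv_le_one_of_one_le₀ (one_le_pow₀ one_le_two)
      refine Fin.cases ?_ (fun i => ?_) i
      · obtain ⟨hx1, hx2⟩ := h₀ (hx 0)
        obtain ⟨z, hz⟩ := hx1 k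
        have hz' := abs_le.1 hz
        have hp : (0 : ℝ) < 2 ^ α k := by positivity
        have hz0 : 0 ≤ z := by
          have : (0 : ℝ) ≤ z / 2 ^ α k := by linarith [hx2.1, hz'.2]
          rw [le_div_iff₀ hp, zero_mul] at this
          exact_mod_cast this
        obtain ⟨z, rfl⟩ := Int.eq_ofNat_of_zero_le hz0
        have hz1 : z < 2 ^ (α k + 2) := by
          have : (z : ℝ) / 2 ^ α k < 4 := by
            have := hz'.1
            rw [Int.cast_natCast] at this
            linarith [hx2.2]
          rw [div_lt_iff₀ hp] at this
          have h' : (z : ℝ) < 2 ^ (α k + 2) := by rw [pow_add]; linarith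
          exact_mod_cast h'
        exact ⟨⟨z, hz1⟩, by simpa [he, hα, hN] using hz⟩
      · have hxi := h₁ i (hx i.succ)
        have hp : (0 : ℝ) < 2 ^ N k := by positivity
        have hz1 : ⌊x i.succ * 2 ^ N k⌋₊ < 2 ^ (N k + 1) := by
          rw [Nat.floor_lt (mul_nonneg hxi.1 hp.le), pow_succ]
          push_cast
          nlinarith [hxi.2]
        refine ⟨⟨_, hz1⟩, ?_⟩
        have h1 := Nat.floor_le (mul_nonneg hxi.1 hp.le)
        have h2 := Nat.lt_floor_add_one (x i.succ * 2 ^ N k)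
        simp only [he, Fin.cons_succ]
        have : x i.succ - (⌊x i.succ * 2 ^ N k⌋₊ : ℝ) / 2 ^ N k
            = (x i.succ * 2 ^ N k - ⌊x i.succ * 2 ^ N k⌋₊) * (2 ^ N k)⁻¹ := by
          field_simp
        rw [this, abs_of_nonneg (mul_nonneg (by linarith) (by positivity))]
        exact mul_le_of_le_one_left (by positivity) (by linarith)
    choose z hz using hz
    exact mem_iUnion.2 ⟨z, hz⟩
  have hs : 0 ≤ m + σ := by positivity
  have hsum : ∀ k, ∑ z, ediam (t k z) ^ (m + σ) ≤
      ENNReal.ofReal (2 ^ (m + 2) * b ^ (m + σ)) := by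
    intro k
    calc ∑ z, ediam (t k z) ^ (m + σ)
        ≤ ∑ _z : (∀ i, Fin (c k i)), ENNReal.ofReal (b * (2 ^ N k)⁻¹) ^ (m + σ) := by
          gcongr with z
          exact hdiam k z
      _ = ENNReal.ofReal (2 ^ (α k + 2) * (2 ^ (N k + 1)) ^ m *
            (b * (2 ^ N k)⁻¹) ^ (m + σ)) := by
          rw [Finset.sum_const, Finset.card_univ, Fintype.card_pi, nsmul_eq_mul,
            ENNReal.ofReal_rpow_of_nonneg (by positivity) hs, ENNReal.ofReal_mul (by positivity)]
          congr 1
          simp only [Fintype.card_fin, Fin.prod_univ_succ, hc, Fin.cons_zero, Fin.cons_succ,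
            Finset.prod_const, Finset.card_univ]
          rw [← ENNReal.ofReal_natCast]
          push_cast
          rfl
      _ ≤ _ := by
          refine ENNReal.ofReal_le_ofReal ?_
          have hαN : (α k : ℝ) ≤ σ * N k := by
            refine (Nat.floor_le (by positivity)).trans ?_
            gcongr
            exact Nat.le_add_right _ _
          have h2 : (2 : ℝ) ^ α k ≤ ((2 : ℝ) ^ N k) ^ σ := by
            rw [← Real.rpow_natCast, ← Real.rpow_natCast, ← Real.rpow_mul two_pos.le, mul_comm _ σ]
            exact Real.rpow_le_rpow_of_exponent_le one_le_two hαN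
          have hp : (0 : ℝ) < 2 ^ N k := by positivity
          rw [Real.mul_rpow hb0 (by positivity), Real.inv_rpow hp.le, Real.rpow_add hp,
            Real.rpow_natCast, pow_succ 2 (N k), mul_pow, pow_add 2 (α k), pow_add 2 m]
          have hq : (0 : ℝ) < (2 ^ N k) ^ m := by positivity
          have hq' : (0 : ℝ) < ((2 : ℝ) ^ N k) ^ σ := by positivity
          calc (2 : ℝ) ^ α k * 2 ^ 2 * ((2 ^ N k) ^ m * 2 ^ m) *
                (b ^ (m + σ) * ((2 ^ N k) ^ m * (2 ^ N k) ^ σ)⁻¹)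
              = (2 ^ α k / (2 ^ N k) ^ σ) * (2 ^ m * 2 ^ 2 * b ^ (m + σ)) := by
                field_simp
            _ ≤ 1 * (2 ^ m * 2 ^ 2 * b ^ (m + σ)) := by
                gcongr
                exact (div_le_one hq').2 h2
            _ = _ := one_mul _
  have hlim : Filter.Tendsto (fun k => ENNReal.ofReal (b * (2 ^ N k)⁻¹)) Filter.atTop (nhds 0) := by
    have hNtop : Filter.Tendsto N Filter.atTop Filter.atTop :=
      Filter.tendsto_atTop_mono (fun k => Nat.le_add_left _ _) Filter.tendsto_id
    have h1 : Filter.Tendsto (fun k => b * ((2 : ℝ) ^ N k)⁻¹) Filter.atTop (nhds (b * 0)) :=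
      (tendsto_inv_atTop_zero.comp
        ((tendsto_pow_atTop_atTop_of_one_lt one_lt_two).comp hNtop)).const_mul b
    simpa using ENNReal.tendsto_ofReal h1
  have hfin := Measure.hausdorffMeasure_le_liminf_sum (m + σ) (euclideanBox K) _ hlim t
    (Filter.Eventually.of_forall hdiam) (Filter.Eventually.of_forall hcover)
  have hfin' : μH[m + σ] (euclideanBox K) ≠ ∞ := by
    refine ne_top_of_le_ne_top (ENNReal.ofReal_ne_top (r := 2 ^ (m + 2) * b ^ (m + σ)))
      (hfin.trans ?_)
    exact (Filter.liminf_le_liminf (Filter.Eventually.of_forall hsum)).trans_eq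
      (Filter.liminf_const _)
  refine dimH_le_of_hausdorffMeasure_ne_top ?_
  rwa [Real.coe_toNNReal _ hs]

open scoped Pointwise in
lemma isClosed_latticeSet (a : ℝ) : IsClosed (latticeSet a) := by
  have h : latticeSet a = ⋂ k, (range (fun z : ℤ => (z : ℝ) / 2 ^ ⌊a * blockLen k⌋₊) +
      closedBall (0 : ℝ) (2 ^ (blockLen k + k))⁻¹) := by
    ext x
    simp only [latticeSet, mem_ofPred_eq, mem_iInter, Set.mem_add, mem_range,
      exists_exists_eq_and, mem_closedBall_zero_iff, Real.norm_eq_abs]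
    refine forall_congr' fun k => exists_congr fun z => ⟨fun hz => ⟨_, hz, by ring⟩, ?_⟩
    rintro ⟨y, hy, rfl⟩
    rwa [add_sub_cancel_left]
  rw [h]
  refine isClosed_iInter fun k => IsClosed.add_right_of_isCompact ?_ (isCompact_closedBall _ _)
  have := ((isClosedMap_smul₀ ((2 ^ ⌊a * blockLen k⌋₊ : ℝ)⁻¹)).comp
    Int.isClosedEmbedding_coe_real.isClosedMap).isClosed_range
  convert this using 2
  ext z
  simp [div_eq_inv_mul]

lemma isCompact_euclideanBox {ι : Type*} [Fintype ι] {K : ι → Set ℝ}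
    (hK : ∀ i, IsCompact (K i)) : IsCompact (euclideanBox K) := by
  have h := (isCompact_univ_pi hK).image (PiLp.continuous_toLp 2 fun _ : ι => ℝ)
  convert h using 1
  ext x
  exact ⟨fun hx => ⟨WithLp.ofLp x, fun i _ => hx i, rfl⟩,
    by rintro ⟨y, hy, rfl⟩ i; exact hy i trivial⟩

/-- The values `y - t * v` for `y`, `t`, `v` in the lattice sets with parameters
`1`, `σ` and `1 - σ`. -/
def latticeDifferences (σ : ℝ) : Set ℝ :=
  {u | ∃ y ∈ latticeSet 1 ∩ Icc 0 1, ∃ t ∈ latticeSet σ ∩ Icc 1 2,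
    ∃ v ∈ latticeSet (1 - σ) ∩ Icc 0 1, u = y - t * v}

lemma exists_abs_sub_le_of_mem_latticeDifferences {σ : ℝ} (hσ₀ : 0 ≤ σ) (hσ₁ : σ ≤ 1) {u : ℝ}
    (hu : u ∈ latticeDifferences σ) (k : ℕ) :
    ∃ z ∈ Finset.Icc (-(8 * 2 ^ blockLen k) : ℤ) (8 * 2 ^ blockLen k),
      |u - z / 2 ^ blockLen k| ≤ 6 * (2 ^ (blockLen k + k))⁻¹ := by
  obtain ⟨y, ⟨hy, hy'⟩, t, ⟨ht, ht'⟩, v, ⟨hv, hv'⟩, rfl⟩ := hu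
  obtain ⟨z₃, h₃⟩ := hy k
  obtain ⟨z₁, h₁⟩ := ht k
  obtain ⟨z₂, h₂⟩ := hv k
  rw [one_mul, Nat.floor_natCast] at h₃
  set M := blockLen k with hM
  set α := ⌊σ * M⌋₊ with hα
  set β := ⌊(1 - σ) * M⌋₊ with hβ
  have hαβ : α + β ≤ M := by
    have h1 : (α : ℝ) ≤ σ * M := Nat.floor_le (by positivity)
    have h2 : (β : ℝ) ≤ (1 - σ) * M :=
      Nat.floor_le (mul_nonneg (sub_nonneg.2 hσ₁) (Nat.cast_nonneg _))
    have : (α + β : ℝ) ≤ M := by linarith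
    exact_mod_cast this
  obtain ⟨δ, hδ⟩ := Nat.exists_eq_add_of_le hαβ
  set η : ℝ := (2 ^ (M + k))⁻¹ with hη
  have hη1 : η ≤ 1 := inv_le_one_of_one_le₀ (one_le_pow₀ one_le_two)
  have hη0 : 0 < η := by positivity
  have hz : ((z₃ - z₁ * z₂ * 2 ^ δ : ℤ) : ℝ) / 2 ^ M
      = z₃ / 2 ^ M - (z₁ / 2 ^ α) * (z₂ / 2 ^ β) := by
    rw [hδ, pow_add, pow_add]
    push_cast
    field_simp
  have hbound : |y - t * v - ((z₃ - z₁ * z₂ * 2 ^ δ : ℤ) : ℝ) / 2 ^ M| ≤ 6 * η := by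
    rw [hz]
    set p : ℝ := z₁ / 2 ^ α
    set q : ℝ := z₂ / 2 ^ β
    have e : y - t * v - (z₃ / 2 ^ M - p * q)
        = (y - z₃ / 2 ^ M) - t * (v - q) - (t - p) * q := by ring
    have hq : |q| ≤ 2 := by
      have := abs_le.1 h₂
      exact abs_le.2 ⟨by linarith [hv'.1], by linarith [hv'.2]⟩
    have ht2 : |t| ≤ 2 := abs_le.2 ⟨by linarith [ht'.1], ht'.2⟩
    rw [e]
    calc |(y - z₃ / 2 ^ M) - t * (v - q) - (t - p) * q|
        ≤ |y - z₃ / 2 ^ M| + |t * (v - q)| + |(t - p) * q| :=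
          (abs_sub _ _).trans (by gcongr; exact abs_sub _ _)
      _ ≤ η + 2 * η + η * 2 := by
          rw [abs_mul, abs_mul]
          gcongr
      _ ≤ 6 * η := by linarith
  refine ⟨_, ?_, hbound⟩
  have hp : (0 : ℝ) < 2 ^ M := by positivity
  have hu : |y - t * v| ≤ 2 := by
    refine abs_le.2 ⟨?_, ?_⟩ <;> nlinarith [hy'.1, hy'.2, ht'.1, ht'.2, hv'.1, hv'.2]
  have h1 := abs_le.1 hbound
  have h2 := abs_le.1 hu
  rw [Finset.mem_Icc]
  set w := z₃ - z₁ * z₂ * 2 ^ δ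
  have h3 : (w : ℝ) / 2 ^ M ≤ 8 := by linarith
  have h4 : -8 ≤ (w : ℝ) / 2 ^ M := by linarith
  rw [div_le_iff₀ hp] at h3
  rw [le_div_iff₀ hp] at h4
  constructor
  · have : (-(8 * 2 ^ M) : ℝ) ≤ w := by linarith
    exact_mod_cast this
  · exact_mod_cast h3

lemma volume_latticeDifferences {σ : ℝ} (hσ₀ : 0 ≤ σ) (hσ₁ : σ ≤ 1) :
    volume (latticeDifferences σ) = 0 := by
  have hle : ∀ k : ℕ, volume (latticeDifferences σ) ≤ ENNReal.ofReal (204 * (2 ^ k)⁻¹) := by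
    intro k
    set M := blockLen k with hM
    calc volume (latticeDifferences σ)
        ≤ volume (⋃ z ∈ Finset.Icc (-(8 * 2 ^ M) : ℤ) (8 * 2 ^ M),
            closedBall ((z : ℝ) / 2 ^ M) (6 * (2 ^ (M + k))⁻¹)) := by
          refine measure_mono fun u hu => ?_
          obtain ⟨z, hz, h⟩ := exists_abs_sub_le_of_mem_latticeDifferences hσ₀ hσ₁ hu k
          exact mem_iUnion₂.2 ⟨z, hz, by rwa [mem_closedBall, Real.dist_eq]⟩
      _ ≤ ∑ z ∈ Finset.Icc (-(8 * 2 ^ M) : ℤ) (8 * 2 ^ M),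
            volume (closedBall ((z : ℝ) / 2 ^ M) (6 * (2 ^ (M + k))⁻¹)) :=
          measure_biUnion_finset_le _ _
      _ = ((16 * 2 ^ M + 1 : ℕ) : ℝ≥0∞) * ENNReal.ofReal (2 * (6 * (2 ^ (M + k))⁻¹)) := by
          simp only [Real.volume_closedBall, Finset.sum_const, nsmul_eq_mul, Int.card_Icc]
          congr 2
          have : (8 * 2 ^ M + 1 - -(8 * 2 ^ M) : ℤ) = (16 * 2 ^ M + 1 : ℕ) := by
            push_cast
            ring
          rw [this, Int.toNat_natCast]
      _ ≤ _ := by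
          rw [← ENNReal.ofReal_natCast, ← ENNReal.ofReal_mul (by positivity)]
          refine ENNReal.ofReal_le_ofReal ?_
          push_cast
          have h1 : (1 : ℝ) ≤ 2 ^ M := one_le_pow₀ one_le_two
          rw [pow_add, mul_inv]
          calc (16 * 2 ^ M + 1 : ℝ) * (2 * (6 * ((2 ^ M)⁻¹ * (2 ^ k)⁻¹)))
              ≤ (16 * 2 ^ M + 2 ^ M) * (2 * (6 * ((2 ^ M)⁻¹ * (2 ^ k)⁻¹))) := by gcongr
            _ = 204 * (2 ^ k)⁻¹ := by
              field_simp
              norm_num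
  have hlim : Filter.Tendsto (fun k : ℕ => ENNReal.ofReal (204 * (2 ^ k)⁻¹)) Filter.atTop
      (nhds 0) := by
    have h1 : Filter.Tendsto (fun k : ℕ => 204 * ((2 : ℝ) ^ k)⁻¹) Filter.atTop (nhds (204 * 0)) :=
      (tendsto_inv_atTop_zero.comp (tendsto_pow_atTop_atTop_of_one_lt one_lt_two)).const_mul 204
    simpa using ENNReal.tendsto_ofReal h1
  exact le_antisymm (ge_of_tendsto' hlim hle) zero_le

lemma lipschitzOnWith_normalize (E : Type*) [NormedAddCommGroup E] [NormedSpace ℝ E] :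
    LipschitzOnWith 2 (fun z : E => ‖z‖⁻¹ • z) {z | 1 ≤ ‖z‖} := by
  refine LipschitzOnWith.of_dist_le_mul fun x (hx : 1 ≤ ‖x‖) y (hy : 1 ≤ ‖y‖) => ?_
  have hx0 : 0 < ‖x‖ := by linarith
  have hy0 : 0 < ‖y‖ := by linarith
  rw [dist_eq_norm, dist_eq_norm]
  have e : ‖x‖⁻¹ • x - ‖y‖⁻¹ • y
      = ‖x‖⁻¹ • (x - y) + (‖x‖⁻¹ * (‖y‖ - ‖x‖)) • ‖y‖⁻¹ • y := by
    rw [smul_sub, smul_smul, mul_assoc, sub_mul, mul_inv_cancel₀ hy0.ne', mul_sub, sub_smul,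
      mul_one, ← mul_assoc, inv_mul_cancel₀ hx0.ne', one_mul]
    abel
  have hn : ‖‖y‖⁻¹ • y‖ = 1 := by
    rw [norm_smul, norm_inv, norm_norm, inv_mul_cancel₀ hy0.ne']
  have hx1 : ‖x‖⁻¹ ≤ 1 := inv_le_one_of_one_le₀ hx
  calc ‖‖x‖⁻¹ • x - ‖y‖⁻¹ • y‖
      ≤ ‖‖x‖⁻¹ • (x - y)‖ + ‖(‖x‖⁻¹ * (‖y‖ - ‖x‖)) • ‖y‖⁻¹ • y‖ := by
        rw [e]
        exact norm_add_le _ _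
    _ = ‖x‖⁻¹ * ‖x - y‖ + ‖x‖⁻¹ * |‖y‖ - ‖x‖| := by
        rw [norm_smul _ (x - y), norm_smul _ (‖y‖⁻¹ • y), hn, norm_mul, norm_inv, norm_norm,
          mul_one, Real.norm_eq_abs]
    _ ≤ 1 * ‖x - y‖ + 1 * ‖x - y‖ := by
        gcongr
        rw [abs_sub_comm]
        exact abs_norm_sub_norm_le x y
    _ = ((2 : ℝ≥0) : ℝ) * ‖x - y‖ := by
        rw [NNReal.coe_ofNat]
        ring

lemma hausdorffMeasure_normalize_image_eq_zero {m : ℕ} {W : Set ℝ} (hW : volume W = 0) :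
    μH[(m : ℝ) + 1] ((fun z => ‖z‖⁻¹ • z) ''
      {z : EuclideanSpace ℝ (Fin (m + 2)) | z 0 = 1 ∧ z 1 ∈ W}) = 0 := by
  set S := {z : EuclideanSpace ℝ (Fin (m + 2)) | z 0 = 1 ∧ z 1 ∈ W} with hS
  have hm : (0 : ℝ) ≤ m + 1 := by positivity
  set J : (Fin (m + 1) → ℝ) → EuclideanSpace ℝ (Fin (m + 2)) :=
    fun w => WithLp.toLp 2 (Fin.cons 1 w) with hJ
  have hcons : LipschitzWith 1 (fun w : Fin (m + 1) → ℝ => (Fin.cons 1 w : Fin (m + 2) → ℝ)) := by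
    refine LipschitzWith.of_edist_le fun w w' => edist_pi_le_iff.2 fun i => ?_
    refine Fin.cases ?_ (fun i => ?_) i
    · simp
    · simpa using edist_le_pi_edist w w' i
  have hJL := (PiLp.lipschitzWith_toLp 2 (fun _ : Fin (m + 2) => ℝ)).comp hcons
  have hvol : μH[(m : ℝ) + 1] {w : Fin (m + 1) → ℝ | w 0 ∈ W} = 0 := by
    have h1 : ((Fintype.card (Fin (m + 1)) : ℕ) : ℝ) = (m : ℝ) + 1 := by simp
    rw [← h1, hausdorffMeasure_pi_real, volume_pi]
    exact Measure.pi_eval_preimage_null _ hW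
  have hSJ : S ⊆ J '' {w | w 0 ∈ W} := by
    rintro z ⟨hz0, hz1⟩
    refine ⟨fun i => z i.succ, hz1, ?_⟩
    ext i
    refine Fin.cases ?_ (fun i => ?_) i
    · simp [hJ, hz0]
    · simp [hJ]
  have hS0 : μH[(m : ℝ) + 1] S = 0 := by
    refine measure_mono_null hSJ (le_antisymm ?_ zero_le)
    exact (hJL.hausdorffMeasure_image_le hm _).trans_eq (by rw [hvol, mul_zero])
  have hSn : S ⊆ {z | 1 ≤ ‖z‖} := by
    intro z hz
    have := PiLp.norm_apply_le z 0
    rw [hz.1, norm_one] at this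
    exact this
  refine le_antisymm ?_ zero_le
  refine (((lipschitzOnWith_normalize _).mono hSn).hausdorffMeasure_image_le hm).trans_eq ?_
  rw [hS0, mul_zero]

/-- The projective involution `(t, y) ↦ (1 / t, y / t)`. -/
noncomputable def projectiveInversion {m : ℕ} (x : EuclideanSpace ℝ (Fin (m + 2))) :
    EuclideanSpace ℝ (Fin (m + 2)) :=
  (x 0)⁻¹ • (x + (1 - x 0) • EuclideanSpace.single 0 1)

lemma projectiveInversion_apply_zero {m : ℕ} (x : EuclideanSpace ℝ (Fin (m + 2))) :
    projectiveInversion x 0 = (x 0)⁻¹ := by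
  simp [projectiveInversion]
  ring

lemma projectiveInversion_apply_succ {m : ℕ} (x : EuclideanSpace ℝ (Fin (m + 2)))
    (i : Fin (m + 1)) : projectiveInversion x i.succ = (x 0)⁻¹ * x i.succ := by
  simp [projectiveInversion]

lemma projectiveInversion_projectiveInversion {m : ℕ} {x : EuclideanSpace ℝ (Fin (m + 2))}
    (hx : x 0 ≠ 0) : projectiveInversion (projectiveInversion x) = x := by
  ext i
  refine Fin.cases ?_ (fun i => ?_) i
  · rw [projectiveInversion_apply_zero, projectiveInversion_apply_zero, inv_inv]
  · rw [projectiveInversion_apply_succ, projectiveInversion_apply_zero,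
      projectiveInversion_apply_succ, inv_inv, mul_inv_cancel_left₀ hx]

lemma contDiffOn_projectiveInversion (m : ℕ) :
    ContDiffOn ℝ 1 (projectiveInversion (m := m)) {x | 0 < x 0} := by
  have h0 : ContDiff ℝ 1 fun x : EuclideanSpace ℝ (Fin (m + 2)) => x 0 :=
    contDiff_euclidean.1 contDiff_id 0
  exact (h0.contDiffOn.inv fun x hx => ne_of_gt hx).smul
    (contDiff_id.add ((contDiff_const.sub h0).smul contDiff_const)).contDiffOn

lemma dimH_projectiveInversion_image {m : ℕ} {A : Set (EuclideanSpace ℝ (Fin (m + 2)))}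
    (hA : ∀ x ∈ A, 0 < x 0) : dimH (projectiveInversion '' A) = dimH A := by
  have hc : Convex ℝ {x : EuclideanSpace ℝ (Fin (m + 2)) | 0 < x 0} :=
    convex_halfSpace_gt (f := fun x : EuclideanSpace ℝ (Fin (m + 2)) => x 0)
      ⟨fun _ _ => rfl, fun _ _ => rfl⟩ 0
  have hd := contDiffOn_projectiveInversion m
  refine le_antisymm (hd.dimH_image_le hc hA) ?_
  have h : projectiveInversion '' (projectiveInversion '' A) = A := by
    rw [image_image]
    exact (image_congr fun x hx =>
      projectiveInversion_projectiveInversion (hA x hx).ne').trans (image_id A)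
  calc dimH A = dimH (projectiveInversion '' (projectiveInversion '' A)) := by rw [h]
    _ ≤ _ := by
      refine hd.dimH_image_le hc ?_
      rintro _ ⟨x, hx, rfl⟩
      change 0 < projectiveInversion x 0
      rw [projectiveInversion_apply_zero]
      exact inv_pos.2 (hA x hx)

/-- The factors of the box whose projective image is nearly invisible from many points. -/
def targetFactor (m : ℕ) (σ : ℝ) : Fin (m + 2) → Set ℝ :=
  Fin.cons (latticeSet σ ∩ Icc 1 2) (Fin.cons (latticeSet 1 ∩ Icc 0 1) fun _ => Icc 0 1)

/-- The factors of the box of points from which the target is invisible. -/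
def sourceFactor (m : ℕ) (σ : ℝ) : Fin (m + 2) → Set ℝ :=
  Fin.cons {0} (Fin.cons (latticeSet (1 - σ) ∩ Icc 0 1) fun _ => Icc 0 1)

lemma isCompact_targetFactor (m : ℕ) (σ : ℝ) (i : Fin (m + 2)) :
    IsCompact (targetFactor m σ i) := by
  refine Fin.cases ?_ (Fin.cases ?_ fun i => ?_) i
  · exact isCompact_Icc.inter_left (isClosed_latticeSet σ)
  · exact isCompact_Icc.inter_left (isClosed_latticeSet 1)
  · exact isCompact_Icc

lemma zero_lt_of_mem_target {m : ℕ} {σ : ℝ} {x : EuclideanSpace ℝ (Fin (m + 2))}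
    (hx : x ∈ euclideanBox (targetFactor m σ)) : 0 < x 0 :=
  one_pos.trans_le (hx 0).2.1

lemma ofReal_le_of_forall_sub {c ε₀ : ℝ} (hε₀ : 0 < ε₀) {D : ℝ≥0∞}
    (h : ∀ ε, 0 < ε → ε < ε₀ → ENNReal.ofReal (c - 2 * ε) ≤ D) : ENNReal.ofReal c ≤ D := by
  have hlim : Filter.Tendsto (fun ε : ℝ => ENNReal.ofReal (c - 2 * ε)) (nhdsWithin 0 (Ioi 0))
      (nhds (ENNReal.ofReal c)) := by
    have h1 : Continuous fun ε : ℝ => ENNReal.ofReal (c - 2 * ε) :=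
      ENNReal.continuous_ofReal.comp (by fun_prop)
    simpa using (h1.tendsto 0).mono_left nhdsWithin_le_nhds
  refine le_of_tendsto hlim ?_
  filter_upwards [Ioo_mem_nhdsGT hε₀] with ε hε using h ε hε.1 hε.2

lemma dimH_target {m : ℕ} {σ : ℝ} (hσ₀ : 0 < σ) (hσ₁ : σ < 1) :
    dimH (euclideanBox (targetFactor m σ)) = ENNReal.ofReal (m + 1 + σ) := by
  refine le_antisymm ?_ (ofReal_le_of_forall_sub hσ₀ fun ε hε hεσ => ?_)
  · have h := dimH_euclideanBox_le (m := m + 1) hσ₀.le (K := targetFactor m σ) Subset.rfl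
      fun i => by
        refine Fin.cases ?_ (fun i => ?_) i
        · exact inter_subset_right
        · exact Subset.rfl
    simpa using h
  · have h := le_dimH_euclideanBox (K := targetFactor m σ)
      (d := Fin.cons (σ - ε) (Fin.cons (1 - ε) fun _ => 1))
      (Fin.cases (by simpa using hεσ.le) (Fin.cases (by simp; linarith) (by simp)))
      (Fin.cases
        (containsInvHolderImage_latticeSet_inter_Icc_one_two hσ₀ hσ₁.le
          (by simpa using hεσ) (by simpa using hε))
        (Fin.cases
          (containsInvHolderImage_latticeSet_inter_Icc_zero_one one_pos le_rfl
            (by simp; linarith) (by simpa using hε))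
          fun _ => containsInvHolderImage_Icc))
    refine le_trans (le_of_eq ?_) h
    simp only [Fin.sum_univ_succ, Fin.cons_zero, Fin.cons_succ, Finset.sum_const,
      Finset.card_univ, Fintype.card_fin, nsmul_eq_mul]
    congr 1
    ring

lemma le_dimH_source {m : ℕ} {σ : ℝ} (hσ₀ : 0 < σ) (hσ₁ : σ < 1) :
    ENNReal.ofReal (m + 1 - σ) ≤ dimH (euclideanBox (sourceFactor m σ)) := by
  refine ofReal_le_of_forall_sub (ε₀ := (1 - σ) / 2) (by linarith) fun ε hε hεσ => ?_
  have h := le_dimH_euclideanBox (K := sourceFactor m σ)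
    (d := Fin.cons 0 (Fin.cons (1 - σ - 2 * ε) fun _ => 1))
    (Fin.cases (by simp) (Fin.cases (by simp; linarith) (by simp)))
    (Fin.cases (containsInvHolderImage_singleton 0)
      (Fin.cases
        (containsInvHolderImage_latticeSet_inter_Icc_zero_one (by linarith) (by linarith)
          (by simp; linarith) (by simpa using hε))
        fun _ => containsInvHolderImage_Icc))
  refine le_trans (le_of_eq ?_) h
  simp only [Fin.sum_univ_succ, Fin.cons_zero, Fin.cons_succ, Finset.sum_const,
    Finset.card_univ, Fintype.card_fin, nsmul_eq_mul]
  congr 1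
  ring

lemma radialProj_target_subset {m : ℕ} {σ : ℝ} {v : EuclideanSpace ℝ (Fin (m + 2))}
    (hv : v ∈ euclideanBox (sourceFactor m σ)) :
    radialProj v (projectiveInversion '' euclideanBox (targetFactor m σ)) ⊆
      (fun z => ‖z‖⁻¹ • z) '' {z | z 0 = 1 ∧ z 1 ∈ latticeDifferences σ} := by
  rintro _ ⟨_, ⟨⟨x, hx, rfl⟩, -⟩, rfl⟩
  have ht := zero_lt_of_mem_target hx
  have hv0 : v 0 = 0 := hv 0
  set z := x + (1 - x 0) • EuclideanSpace.single 0 1 - x 0 • v with hz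
  have e : projectiveInversion x - v = (x 0)⁻¹ • z := by
    rw [hz, smul_sub, smul_smul, inv_mul_cancel₀ ht.ne', one_smul, projectiveInversion]
  refine ⟨z, ⟨by simp [hz, hv0], x 1, hx 1, x 0, hx 0, v 1, hv 1, by simp [hz]⟩, ?_⟩
  simp only [e]
  rw [norm_smul, norm_inv, Real.norm_of_nonneg ht.le, mul_inv, inv_inv, smul_smul, mul_right_comm,
    mul_inv_cancel₀ ht.ne', one_mul]

/-- **Sharpness of the visibility exceptional set estimate.** For every `n ≥ 2` and
`n - 1 < s < n` there is a compact set `B ⊆ ℝⁿ` with `dim B = s` whose invisibility set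
has Hausdorff dimension at least `2(n-1) - s`. -/
theorem visibility_exceptional_set_sharp (n : ℕ) (hn : 2 ≤ n) (s : ℝ)
    (hs₁ : (n : ℝ) - 1 < s) (hs₂ : s < n) :
    ∃ B : Set (EuclideanSpace ℝ (Fin n)), IsCompact B ∧ dimH B = ENNReal.ofReal s ∧
      ENNReal.ofReal (2 * ((n : ℝ) - 1) - s) ≤
        dimH {x : EuclideanSpace ℝ (Fin n) | μH[(n : ℝ) - 1] (radialProj x B) = 0} := by
  obtain ⟨m, rfl⟩ := Nat.exists_eq_add_of_le' hn
  obtain ⟨σ, rfl⟩ : ∃ σ, s = m + 1 + σ := ⟨s - (m + 1), by ring⟩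
  push_cast at hs₁ hs₂ ⊢
  have hσ₀ : 0 < σ := by linarith
  have hσ₁ : σ < 1 := by linarith
  refine ⟨projectiveInversion '' euclideanBox (targetFactor m σ), ?_, ?_, ?_⟩
  · exact (isCompact_euclideanBox (isCompact_targetFactor m σ)).image_of_continuousOn
      ((contDiffOn_projectiveInversion m).continuousOn.mono fun x hx => zero_lt_of_mem_target hx)
  · rw [dimH_projectiveInversion_image fun x hx => zero_lt_of_mem_target hx]
    exact dimH_target hσ₀ hσ₁
  · have e1 : 2 * ((m : ℝ) + 2 - 1) - (m + 1 + σ) = m + 1 - σ := by ring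
    have e2 : (m : ℝ) + 2 - 1 = m + 1 := by ring
    rw [e1, e2]
    refine (le_dimH_source hσ₀ hσ₁).trans (dimH_mono fun v hv => ?_)
    exact measure_mono_null (radialProj_target_subset hv)
      (hausdorffMeasure_normalize_image_eq_zero (volume_latticeDifferences hσ₀.le hσ₁.le))
end

section
/- Let n ≥ 2 and let B ⊆ ℝⁿ be compact. Then the set E := {x ∈ ℝⁿ : H^{n−1}(π_x(B \ {x})) = 0} is a Borel subset of ℝⁿ. -/
open MeasureTheory Metric Set
open scoped ENNReal NNReal

/-- The image of a compact subset of `vᗮ` under inverse stereographic projection from `v` has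
finite codimension-one Hausdorff measure. -/
theorem hausdorffMeasure_stereoInvFunAux_image_lt_top {E : Type*} [NormedAddCommGroup E]
    [InnerProductSpace ℝ E] [MeasurableSpace E] [BorelSpace E] {m : ℕ}
    [Fact (Module.finrank ℝ E = m + 1)] {v : E} (hv : v ≠ 0)
    {K : Set (Submodule.span ℝ {v})ᗮ} (hK : IsCompact K) :
    μH[(m : ℝ)] ((fun w : (Submodule.span ℝ {v})ᗮ => stereoInvFunAux v (w : E)) '' K) < ∞ := by
  have : FiniteDimensional ℝ E := .of_fact_finrank_eq_succ m
  have hsmooth : ContDiff ℝ 1 fun w : (Submodule.span ℝ {v})ᗮ => stereoInvFunAux v (w : E) :=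
    contDiff_stereoInvFunAux.comp (Submodule.span ℝ {v})ᗮ.subtypeL.contDiff
  obtain ⟨C, hC⟩ :=
    hsmooth.locallyLipschitz.locallyLipschitzOn.exists_lipschitzOnWith_of_compact hK
  have hd : Module.finrank ℝ (Submodule.span ℝ {v})ᗮ = m :=
    Submodule.finrank_orthogonal_span_singleton hv
  have hfin : μH[(m : ℝ)] K < ∞ := by
    rw [← hd]
    exact hK.measure_lt_top
  refine (hC.hausdorffMeasure_image_le m.cast_nonneg).trans_lt (ENNReal.mul_lt_top ?_ hfin)
  exact ENNReal.rpow_lt_top_of_nonneg m.cast_nonneg ENNReal.coe_ne_top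

/-- The codimension-one Hausdorff measure on the unit sphere is σ-finite. -/
theorem sigmaFinite_hausdorffMeasure_restrict_sphere {E : Type*} [NormedAddCommGroup E]
    [InnerProductSpace ℝ E] [MeasurableSpace E] [BorelSpace E] {m : ℕ}
    [Fact (Module.finrank ℝ E = m + 1)] :
    SigmaFinite ((μH[(m : ℝ)] : Measure E).restrict (sphere 0 1)) := by
  have : FiniteDimensional ℝ E := .of_fact_finrank_eq_succ m
  have : Nontrivial E := Module.nontrivial_of_finrank_eq_succ (R := ℝ) (Fact.out (p := _ = m + 1))
  obtain ⟨v, hv⟩ := exists_norm_eq E zero_le_one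
  have hv0 : v ≠ 0 := norm_ne_zero_iff.mp (by simp [hv])
  let S : ℕ → Set E := fun k =>
    (fun w : (Submodule.span ℝ {v})ᗮ => stereoInvFunAux v (w : E)) '' closedBall 0 k
  refine Measure.sigmaFinite_of_countable (S := {(sphere 0 1)ᶜ, {v}} ∪ range S)
    ((to_countable _).union (countable_range S)) ?_ ?_
  · rintro s ((rfl | rfl) | ⟨k, rfl⟩)
    · simp [Measure.restrict_apply isClosed_sphere.measurableSet.compl]
    · exact (Measure.restrict_apply_le _ _).trans_lt <|
        (Measure.hausdorffMeasure_le_one_of_subsingleton subsingleton_singleton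
          m.cast_nonneg).trans_lt ENNReal.one_lt_top
    · exact (Measure.restrict_apply_le _ _).trans_lt <|
        hausdorffMeasure_stereoInvFunAux_image_lt_top hv0 (isCompact_closedBall 0 _)
  · refine eq_univ_of_forall fun x => ?_
    by_cases hx : x ∈ sphere (0 : E) 1
    · by_cases hxv : x = v
      · exact ⟨{v}, by simp, hxv⟩
      · obtain ⟨k, hk⟩ := exists_nat_ge ‖stereoToFun v x‖
        refine ⟨S k, .inr ⟨k, rfl⟩, stereoToFun v x, by simpa using hk, ?_⟩
        exact congrArg Subtype.val (stereo_left_inv hv (x := ⟨x, hx⟩) hxv)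
    · exact ⟨(sphere 0 1)ᶜ, by simp, hx⟩

/-- The pairs of a base point and a direction in which a compact set is visible at distance at
least `r` form a closed set. -/
theorem isClosed_visible_directions {E : Type*} [NormedAddCommGroup E] [NormedSpace ℝ E]
    {B : Set E} (hB : IsCompact B) (r : ℝ) :
    IsClosed {p : E × E | ∃ y ∈ B, r ≤ ‖y - p.1‖ ∧ ‖y - p.1‖ • p.2 = y - p.1} := by
  have : CompactSpace B := isCompact_iff_compactSpace.mp hB
  have hclosed : IsClosed {q : B × (E × E) |
      r ≤ ‖(q.1 : E) - q.2.1‖ ∧ ‖(q.1 : E) - q.2.1‖ • q.2.2 = q.1 - q.2.1} := by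
    rw [ofPred_and]
    exact (isClosed_le (by fun_prop) (by fun_prop)).inter
      (isClosed_eq (by fun_prop) (by fun_prop))
  convert isClosedMap_snd_of_compactSpace _ hclosed using 1
  ext p
  simp [and_left_comm]

theorem radialProj_subset_sphere {n : ℕ} (x : EuclideanSpace ℝ (Fin n))
    (B : Set (EuclideanSpace ℝ (Fin n))) : radialProj x B ⊆ sphere 0 1 := by
  rintro _ ⟨y, ⟨-, hy⟩, rfl⟩
  have : ‖y - x‖ ≠ 0 := norm_ne_zero_iff.mpr (sub_ne_zero.mpr hy)
  simp [norm_smul, this]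

/-- The graph of `x ↦ radialProj x B` is a Borel set when `B` is compact. -/
theorem measurableSet_mem_radialProj {n : ℕ} {B : Set (EuclideanSpace ℝ (Fin n))}
    (hB : IsCompact B) :
    MeasurableSet {p : EuclideanSpace ℝ (Fin n) × EuclideanSpace ℝ (Fin n) |
      p.2 ∈ radialProj p.1 B} := by
  convert MeasurableSet.iUnion fun k : ℕ =>
    (isClosed_visible_directions hB (1 / ((k : ℝ) + 1))).measurableSet using 1
  ext ⟨x, v⟩
  simp only [mem_ofPred_eq, mem_iUnion]
  constructor
  · rintro ⟨y, ⟨hy, hyx⟩, rfl⟩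
    have hpos : 0 < ‖y - x‖ := norm_pos_iff.mpr (sub_ne_zero.mpr hyx)
    obtain ⟨k, hk⟩ := exists_nat_one_div_lt hpos
    exact ⟨k, y, hy, hk.le, smul_inv_smul₀ hpos.ne' _⟩
  · rintro ⟨k, y, hy, hk, hv⟩
    have hpos : 0 < ‖y - x‖ := Nat.one_div_pos_of_nat.trans_le hk
    refine ⟨y, ⟨hy, fun h => hpos.ne' ?_⟩, ?_⟩
    · simp [mem_singleton_iff.mp h]
    · exact (inv_smul_eq_iff₀ hpos.ne').mpr hv.symm

/-- For a compact set `B ⊆ ℝⁿ`, the set of points from which `B` is invisible,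
`E = {x : H^{n-1}(π_x(B)) = 0}`, is a Borel set. -/
theorem invisibility_set_borel (n : ℕ) (hn : 2 ≤ n)
    (B : Set (EuclideanSpace ℝ (Fin n))) (hB : IsCompact B) :
    MeasurableSet {x : EuclideanSpace ℝ (Fin n) | μH[(n : ℝ) - 1] (radialProj x B) = 0} := by
  obtain ⟨m, rfl⟩ : ∃ m, n = m + 1 := ⟨n - 1, by omega⟩
  have : Fact (Module.finrank ℝ (EuclideanSpace ℝ (Fin (m + 1))) = m + 1) := ⟨by simp⟩
  have := sigmaFinite_hausdorffMeasure_restrict_sphere (m := m)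
    (E := EuclideanSpace ℝ (Fin (m + 1)))
  have hmeas := measurable_measure_prodMk_left
    (ν := (μH[(m : ℝ)] : Measure (EuclideanSpace ℝ (Fin (m + 1)))).restrict (sphere 0 1))
    (measurableSet_mem_radialProj hB)
  convert hmeas (measurableSet_singleton 0) using 1
  ext x
  have hx : (Prod.mk x ⁻¹' {p : EuclideanSpace ℝ (Fin (m + 1)) × EuclideanSpace ℝ (Fin (m + 1)) |
      p.2 ∈ radialProj p.1 B}) = radialProj x B := rfl
  simp only [mem_ofPred_eq, mem_preimage, mem_singleton_iff, hx]
  rw [Measure.restrict_eq_self _ (radialProj_subset_sphere x B)]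
  simp
end
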